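/- arXiv:2511.17325 — 2 statements merged into one kernel-verified Lean document; each statement's English description precedes it below -/
import Mathlib

section
/- Let n ≥ 1 and 0 < s < 1. Let Ω ⊂ ℝⁿ be a domain whose boundary is locally of class C^{1,1}, fix a point x₀ ∈ ∂Ω and write B_r = B_r(x₀). Let g ∈ L^∞(Ω ∩ B_4) and let u ∈ C^{1,1}_{loc}(Ω ∩ B_4) ∩ L_{2s} be nonnegative on ℝⁿ and a classical solution of (-Δ)^s u = g in Ω ∩ B_4 with u = 0 in B_4 \ Ω. Then u ∈ C^s(Ω ∩ B_{1/2}) and ‖u‖_{C^s(Ω ∩ B_{1/2})} ≤ C (‖g‖_{L^∞(Ω ∩ B_4)} + ‖u‖_{L^∞(Ω ∩ B_4)}), where C depends only on n, s and the local C^{1,1} norm of ∂Ω. -/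
open MeasureTheory Metric Set Filter
open scoped Topology NNReal ENNReal RealInnerProductSpace

noncomputable section

/-- `n`-dimensional Euclidean space `ℝⁿ`. -/
abbrev Euc (n : ℕ) := EuclideanSpace ℝ (Fin n)

/-- The standard normalization constant `C_{n,s}` of the fractional Laplacian,
`C_{n,s} = 4^s Γ(n/2+s) / (π^{n/2} |Γ(-s)|) = s·4^s·Γ(n/2+s) / (π^{n/2} Γ(1-s))`. -/
def fracC (n : ℕ) (s : ℝ) : ℝ :=
  s * 4 ^ s * Real.Gamma ((n : ℝ) / 2 + s) /
    (Real.pi ^ ((n : ℝ) / 2) * Real.Gamma (1 - s))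

/-- `(-Δ)^s u (x) = v` in the classical (Cauchy principal value) sense: the truncated
integrals `C_{n,s} ∫_{|x-y| ≥ ε} (u(x) - u(y))/|x-y|^{n+2s} dy` tend to `v` as `ε → 0⁺`. -/
def HasFracLapAt (n : ℕ) (s : ℝ) (u : Euc n → ℝ) (x : Euc n) (v : ℝ) : Prop :=
  Tendsto (fun ε : ℝ =>
      fracC n s *
        ∫ y in {y : Euc n | ε ≤ dist x y}, (u x - u y) / dist x y ^ ((n : ℝ) + 2 * s))
    (𝓝[>] (0 : ℝ)) (𝓝 v)

/-- The tail space `L_{2s}`: locally integrable functions with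
`∫_{ℝⁿ} |u(y)|/(1+|y|^{n+2s}) dy < ∞`. -/
def MemL2s (n : ℕ) (s : ℝ) (u : Euc n → ℝ) : Prop :=
  LocallyIntegrable u volume ∧
    Integrable (fun y : Euc n => |u y| / (1 + ‖y‖ ^ ((n : ℝ) + 2 * s))) volume

/-- The `L_{2s}` norm `‖u‖_{L_{2s}} = ∫_{ℝⁿ} |u(y)|/(1+|y|^{n+2s}) dy`. -/
def l2sNorm (n : ℕ) (s : ℝ) (u : Euc n → ℝ) : ℝ :=
  ∫ y : Euc n, |u y| / (1 + ‖y‖ ^ ((n : ℝ) + 2 * s))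

/-- `u ∈ C^{1,1}_{loc}(Ω)`: near every point of `Ω`, `u` is `C^1` with a Lipschitz
continuous derivative. -/
def C11LocOn (n : ℕ) (u : Euc n → ℝ) (Ω : Set (Euc n)) : Prop :=
  ∀ x ∈ Ω, ∃ ε > 0, ball x ε ⊆ Ω ∧ ContDiffOn ℝ 1 u (ball x ε) ∧
    ∃ L : ℝ≥0, LipschitzOnWith L (fun y => fderiv ℝ u y) (ball x ε)

/-- The `C^γ(K)` norm (`0 < γ < 1`) of `u` is bounded by `A`: both the sup norm and the
`γ`-Hölder seminorm of `u` on `K` are at most `A`. -/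
def HolderBoundOn (n : ℕ) (γ : ℝ) (u : Euc n → ℝ) (K : Set (Euc n)) (A : ℝ) : Prop :=
  (∀ x ∈ K, |u x| ≤ A) ∧ ∀ x ∈ K, ∀ y ∈ K, |u x - u y| ≤ A * dist x y ^ γ

/-- Two-sided (interior and exterior) tangent ball condition of radius `ρ` at a boundary
point `z` of `Ω`.  A uniform two-sided ball condition is the standard geometric
characterization of a (locally) `C^{1,1}` boundary: the radius `ρ` is controlled by the
local `C^{1,1}` norm of `∂Ω` and vice versa. -/
def TwoSidedBallAt (n : ℕ) (Ω : Set (Euc n)) (ρ : ℝ) (z : Euc n) : Prop :=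
  ∃ ν : Euc n, ‖ν‖ = 1 ∧ ball (z + ρ • ν) ρ ⊆ Ω ∧ ball (z - ρ • ν) ρ ⊆ Ωᶜ

namespace FracLap

section

variable {n : ℕ}

/-- The kernel `|z|^{-(n+2s)}`. -/
def ker (n : ℕ) (s : ℝ) (z : Euc n) : ℝ := ‖z‖ ^ (-((n : ℝ) + 2 * s))

/-- The area of the unit sphere of `ℝⁿ`. -/
def sphereArea (n : ℕ) : ℝ := n * volume.real (ball (0 : Euc n) 1)

theorem measurableSet_far (r : ℝ) : MeasurableSet {z : Euc n | r ≤ ‖z‖} :=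
  (isClosed_le continuous_const continuous_norm).measurableSet

theorem measurableSet_near (r : ℝ) : MeasurableSet {z : Euc n | ‖z‖ < r} :=
  (isOpen_lt continuous_norm continuous_const).measurableSet

theorem ker_nonneg (s : ℝ) (z : Euc n) : 0 ≤ ker n s z := by unfold ker; positivity

theorem ker_neg (s : ℝ) (z : Euc n) : ker n s (-z) = ker n s z := by simp [ker]

theorem measurable_ker (s : ℝ) : Measurable (ker n s) := by unfold ker; fun_prop

theorem pow_mul_rpow_sub_one (h : n ≠ 0) {y : ℝ} (hy : 0 < y) (q : ℝ) :
    y ^ (n - 1) * y ^ (-(n : ℝ) + q) = y ^ (q - 1) := by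
  rw [← Real.rpow_natCast, ← Real.rpow_add hy]
  congr 1
  rw [Nat.cast_sub (by omega)]; push_cast; ring

variable [NeZero n]

theorem sphereArea_pos : 0 < sphereArea n := by
  have : 0 < volume.real (ball (0 : Euc n) 1) :=
    ENNReal.toReal_pos (measure_ball_pos _ _ one_pos).ne' measure_ball_lt_top.ne
  have := Nat.pos_of_ne_zero (NeZero.ne n)
  unfold sphereArea; positivity

theorem far_rpow {q r : ℝ} (hq : 0 < q) (hr : 0 < r) :
    IntegrableOn (fun z : Euc n => ‖z‖ ^ (-((n : ℝ) + q))) {z | r ≤ ‖z‖} ∧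
    ∫ z in {z : Euc n | r ≤ ‖z‖}, ‖z‖ ^ (-((n : ℝ) + q)) = sphereArea n * (r ^ (-q) / q) := by
  have hn : n ≠ 0 := NeZero.ne n
  set f : ℝ → ℝ := (Ici r).indicator (fun t => t ^ (-((n : ℝ) + q))) with hf
  have hind : (fun z : Euc n => f ‖z‖) =
      {z : Euc n | r ≤ ‖z‖}.indicator (fun z => ‖z‖ ^ (-((n : ℝ) + q))) := by
    ext z; simp [f, indicator]
  have h1 : ∀ y ∈ Ioi (0 : ℝ), y ^ (n - 1) • f y =
      (Ici r).indicator (fun t => t ^ (-q - 1)) y := by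
    intro y hy
    by_cases h : r ≤ y
    · simp only [f, indicator, mem_Ici, h, if_true, smul_eq_mul]
      rw [← pow_mul_rpow_sub_one hn hy]; ring_nf
    · simp [f, indicator, h]
  have hI : IntegrableOn (fun t : ℝ => t ^ (-q - 1)) (Ici r) := by
    rw [integrableOn_Ici_iff_integrableOn_Ioi]
    exact integrableOn_Ioi_rpow_of_lt (by linarith) hr
  constructor
  · rw [← integrable_indicator_iff (measurableSet_far r), ← hind,
      integrable_fun_norm_addHaar, finrank_euclideanSpace_fin,
      integrableOn_congr_fun h1 measurableSet_Ioi]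
    exact ((integrable_indicator_iff measurableSet_Ici).2 hI).integrableOn
  · rw [← integral_indicator (measurableSet_far r), ← hind,
      integral_fun_norm_addHaar, finrank_euclideanSpace_fin,
      setIntegral_congr_fun measurableSet_Ioi h1, setIntegral_indicator measurableSet_Ici,
      inter_eq_right.2 (Ici_subset_Ioi.2 hr), integral_Ici_eq_integral_Ioi,
      integral_Ioi_rpow_of_lt (by linarith) hr, nsmul_eq_mul, smul_eq_mul, sphereArea, mul_assoc]
    congr 2
    rw [show -q - 1 + 1 = -q by ring]; field_simp

theorem near_rpow {q r : ℝ} (hq : 0 < q) (hr : 0 < r) :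
    IntegrableOn (fun z : Euc n => ‖z‖ ^ (-(n : ℝ) + q)) {z | ‖z‖ < r} ∧
    ∫ z in {z : Euc n | ‖z‖ < r}, ‖z‖ ^ (-(n : ℝ) + q) = sphereArea n * (r ^ q / q) := by
  have hn : n ≠ 0 := NeZero.ne n
  set f : ℝ → ℝ := (Iio r).indicator (fun t => t ^ (-(n : ℝ) + q)) with hf
  have hind : (fun z : Euc n => f ‖z‖) =
      {z : Euc n | ‖z‖ < r}.indicator (fun z => ‖z‖ ^ (-(n : ℝ) + q)) := by
    ext z; simp [f, indicator]
  have h1 : ∀ y ∈ Ioi (0 : ℝ), y ^ (n - 1) • f y =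
      (Iio r).indicator (fun t => t ^ (q - 1)) y := by
    intro y hy
    by_cases h : y < r
    · simp only [f, indicator, mem_Iio, h, if_true, smul_eq_mul]
      exact pow_mul_rpow_sub_one hn hy q
    · simp [f, indicator, h]
  have hI : IntegrableOn (fun t : ℝ => t ^ (q - 1)) (Ioo 0 r) :=
    (intervalIntegral.integrableOn_Ioo_rpow_iff hr).2 (by linarith)
  have hs : Ioi (0 : ℝ) ∩ Iio r = Ioo 0 r := rfl
  constructor
  · rw [← integrable_indicator_iff (measurableSet_near r), ← hind,
      integrable_fun_norm_addHaar, finrank_euclideanSpace_fin,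
      integrableOn_congr_fun h1 measurableSet_Ioi, IntegrableOn,
      integrable_indicator_iff measurableSet_Iio, IntegrableOn,
      Measure.restrict_restrict measurableSet_Iio, inter_comm, hs]
    exact hI
  · rw [← integral_indicator (measurableSet_near r), ← hind,
      integral_fun_norm_addHaar, finrank_euclideanSpace_fin,
      setIntegral_congr_fun measurableSet_Ioi h1, setIntegral_indicator measurableSet_Iio,
      hs, ← integral_Ioc_eq_integral_Ioo, ← intervalIntegral.integral_of_le hr.le,
      integral_rpow (Or.inl (by linarith)), nsmul_eq_mul, smul_eq_mul, sphereArea, mul_assoc]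
    congr 2
    rw [show q - 1 + 1 = q by ring, Real.zero_rpow hq.ne']; ring

end

/-- Second difference at `1` of the function `t ↦ t₊ˢ`. -/
def secDiff (s t : ℝ) : ℝ := 2 - (max (1 + t) 0) ^ s - (max (1 - t) 0) ^ s

theorem secDiff_neg (s t : ℝ) : secDiff s (-t) = secDiff s t := by
  unfold secDiff; rw [sub_neg_eq_add, ← sub_eq_add_neg]; ring

theorem secDiff_zero (s : ℝ) : secDiff s 0 = 0 := by
  simp [secDiff]; norm_num

theorem continuous_secDiff {s : ℝ} (hs : 0 < s) : Continuous (secDiff s) := by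
  unfold secDiff
  refine (continuous_const.sub ?_).sub ?_
  · exact Continuous.rpow_const (by fun_prop) (fun _ => Or.inr hs.le)
  · exact Continuous.rpow_const (by fun_prop) (fun _ => Or.inr hs.le)

theorem one_add_rpow_le {s : ℝ} (hs1 : s < 1) {t : ℝ} (ht : 0 ≤ t) :
    (1 + t) ^ s ≤ 1 + t :=
  (Real.rpow_le_rpow_of_exponent_le (by linarith) hs1.le).trans_eq (Real.rpow_one _)

theorem abs_secDiff_le_sq_of_nonneg {s : ℝ} (hs0 : 0 < s) (hs1 : s < 1) {t : ℝ} (ht : 0 ≤ t) :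
    |secDiff s t| ≤ 2 * t ^ 2 := by
  unfold secDiff
  rw [max_eq_left (by linarith : 0 ≤ 1 + t)]
  rcases le_total t 1 with h | h
  · rw [max_eq_left (by linarith : 0 ≤ 1 - t)]
    set a := (1 + t) ^ s with ha
    set b := (1 - t) ^ s with hb
    have ha0 : 0 ≤ a := by positivity
    have hb0 : 0 ≤ b := Real.rpow_nonneg (by linarith) _
    have ha1 : a ≤ 1 + s * t := rpow_one_add_le_one_add_mul_self (by linarith) hs0.le hs1.le
    have hb1 : b ≤ 1 + s * (-t) := by
      have := rpow_one_add_le_one_add_mul_self (s := -t) (by linarith) hs0.le hs1.le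
      rwa [← sub_eq_add_neg] at this
    have hab : 1 - t ^ 2 ≤ a * b := by
      rw [ha, hb, ← Real.mul_rpow (by linarith) (by linarith)]
      have h0 : 0 ≤ (1 + t) * (1 - t) := mul_nonneg (by linarith) (by linarith)
      have h1 : (1 + t) * (1 - t) ≤ 1 := by nlinarith
      calc 1 - t ^ 2 = ((1 + t) * (1 - t)) ^ (1 : ℝ) := by rw [Real.rpow_one]; ring
        _ ≤ _ := Real.rpow_le_rpow_of_exponent_ge' h0 h1 hs0.le hs1.le
    rw [abs_le]; constructor
    · nlinarith
    · by_contra hcon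
      push Not at hcon
      have h3 : a + b < 2 - 2 * t ^ 2 := by linarith
      nlinarith [sq_nonneg (a - b), sq_nonneg t]
  · rw [max_eq_right (by linarith : 1 - t ≤ 0), Real.zero_rpow hs0.ne']
    have h1 := one_add_rpow_le hs1 ht
    have h2 : 0 ≤ (1 + t) ^ s := by positivity
    rw [abs_le]; constructor <;> nlinarith

theorem abs_secDiff_le_sq {s : ℝ} (hs0 : 0 < s) (hs1 : s < 1) (t : ℝ) :
    |secDiff s t| ≤ 2 * t ^ 2 := by
  rcases le_total 0 t with h | h
  · exact abs_secDiff_le_sq_of_nonneg hs0 hs1 h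
  · rw [← secDiff_neg, ← neg_sq]
    exact abs_secDiff_le_sq_of_nonneg hs0 hs1 (by linarith)

theorem rpow_add_le {s : ℝ} (hs0 : 0 < s) (hs1 : s < 1) {a b : ℝ} (ha : 0 ≤ a) (hb : 0 ≤ b) :
    (a + b) ^ s ≤ a ^ s + b ^ s :=
  Real.rpow_add_le_add_rpow ha hb hs0.le hs1.le

theorem max_rpow_le {s : ℝ} (hs0 : 0 < s) (hs1 : s < 1) (t : ℝ) :
    (max (1 + t) 0) ^ s ≤ 1 + |t| ^ s := by
  calc (max (1 + t) 0) ^ s ≤ (1 + |t|) ^ s := by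
        refine Real.rpow_le_rpow (le_max_right _ _) ?_ hs0.le
        exact max_le (by linarith [le_abs_self t]) (by positivity)
    _ ≤ 1 ^ s + |t| ^ s := rpow_add_le hs0 hs1 zero_le_one (abs_nonneg t)
    _ = _ := by rw [Real.one_rpow]

theorem abs_secDiff_le_rpow {s : ℝ} (hs0 : 0 < s) (hs1 : s < 1) (t : ℝ) :
    |secDiff s t| ≤ 2 + 2 * |t| ^ s := by
  have h1 := max_rpow_le hs0 hs1 t
  have h2 := max_rpow_le hs0 hs1 (-t)
  rw [abs_neg, ← sub_eq_add_neg] at h2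
  have h3 : 0 ≤ (max (1 + t) 0) ^ s := Real.rpow_nonneg (le_max_right _ _) _
  have h4 : 0 ≤ (max (1 - t) 0) ^ s := Real.rpow_nonneg (le_max_right _ _) _
  have h5 : 0 ≤ |t| ^ s := by positivity
  unfold secDiff
  rw [abs_le]; constructor <;> linarith

/-- Left half of the integrand of the one dimensional fractional Laplacian of `t₊ˢ` at `1`. -/
def leftInt (s x : ℝ) : ℝ := x ^ (-1 - 2 * s) * (1 - (max (1 - x) 0) ^ s)

/-- Right half of the integrand of the one dimensional fractional Laplacian of `t₊ˢ` at `1`. -/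
def rightInt (s x : ℝ) : ℝ := x ^ (-1 - 2 * s) * (1 - (1 + x) ^ s)

theorem continuousOn_leftInt {s : ℝ} (hs0 : 0 < s) : ContinuousOn (leftInt s) (Ioi 0) := by
  intro x hx
  refine ContinuousWithinAt.mul ?_ ?_
  · exact (Real.continuousAt_rpow_const _ _ (Or.inl (ne_of_gt hx))).continuousWithinAt
  · refine (Continuous.continuousWithinAt ?_)
    exact continuous_const.sub (Continuous.rpow_const (by fun_prop) (fun _ => Or.inr hs0.le))

theorem leftInt_of_one_le {s : ℝ} (hs0 : 0 < s) {x : ℝ} (hx : 1 ≤ x) :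
    leftInt s x = x ^ (-1 - 2 * s) := by
  unfold leftInt
  rw [max_eq_right (by linarith), Real.zero_rpow hs0.ne']; ring

theorem leftInt_nonneg {s : ℝ} (hs0 : 0 < s) {x : ℝ} (hx : 0 < x) : 0 ≤ leftInt s x := by
  unfold leftInt
  refine mul_nonneg (by positivity) (sub_nonneg.2 ?_)
  exact Real.rpow_le_one (le_max_right _ _) (max_le (by linarith) zero_le_one) hs0.le

theorem leftInt_le {s : ℝ} (hs0 : 0 < s) (hs1 : s < 1) {x : ℝ} (hx : 0 < x) :
    leftInt s x ≤ x ^ (- 2 * s) := by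
  have h1 : 1 - (max (1 - x) 0) ^ s ≤ x := by
    have : max (1 - x) 0 ≤ (max (1 - x) 0) ^ s := by
      calc max (1 - x) 0 = (max (1 - x) 0) ^ (1 : ℝ) := (Real.rpow_one _).symm
        _ ≤ _ := Real.rpow_le_rpow_of_exponent_ge' (le_max_right _ _)
            (max_le (by linarith) zero_le_one) hs0.le hs1.le
    linarith [le_max_left (1 - x) 0]
  calc leftInt s x ≤ x ^ (-1 - 2 * s) * x := by
        unfold leftInt; gcongr
    _ = x ^ (- 2 * s) := by
        rw [← Real.rpow_add_one hx.ne']; ring_nf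

theorem intervalIntegrable_leftInt {s : ℝ} (hs0 : 0 < s) {a b : ℝ} (ha : 0 < a) (hb : 0 < b) :
    IntervalIntegrable (leftInt s) volume a b :=
  ((continuousOn_leftInt hs0).mono fun _ hx => lt_of_lt_of_le (lt_min ha hb) hx.1
    ).intervalIntegrable

theorem integral_leftInt {s : ℝ} (hs0 : 0 < s) {ε : ℝ} (hε : 0 < ε) :
    IntegrableOn (leftInt s) (Ioi ε) ∧
    ∫ x in Ioi ε, leftInt s x = (∫ x in ε..1, leftInt s x) + 1 / (2 * s) := by
  have hEq : EqOn (leftInt s) (fun x => x ^ (-1 - 2 * s)) (Ioi 1) :=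
    fun x hx => leftInt_of_one_le hs0 (le_of_lt hx)
  have hI1 : IntegrableOn (leftInt s) (Ioi 1) := by
    rw [integrableOn_congr_fun hEq measurableSet_Ioi]
    exact integrableOn_Ioi_rpow_of_lt (by linarith) one_pos
  have hi := intervalIntegrable_leftInt hs0 hε one_pos
  have hI : IntegrableOn (leftInt s) (Ioi ε) := by
    rcases le_total ε 1 with h | h
    · rw [← Ioc_union_Ioi_eq_Ioi h]
      exact ((intervalIntegrable_iff_integrableOn_Ioc_of_le h).1 hi).union hI1
    · exact hI1.mono_set (Ioi_subset_Ioi h)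
  refine ⟨hI, ?_⟩
  have h1 : ∫ x in Ioi 1, leftInt s x = 1 / (2 * s) := by
    rw [setIntegral_congr_fun measurableSet_Ioi hEq, integral_Ioi_rpow_of_lt (by linarith)
      one_pos, Real.one_rpow, show -1 - 2 * s + 1 = -(2 * s) by ring, neg_div_neg_eq]
  rw [← h1]
  exact (intervalIntegral.integral_interval_add_Ioi hI hI1).symm

/-- The square `((1+t)^s-1)^2 t^{-2s}`, whose derivative cancels the symmetrized integrand. -/
def sqTerm (s t : ℝ) : ℝ := ((1 + t) ^ s - 1) ^ 2 * t ^ (-2 * s)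

theorem hasDerivAt_sqTerm (s : ℝ) {t : ℝ} (ht : 0 < t) :
    HasDerivAt (sqTerm s)
      (2 * s * (t ^ (-1 - 2 * s) * ((1 + t) ^ s - 1) * (1 - (1 + t) ^ (s - 1)))) t := by
  have h1 : HasDerivAt (fun t : ℝ => (1 + t) ^ s) (1 * s * (1 + t) ^ (s - 1)) t :=
    ((hasDerivAt_id t).const_add 1).rpow_const (Or.inl (by simp; linarith))
  have h2 : HasDerivAt (fun t : ℝ => t ^ (-2 * s)) (-2 * s * t ^ (-2 * s - 1)) t :=
    Real.hasDerivAt_rpow_const (Or.inl ht.ne')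
  have h3 := ((h1.sub_const 1).pow 2).mul h2
  refine h3.congr_deriv ?_
  have e1 : t ^ (-2 * s) = t ^ (-1 - 2 * s) * t := by
    rw [← Real.rpow_add_one ht.ne']; ring_nf
  have e2 : t ^ (-2 * s - 1) = t ^ (-1 - 2 * s) := by ring_nf
  have e3 : (1 + t) ^ s = (1 + t) ^ (s - 1) * (1 + t) := by
    rw [← Real.rpow_add_one (by linarith)]; ring_nf
  simp only [Pi.pow_apply, e1, e2, Nat.cast_ofNat]
  rw [e3]; ring

theorem hasDerivAt_comp_left {s : ℝ} (hs0 : 0 < s) {t : ℝ} (ht : 0 < t) :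
    HasDerivAt (fun t => ∫ x in (t / (1 + t))..1, leftInt s x)
      (-(t ^ (-1 - 2 * s) * ((1 + t) ^ s - 1) * (1 + t) ^ (s - 1))) t := by
  have h1t : 0 < 1 + t := by linarith
  have hv : 0 < t / (1 + t) := by positivity
  have h1 : HasDerivAt (fun u => ∫ x in u..1, leftInt s x) (-leftInt s (t / (1 + t)))
      (t / (1 + t)) := by
    have hc : ContinuousOn (leftInt s) (Ioi 0) := continuousOn_leftInt hs0
    exact intervalIntegral.integral_hasDerivAt_left (intervalIntegrable_leftInt hs0 hv one_pos)
      (hc.stronglyMeasurableAtFilter isOpen_Ioi _ hv) (hc.continuousAt (Ioi_mem_nhds hv))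
  have h2 : HasDerivAt (fun t : ℝ => t / (1 + t)) (1 / (1 + t) ^ 2) t := by
    have := (hasDerivAt_id t).div ((hasDerivAt_id t).const_add 1) h1t.ne'
    refine this.congr_deriv ?_
    simp
  refine (h1.comp t h2).congr_deriv ?_
  unfold leftInt
  have e0 : 1 - t / (1 + t) = (1 + t)⁻¹ := by field_simp; ring
  rw [e0, max_eq_left (by positivity), Real.inv_rpow h1t.le, Real.div_rpow ht.le h1t.le]
  have e3 : (1 + t) ^ s = (1 + t) ^ (s - 1) * (1 + t) := by
    rw [← Real.rpow_add_one h1t.ne']; ring_nf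
  have hA : 0 < (1 + t) ^ (s - 1) := by positivity
  have e4 : (1 + t) ^ (-1 - 2 * s) = (((1 + t) ^ (s - 1)) ^ 2 * (1 + t) ^ 3)⁻¹ := by
    rw [← Real.rpow_natCast, ← Real.rpow_mul h1t.le, ← Real.rpow_natCast (1 + t) 3,
      ← Real.rpow_add h1t, ← Real.rpow_neg h1t.le]
    congr 1; push_cast; ring
  rw [e4, e3]
  field_simp

theorem tendsto_sqTerm {s : ℝ} (hs0 : 0 < s) : Tendsto (sqTerm s) atTop (𝓝 1) := by
  have h1 : Tendsto (fun t : ℝ => ((t⁻¹ + 1) ^ s - t ^ (-s)) ^ 2) atTop (𝓝 (((0 + 1) ^ s - 0) ^ 2)) := by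
    refine Tendsto.pow (Tendsto.sub ?_ (tendsto_rpow_neg_atTop hs0)) 2
    exact (tendsto_inv_atTop_zero.add_const 1).rpow_const (Or.inl (by norm_num))
  rw [show (((0 : ℝ) + 1) ^ s - 0) ^ 2 = 1 by simp] at h1
  refine h1.congr' ?_
  filter_upwards [eventually_gt_atTop 0] with t ht
  have e0 : t⁻¹ + 1 = (1 + t) / t := by field_simp
  rw [e0, Real.div_rpow (by linarith) ht.le, sqTerm, Real.rpow_neg ht.le,
    show -2 * s = -(s * (2 : ℕ)) by push_cast; ring, Real.rpow_neg ht.le, Real.rpow_mul ht.le,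
    Real.rpow_natCast]
  have : 0 < t ^ s := by positivity
  field_simp

theorem integral_rightInt {s : ℝ} (hs0 : 0 < s) {ε : ℝ} (hε : 0 < ε) :
    IntegrableOn (rightInt s) (Ioi ε) ∧
    ∫ x in Ioi ε, rightInt s x =
      sqTerm s ε / (2 * s) - 1 / (2 * s) - ∫ x in (ε / (1 + ε))..1, leftInt s x := by
  set W : ℝ → ℝ := fun t => (∫ x in (t / (1 + t))..1, leftInt s x) - sqTerm s t / (2 * s) with hW
  have hder : ∀ x ∈ Ici ε, HasDerivAt W (rightInt s x) x := by
    intro x hx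
    have hx0 : 0 < x := lt_of_lt_of_le hε hx
    refine ((hasDerivAt_comp_left hs0 hx0).sub ((hasDerivAt_sqTerm s hx0).div_const (2 * s))
      ).congr_deriv ?_
    unfold rightInt
    field_simp
    ring
  have hneg : ∀ x ∈ Ioi ε, rightInt s x ≤ 0 := by
    intro x hx
    have hx0 : 0 < x := lt_trans hε hx
    have : 1 ≤ (1 + x) ^ s := Real.one_le_rpow (by linarith) hs0.le
    unfold rightInt
    exact mul_nonpos_of_nonneg_of_nonpos (by positivity) (by linarith)
  have hlim : Tendsto W atTop (𝓝 (0 - 1 / (2 * s))) := by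
    refine Tendsto.sub ?_ ((tendsto_sqTerm hs0).div_const _)
    have hc : ContinuousAt (fun u => ∫ x in u..1, leftInt s x) 1 := by
      have hc : ContinuousOn (leftInt s) (Ioi 0) := continuousOn_leftInt hs0
      exact (intervalIntegral.integral_hasDerivAt_left
        (intervalIntegrable_leftInt hs0 one_pos one_pos)
        (hc.stronglyMeasurableAtFilter isOpen_Ioi _ (by simp))
        (hc.continuousAt (Ioi_mem_nhds one_pos))).continuousAt
    have h2 : Tendsto (fun t : ℝ => t / (1 + t)) atTop (𝓝 1) := by
      have : Tendsto (fun t : ℝ => (t⁻¹ + 1)⁻¹) atTop (𝓝 ((0 + 1)⁻¹)) :=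
        (tendsto_inv_atTop_zero.add_const 1).inv₀ (by norm_num)
      rw [zero_add, inv_one] at this
      refine this.congr' ?_
      filter_upwards [eventually_gt_atTop 0] with t ht
      field_simp
    have := hc.tendsto.comp h2
    simpa [Function.comp_def] using this
  refine ⟨integrableOn_Ioi_deriv_of_nonpos' hder hneg hlim, ?_⟩
  rw [integral_Ioi_of_hasDerivAt_of_nonpos' hder hneg hlim, hW]
  ring

theorem rpow_mul_secDiff {s t : ℝ} (ht : 0 < t) :
    t ^ (-1 - 2 * s) * secDiff s t = rightInt s t + leftInt s t := by
  unfold secDiff rightInt leftInt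
  rw [max_eq_left (by linarith : 0 ≤ 1 + t)]; ring

theorem integrableOn_secDiff {s : ℝ} (hs0 : 0 < s) (hs1 : s < 1) :
    IntegrableOn (fun t => t ^ (-1 - 2 * s) * secDiff s t) (Ioi 0) := by
  rw [← Ioc_union_Ioi_eq_Ioi zero_le_one]
  refine IntegrableOn.union ?_ ?_
  · have hb : IntegrableOn (fun t : ℝ => 2 * t ^ (1 - 2 * s)) (Ioc 0 1) := by
      refine Integrable.const_mul ?_ 2
      exact (intervalIntegrable_iff_integrableOn_Ioc_of_le zero_le_one).1
        (intervalIntegral.intervalIntegrable_rpow' (by linarith))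
    refine Integrable.mono' hb ?_ ?_
    · refine ContinuousOn.aestronglyMeasurable ?_ measurableSet_Ioc
      refine ContinuousOn.mul ?_ (continuous_secDiff hs0).continuousOn
      exact fun x hx => (Real.continuousAt_rpow_const _ _ (Or.inl hx.1.ne')).continuousWithinAt
    · refine (ae_restrict_iff' measurableSet_Ioc).2 (.of_forall fun t ht => ?_)
      have ht0 : 0 < t := ht.1
      rw [norm_mul, Real.norm_of_nonneg (by positivity), Real.norm_eq_abs]
      calc t ^ (-1 - 2 * s) * |secDiff s t| ≤ t ^ (-1 - 2 * s) * (2 * t ^ 2) := by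
            gcongr; exact abs_secDiff_le_sq hs0 hs1 t
        _ = 2 * t ^ (1 - 2 * s) := by
            rw [show 1 - 2 * s = -1 - 2 * s + (2 : ℕ) by push_cast; ring,
              Real.rpow_add_natCast ht0.ne']; ring
  · refine (((integral_rightInt hs0 one_pos).1.add (integral_leftInt hs0 one_pos).1)
      ).congr ?_
    refine (ae_restrict_iff' measurableSet_Ioi).2 (.of_forall fun t ht => ?_)
    exact (rpow_mul_secDiff (lt_trans one_pos ht)).symm

theorem abs_integral_secDiff_tail_le {s : ℝ} (hs0 : 0 < s) (hs1 : s < 1) {ε : ℝ} (hε : 0 < ε)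
    (hε1 : ε < 1) :
    |∫ t in Ioi ε, t ^ (-1 - 2 * s) * secDiff s t| ≤
      (1 / (2 * s) + 2 ^ (2 * s)) * ε ^ (2 - 2 * s) := by
  have hR := integral_rightInt hs0 hε
  have hL := integral_leftInt hs0 hε
  have hv : 0 < ε / (1 + ε) := by positivity
  have hvε : ε / (1 + ε) ≤ ε := div_le_self hε.le (by linarith)
  have hadd : (∫ x in (ε / (1 + ε))..ε, leftInt s x) + (∫ x in ε..1, leftInt s x) =
      ∫ x in (ε / (1 + ε))..1, leftInt s x :=
    intervalIntegral.integral_add_adjacent_intervals (intervalIntegrable_leftInt hs0 hv hε)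
      (intervalIntegrable_leftInt hs0 hε one_pos)
  have heq : ∫ t in Ioi ε, t ^ (-1 - 2 * s) * secDiff s t =
      sqTerm s ε / (2 * s) - ∫ x in (ε / (1 + ε))..ε, leftInt s x := by
    rw [setIntegral_congr_fun measurableSet_Ioi
      (g := fun t => rightInt s t + leftInt s t) (fun t ht => rpow_mul_secDiff (lt_trans hε ht)),
      integral_add hR.1 hL.1, hR.2, hL.2, ← hadd]
    ring
  have h1 : sqTerm s ε ≤ ε ^ (2 - 2 * s) := by
    have h2 := one_add_rpow_le hs1 hε.le
    have h3 : 1 ≤ (1 + ε) ^ s := Real.one_le_rpow (by linarith) hs0.le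
    calc sqTerm s ε ≤ ε ^ 2 * ε ^ (-2 * s) := by
          unfold sqTerm; gcongr; linarith
      _ = _ := by
          rw [show 2 - 2 * s = -2 * s + (2 : ℕ) by push_cast; ring,
              Real.rpow_add_natCast hε.ne']; ring
  have h1' : 0 ≤ sqTerm s ε := by unfold sqTerm; positivity
  have h2 : 0 ≤ ∫ x in (ε / (1 + ε))..ε, leftInt s x :=
    intervalIntegral.integral_nonneg hvε fun x hx => leftInt_nonneg hs0 (lt_of_lt_of_le hv hx.1)
  have h3 : ∫ x in (ε / (1 + ε))..ε, leftInt s x ≤ 2 ^ (2 * s) * ε ^ (2 - 2 * s) := by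
    have hhalf : ε / 2 ≤ ε / (1 + ε) := by gcongr; linarith
    have hle : ∀ x ∈ Icc (ε / (1 + ε)) ε, leftInt s x ≤ (ε / 2) ^ (-2 * s) := by
      intro x hx
      have hx0 : 0 < x := lt_of_lt_of_le hv hx.1
      refine (leftInt_le hs0 hs1 hx0).trans ?_
      exact Real.rpow_le_rpow_of_nonpos (by positivity) (hhalf.trans hx.1) (by linarith)
    calc ∫ x in (ε / (1 + ε))..ε, leftInt s x
        ≤ ∫ _ in (ε / (1 + ε))..ε, (ε / 2) ^ (-2 * s) :=
          intervalIntegral.integral_mono_on hvε (intervalIntegrable_leftInt hs0 hv hε) (by simp) hle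
      _ = (ε - ε / (1 + ε)) * (ε / 2) ^ (-2 * s) := by simp
      _ ≤ ε ^ 2 * (ε / 2) ^ (-2 * s) := by
          gcongr
          rw [sub_le_iff_le_add, ← sub_le_iff_le_add', le_div_iff₀ (by linarith)]
          nlinarith [pow_pos hε 3]
      _ = 2 ^ (2 * s) * ε ^ (2 - 2 * s) := by
          rw [Real.div_rpow hε.le zero_le_two, neg_mul, Real.rpow_neg zero_le_two,
            show 2 - 2 * s = -(2 * s) + (2 : ℕ) by push_cast; ring, Real.rpow_add_natCast hε.ne']
          field_simp
  have h4 : sqTerm s ε / (2 * s) ≤ ε ^ (2 - 2 * s) / (2 * s) := by gcongr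
  have h5 : 0 ≤ sqTerm s ε / (2 * s) := by positivity
  have h6 : 0 ≤ ε ^ (2 - 2 * s) / (2 * s) := by positivity
  have h7 : 0 ≤ 2 ^ (2 * s) * ε ^ (2 - 2 * s) := by positivity
  rw [heq, add_mul, one_div, inv_mul_eq_div, abs_le]
  constructor <;> linarith

/-- The one dimensional fractional Laplacian of `t₊ˢ` vanishes at `1`. -/
theorem integral_secDiff {s : ℝ} (hs0 : 0 < s) (hs1 : s < 1) :
    ∫ t in Ioi 0, t ^ (-1 - 2 * s) * secDiff s t = 0 := by
  have hid : Tendsto (fun ε : ℝ => ε) (𝓝[>] 0) (𝓝 0) := tendsto_id.mono_left nhdsWithin_le_nhds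
  have h1 : Tendsto (fun ε : ℝ => ∫ t in Ioi ε, t ^ (-1 - 2 * s) * secDiff s t ∂(volume.restrict (Ioi 0)))
      (𝓝[>] 0) (𝓝 (∫ t in Ioi 0, t ^ (-1 - 2 * s) * secDiff s t)) :=
    (aecover_Ioi_of_Ioi hid).integral_tendsto_of_countably_generated (integrableOn_secDiff hs0 hs1)
  refine tendsto_nhds_unique h1 (squeeze_zero_norm' (a := fun ε : ℝ =>
    (1 / (2 * s) + 2 ^ (2 * s)) * ε ^ (2 - 2 * s)) ?_ ?_)
  · filter_upwards [self_mem_nhdsWithin, Ioo_mem_nhdsGT one_pos] with ε hε hε1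
    rw [Measure.restrict_restrict measurableSet_Ioi,
      inter_eq_left.2 (Ioi_subset_Ioi (le_of_lt hε))]
    exact abs_integral_secDiff_tail_le hs0 hs1 hε hε1.2
  · have := (hid.rpow_const (p := 2 - 2 * s) (Or.inr (by linarith))).const_mul
      (1 / (2 * s) + 2 ^ (2 * s))
    rwa [Real.zero_rpow (by linarith), mul_zero] at this

section

variable {n : ℕ}

theorem ker_mul_rpow {s : ℝ} {z : Euc n} (hz : z ≠ 0) (p : ℝ) :
    ‖z‖ ^ p * ker n s z = ‖z‖ ^ (-(n : ℝ) + (p - 2 * s)) := by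
  unfold ker
  rw [← Real.rpow_add (norm_pos_iff.2 hz)]
  ring_nf

theorem ker_mul_rpow' {s : ℝ} {z : Euc n} (hz : z ≠ 0) (p : ℝ) :
    ‖z‖ ^ p * ker n s z = ‖z‖ ^ (-((n : ℝ) + (2 * s - p))) := by
  rw [ker_mul_rpow hz]; ring_nf

theorem near_union_far (r : ℝ) : {z : Euc n | ‖z‖ < r} ∪ {z | r ≤ ‖z‖} = univ := by
  ext z; simpa using lt_or_ge _ _

variable [NeZero n]

theorem ae_ne_zero : ∀ᵐ z : Euc n, z ≠ 0 := by
  have : (volume : Measure (Euc n)) {0} = 0 := measure_singleton 0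
  exact compl_mem_ae_iff.2 this

theorem far_rpow_ker {s p r : ℝ} (hp : p < 2 * s) (hr : 0 < r) :
    IntegrableOn (fun z : Euc n => ‖z‖ ^ p * ker n s z) {z | r ≤ ‖z‖} ∧
    ∫ z in {z : Euc n | r ≤ ‖z‖}, ‖z‖ ^ p * ker n s z =
      sphereArea n * (r ^ (p - 2 * s) / (2 * s - p)) := by
  have h := far_rpow (n := n) (q := 2 * s - p) (by linarith) hr
  have hEq : EqOn (fun z : Euc n => ‖z‖ ^ p * ker n s z)
      (fun z => ‖z‖ ^ (-((n : ℝ) + (2 * s - p)))) {z | r ≤ ‖z‖} := fun z hz =>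
    ker_mul_rpow' (norm_pos_iff.1 (lt_of_lt_of_le hr hz)) p
  rw [integrableOn_congr_fun hEq (measurableSet_far r),
    setIntegral_congr_fun (measurableSet_far r) hEq, h.2, neg_sub]
  exact ⟨h.1, rfl⟩

theorem far_ker {s r : ℝ} (hs : 0 < s) (hr : 0 < r) :
    IntegrableOn (ker n s) {z | r ≤ ‖z‖} ∧
    ∫ z in {z : Euc n | r ≤ ‖z‖}, ker n s z = sphereArea n * (r ^ (- (2 * s)) / (2 * s)) := by
  simpa using far_rpow_ker (n := n) (s := s) (p := 0) (by linarith) hr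

theorem near_rpow_ker {s p r : ℝ} (hp : 2 * s < p) (hr : 0 < r) :
    IntegrableOn (fun z : Euc n => ‖z‖ ^ p * ker n s z) {z | ‖z‖ < r} ∧
    ∫ z in {z : Euc n | ‖z‖ < r}, ‖z‖ ^ p * ker n s z =
      sphereArea n * (r ^ (p - 2 * s) / (p - 2 * s)) := by
  have h := near_rpow (n := n) (q := p - 2 * s) (by linarith) hr
  have hEq : (fun z : Euc n => ‖z‖ ^ p * ker n s z) =ᵐ[volume.restrict {z | ‖z‖ < r}]
      (fun z => ‖z‖ ^ (-(n : ℝ) + (p - 2 * s))) :=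
    ae_restrict_of_ae (ae_ne_zero.mono fun z hz => ker_mul_rpow hz p)
  rw [IntegrableOn, integrable_congr hEq, integral_congr_ae hEq, h.2]
  exact ⟨h.1, rfl⟩

theorem near_sq_ker {s r : ℝ} (hs : s < 1) (hr : 0 < r) :
    IntegrableOn (fun z : Euc n => ‖z‖ ^ 2 * ker n s z) {z | ‖z‖ < r} ∧
    ∫ z in {z : Euc n | ‖z‖ < r}, ‖z‖ ^ 2 * ker n s z =
      sphereArea n * (r ^ (2 - 2 * s) / (2 - 2 * s)) := by
  simpa using near_rpow_ker (n := n) (s := s) (p := 2) (by linarith) hr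

theorem integrable_secDiff_inner {s : ℝ} (hs0 : 0 < s) (hs1 : s < 1) (a : Euc n) :
    Integrable (fun z => secDiff s ⟪a, z⟫ * ker n s z) := by
  have hm : ∀ μ : Measure (Euc n),
      AEStronglyMeasurable (fun z => secDiff s ⟪a, z⟫ * ker n s z) μ := fun μ =>
    ((((continuous_secDiff hs0).comp (continuous_const.inner continuous_id)).measurable).mul
      (measurable_ker s)).aestronglyMeasurable
  have hin : ∀ z : Euc n, |⟪a, z⟫| ≤ ‖a‖ * ‖z‖ := fun z => abs_real_inner_le_norm a z
  rw [← integrableOn_univ, ← near_union_far 1]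
  refine IntegrableOn.union ?_ ?_
  · refine Integrable.mono' ((near_sq_ker hs1 one_pos).1.const_mul (2 * ‖a‖ ^ 2)) (hm _)
      (.of_forall fun z => ?_)
    rw [norm_mul, Real.norm_of_nonneg (ker_nonneg s z), Real.norm_eq_abs, ← mul_assoc]
    gcongr
    · exact ker_nonneg s z
    · refine (abs_secDiff_le_sq hs0 hs1 _).trans ?_
      rw [← sq_abs, mul_assoc, ← mul_pow]
      gcongr
      exact hin z
  · refine Integrable.mono' (((far_ker hs0 one_pos).1.const_mul 2).add
      ((far_rpow_ker (p := s) (s := s) (by linarith) one_pos).1.const_mul (2 * ‖a‖ ^ s))) (hm _)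
      (.of_forall fun z => ?_)
    rw [norm_mul, Real.norm_of_nonneg (ker_nonneg s z), Real.norm_eq_abs, Pi.add_apply,
      ← mul_assoc, ← add_mul]
    gcongr
    · exact ker_nonneg s z
    · refine (abs_secDiff_le_rpow hs0 hs1 _).trans ?_
      rw [mul_assoc, ← Real.mul_rpow (norm_nonneg _) (norm_nonneg _)]
      gcongr
      exact hin z

theorem integral_secDiff_mul {s : ℝ} (hs0 : 0 < s) (hs1 : s < 1) (c : ℝ) :
    ∫ r in Ioi 0, r ^ (-1 - 2 * s) * secDiff s (r * c) = 0 := by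
  rcases eq_or_ne c 0 with rfl | hc
  · simp [secDiff_zero]
  · have hc' : 0 < |c| := abs_pos.2 hc
    have h := integral_comp_mul_left_Ioi (fun t => t ^ (-1 - 2 * s) * secDiff s t) 0 hc'
    rw [mul_zero, integral_secDiff hs0 hs1, smul_zero] at h
    have h2 : ∀ r ∈ Ioi (0 : ℝ), r ^ (-1 - 2 * s) * secDiff s (r * c) =
        |c| ^ (1 + 2 * s) * ((|c| * r) ^ (-1 - 2 * s) * secDiff s (|c| * r)) := by
      intro r hr
      have e1 : secDiff s (|c| * r) = secDiff s (r * c) := by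
        rcases abs_choice c with h | h <;> rw [h]
        · rw [mul_comm]
        · rw [neg_mul, secDiff_neg, mul_comm]
      rw [e1, Real.mul_rpow hc'.le (le_of_lt hr), ← mul_assoc, ← mul_assoc,
        ← Real.rpow_add hc', show 1 + 2 * s + (-1 - 2 * s) = 0 by ring, Real.rpow_zero, one_mul]
    rw [setIntegral_congr_fun measurableSet_Ioi h2, integral_const_mul, h, mul_zero]

/-- The half-space profile `(a · z + 1)₊ˢ` has vanishing fractional Laplacian at `z = 0`. -/
theorem integral_secDiff_inner {s : ℝ} (hs0 : 0 < s) (hs1 : s < 1) (a : Euc n) :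
    ∫ z : Euc n, secDiff s ⟪a, z⟫ * ker n s z = 0 := by
  set F : Euc n → ℝ := fun z => secDiff s ⟪a, z⟫ * ker n s z with hF
  have hmp := (volume : Measure (Euc n)).measurePreserving_homeomorphUnitSphereProd
  set e := homeomorphUnitSphereProd (Euc n) with he
  have hemb := e.measurableEmbedding
  set G : sphere (0 : Euc n) 1 × Ioi (0 : ℝ) → ℝ := fun p => F (e.symm p) with hG
  have hGe : ∀ z, G (e z) = F z := fun z => by simp [G]
  have hFi : Integrable (fun z : ({0}ᶜ : Set (Euc n)) => F z)
      ((volume : Measure (Euc n)).comap Subtype.val) :=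
    (integrableOn_iff_comap_subtypeVal (measurableSet_singleton _).compl).1
      (integrable_secDiff_inner hs0 hs1 a).integrableOn
  have hGi : Integrable G ((volume : Measure (Euc n)).toSphere.prod
      (.volumeIoiPow (Module.finrank ℝ (Euc n) - 1))) := by
    rw [← hmp.integrable_comp_emb hemb]
    simpa [Function.comp_def, hGe] using hFi
  calc ∫ z, F z = ∫ z : ({0}ᶜ : Set (Euc n)), F z 
      ∂((volume : Measure (Euc n)).comap Subtype.val) := by
        rw [integral_subtype_comap (measurableSet_singleton _).compl F, restrict_compl_singleton]
    _ = ∫ p, G p ∂((volume : Measure (Euc n)).toSphere.prod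
      (.volumeIoiPow (Module.finrank ℝ (Euc n) - 1))) := by
        rw [← hmp.integral_comp hemb]; simp [hGe]
    _ = 0 := by
        rw [integral_prod _ hGi]
        refine integral_eq_zero_of_ae (.of_forall fun θ => ?_)
        have hθ : ‖(θ : Euc n)‖ = 1 := by simp
        simp only [Measure.volumeIoiPow, ENNReal.ofReal, finrank_euclideanSpace_fin, Pi.zero_apply]
        rw [integral_withDensity_eq_integral_smul
          ((measurable_subtype_coe.pow_const _).real_toNNReal)]
        refine Eq.trans ?_ (integral_secDiff_mul hs0 hs1 ⟪a, (θ : Euc n)⟫)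
        rw [← integral_subtype_comap measurableSet_Ioi
            (fun r : ℝ => r ^ (-1 - 2 * s) * secDiff s (r * ⟪a, (θ : Euc n)⟫))]
        refine integral_congr_ae (.of_forall fun r => ?_)
        have hr : 0 < (r : ℝ) := r.2
        simp only [NNReal.smul_def, Real.coe_toNNReal _ (pow_nonneg hr.le _), smul_eq_mul, hG, hF]
        rw [he, homeomorphUnitSphereProd_symm_apply_coe, inner_smul_right, ker, norm_smul, hθ,
          mul_one, Real.norm_of_nonneg hr.le, mul_comm (secDiff _ _), ← mul_assoc, neg_add,
          pow_mul_rpow_sub_one (NeZero.ne n) hr]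
        ring_nf

end

section

theorem rpow_add_le_tangent {s l q : ℝ} (hs0 : 0 < s) (hs1 : s < 1) (hl : 0 < l) (hq : 0 ≤ q) :
    (l + q) ^ s ≤ l ^ s + l ^ (s - 1) * q := by
  have h0 : 0 ≤ q / l := by positivity
  have h : (1 + q / l) ^ s ≤ 1 + s * (q / l) :=
    rpow_one_add_le_one_add_mul_self (by linarith) hs0.le hs1.le
  have e : l + q = l * (1 + q / l) := by field_simp
  rw [e, Real.mul_rpow hl.le (by positivity), Real.rpow_sub_one hl.ne']
  have h2 : s * (q / l) ≤ q / l := mul_le_of_le_one_left (by positivity) hs1.le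
  calc l ^ s * (1 + q / l) ^ s ≤ l ^ s * (1 + q / l) := by gcongr; linarith
    _ = l ^ s + l ^ s / l * q := by field_simp

/-- The error made when linearising the quadratic argument of the barrier. -/
theorem max_rpow_add_sq_le {s κ δ l r : ℝ} (hs0 : 0 < s) (hs1 : s < 1) (hκ0 : 0 < κ)
    (hκ : κ ≤ 1 - s) (hδ0 : 0 < δ) (hδ1 : δ ≤ 1) (hr : 0 ≤ r) (hl : |l| ≤ r) :
    (max (δ + l + r ^ 2) 0) ^ s ≤
      (max (δ + l) 0) ^ s + 2 * δ ^ (-κ) * r ^ (2 * s + κ) := by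
  rcases le_or_gt (δ / 2) r with h | h
  · have hr0 : 0 < r := by linarith
    have h1 : (max (δ + l + r ^ 2) 0) ^ s ≤ (max (δ + l) 0 + r ^ 2) ^ s := by
      gcongr
      exact max_le (by gcongr; exact le_max_left _ _) (by positivity)
    have h2 := rpow_add_le hs0 hs1 (le_max_right (δ + l) 0) (sq_nonneg r)
    have h3 : (r ^ 2) ^ s = r ^ (2 * s) := by
      rw [← Real.rpow_two, ← Real.rpow_mul hr]
    have h4 : 1 ≤ (2 * r / δ) ^ κ := Real.one_le_rpow (by rw [le_div_iff₀ hδ0]; linarith) hκ0.le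
    have h5 : (2 * r / δ) ^ κ = 2 ^ κ * δ ^ (-κ) * r ^ κ := by
      rw [Real.div_rpow (by positivity) hδ0.le, Real.mul_rpow (by norm_num) hr,
        Real.rpow_neg hδ0.le]; field_simp
    have h6 : (2 : ℝ) ^ κ ≤ 2 := by
      simpa using Real.rpow_le_rpow_of_exponent_le (one_le_two (α := ℝ)) (by linarith : κ ≤ 1)
    have h7 : r ^ (2 * s) ≤ 2 * δ ^ (-κ) * r ^ (2 * s + κ) := by
      calc r ^ (2 * s) ≤ r ^ (2 * s) * (2 * r / δ) ^ κ := le_mul_of_one_le_right (by positivity) h4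
        _ = 2 ^ κ * δ ^ (-κ) * r ^ (2 * s + κ) := by rw [h5, Real.rpow_add hr0]; ring
        _ ≤ _ := by gcongr
    linarith
  · have hl' := abs_le.1 hl
    have hpos : δ / 2 ≤ δ + l := by linarith
    rw [max_eq_left (by nlinarith : 0 ≤ δ + l + r ^ 2), max_eq_left (by linarith)]
    have h1 := rpow_add_le_tangent hs0 hs1 (by linarith : 0 < δ + l) (sq_nonneg r)
    have h2 : (δ + l) ^ (s - 1) ≤ (δ / 2) ^ (s - 1) :=
      Real.rpow_le_rpow_of_nonpos (by linarith) hpos (by linarith)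
    have hA : (δ / 2) ^ (s - 1) * r ^ 2 ≤ δ ^ (-κ) * r ^ (2 * s + κ) := by
      rcases hr.eq_or_lt with rfl | hr0
      · have : 0 ≤ δ ^ (-κ) * 0 ^ (2 * s + κ) := by positivity
        simpa using this
      have e : r ^ 2 = r ^ (2 - 2 * s - κ) * r ^ (2 * s + κ) := by
        rw [← Real.rpow_add hr0, ← Real.rpow_two]; ring_nf
      have h3 : r ^ (2 - 2 * s - κ) ≤ (δ / 2) ^ (2 - 2 * s - κ) :=
        Real.rpow_le_rpow hr h.le (by linarith)
      rw [e, ← mul_assoc]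
      gcongr
      calc (δ / 2) ^ (s - 1) * r ^ (2 - 2 * s - κ)
          ≤ (δ / 2) ^ (s - 1) * (δ / 2) ^ (2 - 2 * s - κ) := by gcongr
        _ = (δ / 2) ^ (1 - s - κ) := by rw [← Real.rpow_add (by positivity)]; ring_nf
        _ ≤ 1 := Real.rpow_le_one (by positivity) (by linarith) (by linarith)
        _ ≤ δ ^ (-κ) := Real.one_le_rpow_of_pos_of_le_one_of_nonpos hδ0 hδ1 (by linarith)
    have h4 : (δ + l) ^ (s - 1) * r ^ 2 ≤ (δ / 2) ^ (s - 1) * r ^ 2 := by gcongr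
    have h5 : 0 ≤ δ ^ (-κ) * r ^ (2 * s + κ) := by positivity
    linarith

/-- The one-dimensional profile of the barrier. -/
def profile (s t₀ t : ℝ) : ℝ := (min (max t 0) t₀) ^ s - (min (max t 0) t₀) ^ (3 * s / 2)

section profile
variable {s t₀ : ℝ}

theorem continuous_profile (hs0 : 0 < s) : Continuous (profile s t₀) := by
  unfold profile
  have h : Continuous fun t : ℝ => min (max t 0) t₀ := by fun_prop
  exact (h.rpow_const fun _ => .inr hs0.le).sub (h.rpow_const fun _ => .inr (by positivity))

theorem profile_of_nonpos (hs0 : 0 < s) (ht₀ : 0 < t₀) {t : ℝ} (ht : t ≤ 0) :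
    profile s t₀ t = 0 := by
  rw [profile, max_eq_right ht, min_eq_left ht₀.le, Real.zero_rpow hs0.ne',
    Real.zero_rpow (by positivity), sub_zero]

theorem profile_nonneg (hs0 : 0 < s) (ht₀ : 0 < t₀) (ht₁ : t₀ ≤ 1) (t : ℝ) :
    0 ≤ profile s t₀ t := by
  rcases le_or_gt t 0 with h | h
  · exact (profile_of_nonpos hs0 ht₀ h).ge
  · rw [profile, sub_nonneg]
    exact Real.rpow_le_rpow_of_exponent_ge (lt_min (lt_max_of_lt_left h) ht₀)
      ((min_le_right _ _).trans ht₁) (by linarith)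

theorem profile_le_rpow (hs0 : 0 < s) (ht₀ : 0 < t₀) (t : ℝ) :
    profile s t₀ t ≤ (max t 0) ^ s := by
  have h0 : 0 ≤ min (max t 0) t₀ := le_min (le_max_right _ _) ht₀.le
  have h1 : (min (max t 0) t₀) ^ s ≤ (max t 0) ^ s :=
    Real.rpow_le_rpow h0 (min_le_left _ _) hs0.le
  have h2 : 0 ≤ (min (max t 0) t₀) ^ (3 * s / 2) := by positivity
  rw [profile]; linarith

theorem profile_le_one (hs0 : 0 < s) (ht₀ : 0 < t₀) (ht₁ : t₀ ≤ 1) (t : ℝ) :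
    profile s t₀ t ≤ 1 := by
  have h0 : 0 ≤ min (max t 0) t₀ := le_min (le_max_right _ _) ht₀.le
  have h1 : (min (max t 0) t₀) ^ s ≤ 1 :=
    Real.rpow_le_one h0 ((min_le_right _ _).trans ht₁) hs0.le
  have h2 : 0 ≤ (min (max t 0) t₀) ^ (3 * s / 2) := by positivity
  rw [profile]; linarith

theorem half_rpow_le_profile (hs0 : 0 < s) (hh : t₀ ^ (s / 2) ≤ 1 / 2)
    {r t : ℝ} (hr : 0 < r) (hr₀ : r ≤ t₀) (ht : r ≤ t) : r ^ s / 2 ≤ profile s t₀ t := by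
  rw [profile, max_eq_left (hr.le.trans ht)]
  set m := min t t₀
  have hm : r ≤ m := le_min ht hr₀
  have hm0 : 0 < m := hr.trans_le hm
  have h1 : m ^ (s / 2) ≤ 1 / 2 :=
    (Real.rpow_le_rpow hm0.le (min_le_right _ _) (by positivity)).trans hh
  have h2 : m ^ (3 * s / 2) = m ^ s * m ^ (s / 2) := by
    rw [← Real.rpow_add hm0]; ring_nf
  have h3 : r ^ s ≤ m ^ s := Real.rpow_le_rpow hr.le hm hs0.le
  have h4 : 0 < m ^ s := by positivity
  rw [h2]; nlinarith

/-- Pointwise comparison of the barrier with the explicit half-space profiles. -/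
theorem profile_le_halfSpace {κ δ l r : ℝ} (hs0 : 0 < s) (hs1 : s < 1) (hκ0 : 0 < κ)
    (hκ : κ ≤ 1 - s) (ht₀ : 0 < t₀) (ht₁ : t₀ ≤ 1) (hδ0 : 0 < δ) (hδ : δ ≤ t₀ / 2)
    (hr : 0 ≤ r) (hl : |l| ≤ r) :
    profile s t₀ (δ + l + r ^ 2) ≤ (max (δ + l) 0) ^ s - (max (δ + l) 0) ^ (3 * s / 2) +
      if r < 1 then 5 * (4 / t₀) ^ 2 * δ ^ (-κ) * r ^ (2 * s + κ) else 5 * r ^ (3 * s / 2) := by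
  have hl' := abs_le.1 hl
  have hmle : max (δ + l) 0 ≤ 1 + r := max_le (by linarith) (by linarith)
  have hmb : (max (δ + l) 0) ^ (3 * s / 2) ≤ (1 + r) ^ (3 * s / 2) :=
    Real.rpow_le_rpow (le_max_right _ _) hmle (by positivity)
  have h2p : (2 : ℝ) ^ (3 * s / 2) ≤ 4 := by
    have := Real.rpow_le_rpow_of_exponent_le (one_le_two (α := ℝ)) (by linarith : 3 * s / 2 ≤ 2)
    rw [Real.rpow_two] at this; linarith
  have hs' : 0 ≤ (max (δ + l) 0) ^ s := by positivity
  have hp1 := profile_le_one (s := s) hs0 ht₀ ht₁ (δ + l + r ^ 2)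
  split_ifs with h
  · have hT : 16 ≤ (4 / t₀) ^ 2 := by
      have : 4 ≤ 4 / t₀ := by rw [le_div_iff₀ ht₀]; nlinarith
      nlinarith
    have hD : 1 ≤ δ ^ (-κ) :=
      Real.one_le_rpow_of_pos_of_le_one_of_nonpos hδ0 (by linarith) (by linarith)
    rcases le_or_gt (δ + l + r ^ 2) t₀ with hf | hf
    · have h1 := max_rpow_add_sq_le hs0 hs1 hκ0 hκ hδ0 (by linarith) hr hl
      have h2 : (max (δ + l) 0) ^ (3 * s / 2) ≤ (max (δ + l + r ^ 2) 0) ^ (3 * s / 2) := by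
        exact Real.rpow_le_rpow (le_max_right _ _) (max_le_max_right 0 (by nlinarith))
          (by positivity)
      have h3 : 2 * δ ^ (-κ) * r ^ (2 * s + κ) ≤
          5 * (4 / t₀) ^ 2 * δ ^ (-κ) * r ^ (2 * s + κ) := by gcongr; linarith
      rw [profile, min_eq_left (max_le hf ht₀.le)]
      linarith
    · have hrt : t₀ / 4 ≤ r := by nlinarith
      have hr0 : 0 < r := by linarith
      have h1 : 1 ≤ (4 / t₀ * r) ^ (2 * s + κ) := Real.one_le_rpow
        (by rw [div_mul_eq_mul_div, le_div_iff₀ ht₀]; linarith) (by linarith)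
      have h2 : (4 / t₀) ^ (2 * s + κ) ≤ (4 / t₀) ^ 2 := by
        rw [← Real.rpow_two]
        exact Real.rpow_le_rpow_of_exponent_le (by rw [le_div_iff₀ ht₀]; linarith) (by linarith)
      rw [Real.mul_rpow (by positivity) hr] at h1
      have h3 : 1 ≤ (4 / t₀) ^ 2 * δ ^ (-κ) * r ^ (2 * s + κ) := by
        calc 1 ≤ (4 / t₀) ^ (2 * s + κ) * r ^ (2 * s + κ) := h1
          _ ≤ (4 / t₀) ^ 2 * r ^ (2 * s + κ) := by gcongr
          _ ≤ (4 / t₀) ^ 2 * δ ^ (-κ) * r ^ (2 * s + κ) := by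
              gcongr; exact le_mul_of_one_le_right (by positivity) hD
      have h4 : (1 + r) ^ (3 * s / 2) ≤ 2 ^ (3 * s / 2) := by gcongr; linarith
      linarith
  · have h1 : (1 + r) ^ (3 * s / 2) ≤ (2 * r) ^ (3 * s / 2) := by gcongr; linarith
    rw [Real.mul_rpow (by norm_num) hr] at h1
    have h2 : 1 ≤ r ^ (3 * s / 2) := Real.one_le_rpow (by linarith) (by positivity)
    have h3 : (2 : ℝ) ^ (3 * s / 2) * r ^ (3 * s / 2) ≤ 4 * r ^ (3 * s / 2) := by gcongr
    linarith

/-- Weighted arithmetic-geometric comparison of the two powers occurring in the barrier. -/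
theorem halfSpace_gain {δ l : ℝ} (hs0 : 0 < s) (hδ0 : 0 < δ) :
    δ ^ (3 * s / 2) - (max (δ + l) 0) ^ (3 * s / 2) ≤
      3 / 2 * δ ^ (3 * s / 2) * (1 - (max (1 + l / δ) 0) ^ s) -
        if δ + l ≤ 0 then δ ^ (3 * s / 2) / 2 else 0 := by
  set τ := max (1 + l / δ) 0 with hτ
  have hτ0 : 0 ≤ τ := le_max_right _ _
  have e : max (δ + l) 0 = δ * τ := by
    rw [hτ, mul_max_of_nonneg _ _ hδ0.le, mul_zero]; congr 1; field_simp
  have hD : 0 < δ ^ (3 * s / 2) := by positivity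
  split_ifs with h
  · have h0 : τ = 0 := max_eq_right (by
      have : 1 + l / δ = (δ + l) / δ := by field_simp
      rw [this]; exact div_nonpos_of_nonpos_of_nonneg h hδ0.le)
    rw [e, h0, mul_zero, Real.zero_rpow hs0.ne', Real.zero_rpow (by positivity)]
    linarith
  · have h1 : 1 + 3 / 2 * (τ ^ s - 1) ≤ τ ^ (3 * s / 2) := by
      have := one_add_mul_self_le_rpow_one_add (s := τ ^ s - 1) (p := 3 / 2)
        (by have : 0 ≤ τ ^ s := by positivity
            linarith) (by norm_num)
      rw [add_sub_cancel, ← Real.rpow_mul hτ0] at this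
      convert this using 2; ring
    rw [e, Real.mul_rpow hδ0.le hτ0]
    nlinarith

end profile

end

section

variable {n : ℕ}

/-- The truncated fractional Laplacian, without the normalisation constant. -/
def trunc (s : ℝ) (w : Euc n → ℝ) (x : Euc n) (ε : ℝ) : ℝ :=
  ∫ z in {z : Euc n | ε ≤ ‖z‖}, (w x - w (x + z)) * ker n s z

theorem fracC_pos (n : ℕ) {s : ℝ} (hs0 : 0 < s) (hs1 : s < 1) : 0 < fracC n s := by
  have h1 : 0 < Real.Gamma ((n : ℝ) / 2 + s) := Real.Gamma_pos_of_pos (by positivity)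
  have h2 : 0 < Real.Gamma (1 - s) := Real.Gamma_pos_of_pos (by linarith)
  unfold fracC
  positivity

theorem setIntegral_translate (x : Euc n) (f : Euc n → ℝ) (S : Set (Euc n)) :
    ∫ z in (fun z => x + z) ⁻¹' S, f (x + z) = ∫ y in S, f y :=
  (measurePreserving_add_left volume x).setIntegral_preimage_emb
    (measurableEmbedding_addLeft x) f S

theorem integrableOn_translate (x : Euc n) {f : Euc n → ℝ} {S : Set (Euc n)} :
    IntegrableOn (fun z => f (x + z)) ((fun z => x + z) ⁻¹' S) ↔ IntegrableOn f S :=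
  (measurePreserving_add_left volume x).integrableOn_comp_preimage (measurableEmbedding_addLeft x)

theorem setIntegral_comp_neg {S : Set (Euc n)} (hS : ∀ z, -z ∈ S ↔ z ∈ S) (f : Euc n → ℝ) :
    ∫ z in S, f (-z) = ∫ z in S, f z := by
  have h := (Measure.measurePreserving_neg (volume : Measure (Euc n))).setIntegral_preimage_emb
    (MeasurableEquiv.neg (Euc n)).measurableEmbedding f S
  rwa [show Neg.neg ⁻¹' S = S from Set.ext hS] at h

theorem setIntegral_odd {S : Set (Euc n)} (hS : ∀ z, -z ∈ S ↔ z ∈ S) {f : Euc n → ℝ}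
    (hf : ∀ z, f (-z) = -f z) : ∫ z in S, f z = 0 := by
  have h := setIntegral_comp_neg hS f
  simp only [hf, integral_neg] at h
  linarith

theorem neg_mem_far (r : ℝ) (z : Euc n) : -z ∈ {z : Euc n | r ≤ ‖z‖} ↔ z ∈ {z : Euc n | r ≤ ‖z‖} := by
  simp

theorem tendsto_trunc {s : ℝ} (hs0 : 0 < s) (hs1 : s < 1) {u : Euc n → ℝ} {x : Euc n} {v : ℝ}
    (h : HasFracLapAt n s u x v) :
    Tendsto (trunc s u x) (𝓝[>] 0) (𝓝 (v / fracC n s)) := by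
  have hc := fracC_pos n hs0 hs1
  have h' := h.div_const (fracC n s)
  refine h'.congr fun ε => ?_
  rw [mul_div_cancel_left₀ _ hc.ne', trunc, ← setIntegral_translate x]
  have : (fun z => x + z) ⁻¹' {y | ε ≤ dist x y} = {z | ε ≤ ‖z‖} := by
    ext z; simp
  rw [this]
  refine setIntegral_congr_fun (measurableSet_far ε) fun z _ => ?_
  simp only [dist_self_add_right, div_eq_mul_inv, ker, Real.rpow_neg (norm_nonneg z)]

variable [NeZero n]

theorem tendsto_setIntegral_far {F : Euc n → ℝ} (hF : Integrable F) :
    Tendsto (fun ε : ℝ => ∫ z in {z : Euc n | ε ≤ ‖z‖}, F z) (𝓝[>] 0) (𝓝 (∫ z, F z)) := by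
  simp only [← integral_indicator (measurableSet_far _)]
  refine tendsto_integral_filter_of_dominated_convergence (fun z => ‖F z‖)
    (.of_forall fun ε => (hF.1.indicator (measurableSet_far ε)))
    (.of_forall fun ε => .of_forall fun z => norm_indicator_le_norm_self _ _) hF.norm
    (ae_ne_zero.mono fun z hz => ?_)
  refine tendsto_const_nhds.congr' ?_
  filter_upwards [Ioc_mem_nhdsGT (norm_pos_iff.2 hz)] with ε hε
  exact (indicator_of_mem (show z ∈ {z : Euc n | ε ≤ ‖z‖} from hε.2) F).symm

theorem integrableOn_bounded_mul_ker {s ε K : ℝ} (hs0 : 0 < s) (hε : 0 < ε) {w : Euc n → ℝ}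
    (hw : AEStronglyMeasurable w) (hK : ∀ z, |w z| ≤ K) :
    IntegrableOn (fun z => w z * ker n s z) {z | ε ≤ ‖z‖} :=
  (far_ker hs0 hε).1.bdd_mul hw.restrict (.of_forall hK)

/-- The kernel has large mass on balls at distance comparable to their radius. -/
theorem mul_le_setIntegral_ker {s r R : ℝ} (hs0 : 0 < s) (hr : 0 < r) {z₀ : Euc n}
    (hR : ∀ z ∈ closedBall z₀ r, r ≤ ‖z‖ ∧ ‖z‖ ≤ R) :
    volume.real (ball (0 : Euc n) 1) * r ^ n * R ^ (-((n : ℝ) + 2 * s)) ≤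
      ∫ z in closedBall z₀ r, ker n s z := by
  have hI : IntegrableOn (ker n s) (closedBall z₀ r) :=
    (far_ker hs0 hr).1.mono_set fun z hz => (hR z hz).1
  have h1 := setIntegral_ge_of_const_le_real (c := R ^ (-((n : ℝ) + 2 * s)))
    (f := ker n s) measurableSet_closedBall (measure_closedBall_lt_top (x := z₀) (r := r)).ne (fun z hz =>
      Real.rpow_le_rpow_of_nonpos (hr.trans_le (hR z hz).1) (hR z hz).2 (by
        have : 0 ≤ (n : ℝ) := n.cast_nonneg
        linarith)) hI
  have h2 : volume.real (closedBall z₀ r) = volume.real (ball (0 : Euc n) 1) * r ^ n := by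
    rw [measureReal_def, Measure.addHaar_closedBall _ _ hr.le, ENNReal.toReal_mul,
      ENNReal.toReal_ofReal (by positivity), finrank_euclideanSpace_fin, mul_comm, measureReal_def]
  rw [h2] at h1
  linarith

end

section

variable {n : ℕ}

/-- The constant measuring the mass of the half space behind a boundary point. -/
def gainConst (n : ℕ) (s ρ : ℝ) : ℝ :=
  volume.real (ball (0 : Euc n) 1) * (1 / (2 * ρ)) ^ n * (3 / (2 * ρ)) ^ (-((n : ℝ) + 2 * s))

theorem gainConst_pos {s ρ : ℝ} (hρ : 0 < ρ) : 0 < gainConst n s ρ := by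
  have : 0 < volume.real (ball (0 : Euc n) 1) :=
    ENNReal.toReal_pos (measure_ball_pos _ _ one_pos).ne' measure_ball_lt_top.ne
  unfold gainConst; positivity

theorem measurableSet_halfSpace (δ : ℝ) (b : Euc n) : MeasurableSet {z | δ + ⟪b, z⟫ ≤ 0} :=
  (isClosed_le (by fun_prop) continuous_const).measurableSet

variable [NeZero n]

/-- The error kernel of the barrier estimate. -/
def barrierErr (s κ A r : ℝ) : ℝ :=
  if r < 1 then A * r ^ (2 * s + κ) else 5 * r ^ (3 * s / 2)

theorem barrierErr_integrable {s κ A : ℝ} (hs0 : 0 < s) (hκ0 : 0 < κ) :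
    Integrable (fun z : Euc n => barrierErr s κ A ‖z‖ * ker n s z) ∧
    ∫ z : Euc n, barrierErr s κ A ‖z‖ * ker n s z =
      sphereArea n * (A / κ + 5 / (s / 2)) := by
  have h1 := near_rpow_ker (n := n) (s := s) (p := 2 * s + κ) (by linarith) one_pos
  have h2 := far_rpow_ker (n := n) (s := s) (p := 3 * s / 2) (by linarith) one_pos
  have e1 : EqOn (fun z : Euc n => A * (‖z‖ ^ (2 * s + κ) * ker n s z))
      (fun z => barrierErr s κ A ‖z‖ * ker n s z) {z | ‖z‖ < 1} := fun z hz => by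
    simp only [barrierErr, if_pos (show ‖z‖ < 1 from hz)]; ring
  have e2 : EqOn (fun z : Euc n => 5 * (‖z‖ ^ (3 * s / 2) * ker n s z))
      (fun z => barrierErr s κ A ‖z‖ * ker n s z) {z | 1 ≤ ‖z‖} := fun z hz => by
    simp only [barrierErr, if_neg (not_lt.2 (show 1 ≤ ‖z‖ from hz))]; ring
  have i1 := (integrableOn_congr_fun e1 (measurableSet_near 1)).1 (h1.1.const_mul A)
  have i2 := (integrableOn_congr_fun e2 (measurableSet_far 1)).1 (h2.1.const_mul 5)
  refine ⟨?_, ?_⟩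
  · rw [← integrableOn_univ, ← near_union_far 1]; exact i1.union i2
  · rw [← setIntegral_univ, ← near_union_far 1, setIntegral_union _ (measurableSet_far 1) i1 i2,
      ← setIntegral_congr_fun (measurableSet_near 1) e1,
      ← setIntegral_congr_fun (measurableSet_far 1) e2, integral_const_mul, integral_const_mul,
      h1.2, h2.2]
    · simp only [Real.one_rpow]; ring_nf
    · exact disjoint_left.2 fun z hz hz' => absurd (show ‖z‖ < 1 from hz) (not_lt.2 hz')

theorem integrableOn_halfSpace {s ε : ℝ} (hs0 : 0 < s) (hs1 : s < 1) (hε : 0 < ε) (a : Euc n) :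
    IntegrableOn (fun z => (1 - (max (1 + ⟪a, z⟫) 0) ^ s) * ker n s z) {z | ε ≤ ‖z‖} := by
  have hc : Continuous fun z : Euc n => 1 - (max (1 + ⟪a, z⟫) 0) ^ s := by
    refine continuous_const.sub (Continuous.rpow_const ?_ fun _ => .inr hs0.le)
    fun_prop
  refine Integrable.mono' (((far_ker hs0 hε).1.const_mul 2).add
    ((far_rpow_ker (p := s) (s := s) (by linarith) hε).1.const_mul (‖a‖ ^ s)))
    (hc.measurable.mul (measurable_ker s)).aestronglyMeasurable (.of_forall fun z => ?_)
  rw [norm_mul, Real.norm_of_nonneg (ker_nonneg s z), Real.norm_eq_abs, Pi.add_apply,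
    ← mul_assoc, ← add_mul]
  have h1 := max_rpow_le hs0 hs1 ⟪a, z⟫
  have h2 : |⟪a, z⟫| ^ s ≤ (‖a‖ * ‖z‖) ^ s := by
    gcongr; exact abs_real_inner_le_norm a z
  rw [Real.mul_rpow (norm_nonneg _) (norm_nonneg _)] at h2
  have h3 : 0 ≤ (max (1 + ⟪a, z⟫) 0) ^ s := by positivity
  have h4 : 0 ≤ ‖a‖ ^ s * ‖z‖ ^ s := by positivity
  gcongr
  · exact ker_nonneg s z
  · rw [abs_le]; constructor <;> linarith

theorem tendsto_halfSpace {s : ℝ} (hs0 : 0 < s) (hs1 : s < 1) (a : Euc n) :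
    Tendsto (fun ε : ℝ => ∫ z in {z : Euc n | ε ≤ ‖z‖},
      (1 - (max (1 + ⟪a, z⟫) 0) ^ s) * ker n s z) (𝓝[>] 0) (𝓝 0) := by
  have h := (tendsto_setIntegral_far (integrable_secDiff_inner hs0 hs1 a)).div_const 2
  rw [integral_secDiff_inner hs0 hs1, zero_div] at h
  refine h.congr' ?_
  filter_upwards [self_mem_nhdsWithin] with ε hε
  set f : Euc n → ℝ := fun z => (1 - (max (1 + ⟪a, z⟫) 0) ^ s) * ker n s z with hf
  have hi : IntegrableOn f {z | ε ≤ ‖z‖} := integrableOn_halfSpace hs0 hs1 hε a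
  have hi' : IntegrableOn (fun z => f (-z)) {z | ε ≤ ‖z‖} := by
    simpa [hf, ker_neg] using integrableOn_halfSpace hs0 hs1 hε (-a)
  have e : ∀ z, secDiff s ⟪a, z⟫ * ker n s z = f z + f (-z) := fun z => by
    simp only [hf, secDiff, inner_neg_right, ker_neg, ← sub_eq_add_neg]; ring
  simp only [e]
  rw [integral_add hi hi', setIntegral_comp_neg (neg_mem_far ε)]
  ring

theorem gain_le {s ρ δ ε : ℝ} (hs0 : 0 < s) (hρ : 0 < ρ) (hδ : 0 < δ) (hε : 0 < ε)
    (hεδ : ε ≤ δ / (2 * ρ)) {b : Euc n} (hb : 2 * ρ ≤ ‖b‖) :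
    gainConst n s ρ * δ ^ (-(2 * s)) ≤
      ∫ z in {z : Euc n | ε ≤ ‖z‖}, {z | δ + ⟪b, z⟫ ≤ 0}.indicator (ker n s) z := by
  have hb0 : 0 < ‖b‖ := by linarith
  set r := δ / (2 * ρ) with hr
  have hr0 : 0 < r := by positivity
  set z₀ : Euc n := (-(2 * r) / ‖b‖) • b with hz₀
  have hnz : ‖z₀‖ = 2 * r := by
    rw [hz₀, norm_smul, norm_div, norm_neg, norm_norm, Real.norm_of_nonneg (by positivity)]
    field_simp
  have hiz : ⟪b, z₀⟫ = -(2 * r * ‖b‖) := by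
    rw [hz₀, inner_smul_right, real_inner_self_eq_norm_sq]; field_simp
  have hmem : ∀ z ∈ closedBall z₀ r, r ≤ ‖z‖ ∧ ‖z‖ ≤ 3 * r := fun z hz => by
    have h1 : ‖z - z₀‖ ≤ r := by simpa [dist_eq_norm] using hz
    have h2 := abs_le.1 ((abs_norm_sub_norm_le z z₀).trans h1)
    constructor <;> linarith [h2.1, h2.2]
  have hhalf : ∀ z ∈ closedBall z₀ r, δ + ⟪b, z⟫ ≤ 0 := fun z hz => by
    have h1 : ‖z - z₀‖ ≤ r := by simpa [dist_eq_norm] using hz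
    have h2 : ⟪b, z - z₀⟫ ≤ ‖b‖ * r := (real_inner_le_norm _ _).trans (by gcongr)
    rw [inner_sub_right, hiz] at h2
    have h3 : 2 * ρ * r ≤ ‖b‖ * r := by gcongr
    have h4 : 2 * ρ * r = δ := by rw [hr]; field_simp
    linarith
  have key := mul_le_setIntegral_ker (s := s) hs0 hr0 hmem
  have e : gainConst n s ρ * δ ^ (-(2 * s)) =
      volume.real (ball (0 : Euc n) 1) * r ^ n * (3 * r) ^ (-((n : ℝ) + 2 * s)) := by
    have e1 : r = δ * (1 / (2 * ρ)) := by rw [hr]; ring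
    have e2 : 3 * r = δ * (3 / (2 * ρ)) := by rw [hr]; ring
    have e3 : δ ^ (-(2 * s)) = δ ^ n * δ ^ (-((n : ℝ) + 2 * s)) := by
      rw [← Real.rpow_natCast, ← Real.rpow_add hδ]; ring_nf
    rw [e2, Real.mul_rpow hδ.le (by positivity), e1, mul_pow, e3, gainConst]
    ring
  rw [e]
  refine key.trans ?_
  rw [setIntegral_indicator (measurableSet_halfSpace δ b)]
  exact setIntegral_mono_set ((far_ker hs0 hε).1.mono_set inter_subset_left)
    (.of_forall fun z => ker_nonneg s z)
    (LE.le.eventuallyLE fun z hz => ⟨hεδ.trans (hmem z hz).1, hhalf z hz⟩)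

theorem barrier_trunc_ge {s κ t₀ ρ : ℝ} (hs0 : 0 < s) (hs1 : s < 1) (hκ0 : 0 < κ)
    (hκ : κ ≤ 1 - s) (ht₀ : 0 < t₀) (ht₁ : t₀ ≤ 1 / 8) (hρ : 0 < ρ) (hρ1 : ρ ≤ 1 / 8)
    (c x : Euc n) {δ : ℝ} (hδ : δ = ‖x - c‖ ^ 2 - ρ ^ 2) (hδ0 : 0 < δ) (hδ1 : δ ≤ t₀ / 2) :
    ∀ᶠ ε in 𝓝[>] (0 : ℝ),
      gainConst n s ρ / 2 * δ ^ (-(s / 2)) -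
          sphereArea n * (5 * (4 / t₀) ^ 2 * δ ^ (-κ) / κ + 5 / (s / 2)) - 1 ≤
        trunc s (fun y => profile s t₀ (‖y - c‖ ^ 2 - ρ ^ 2)) x ε := by
  set b : Euc n := (2 : ℝ) • (x - c) with hb
  set a : Euc n := δ⁻¹ • b with ha
  set A := 5 * (4 / t₀) ^ 2 * δ ^ (-κ) with hA
  have hbn : ‖b‖ = 2 * ‖x - c‖ := by rw [hb, norm_smul]; norm_num
  have hb1 : 2 * ρ ≤ ‖b‖ := by
    rw [hbn]; nlinarith [norm_nonneg (x - c)]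
  have hb2 : ‖b‖ ≤ 1 := by
    rw [hbn]; nlinarith [norm_nonneg (x - c)]
  have hf : ∀ z, ‖x + z - c‖ ^ 2 - ρ ^ 2 = δ + ⟪b, z⟫ + ‖z‖ ^ 2 := fun z => by
    rw [hδ, hb, real_inner_smul_left, show x + z - c = (x - c) + z by abel, norm_add_sq_real]
    ring
  have hai : ∀ z, ⟪a, z⟫ = ⟪b, z⟫ / δ := fun z => by
    rw [ha, real_inner_smul_left]; field_simp
  have hlim := (tendsto_halfSpace hs0 hs1 a).const_mul (δ ^ s - 3 / 2 * δ ^ (3 * s / 2))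
  rw [mul_zero] at hlim
  have hpt : ∀ z : Euc n, (δ ^ s - 3 / 2 * δ ^ (3 * s / 2)) *
        ((1 - (max (1 + ⟪a, z⟫) 0) ^ s) * ker n s z) +
        δ ^ (3 * s / 2) / 2 * {z | δ + ⟪b, z⟫ ≤ 0}.indicator (ker n s) z -
        barrierErr s κ A ‖z‖ * ker n s z ≤
      (profile s t₀ (‖x - c‖ ^ 2 - ρ ^ 2) -
        profile s t₀ (‖x + z - c‖ ^ 2 - ρ ^ 2)) * ker n s z := fun z => by
    have hl : |⟪b, z⟫| ≤ ‖z‖ :=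
      (abs_real_inner_le_norm b z).trans (mul_le_of_le_one_left (norm_nonneg z) hb2)
    have h1 := profile_le_halfSpace (t₀ := t₀) hs0 hs1 hκ0 hκ ht₀ (by linarith) hδ0 hδ1
      (norm_nonneg z) hl
    have h2 := halfSpace_gain (l := ⟪b, z⟫) hs0 hδ0
    have h3 : profile s t₀ δ = δ ^ s - δ ^ (3 * s / 2) := by
      rw [profile, max_eq_left hδ0.le, min_eq_left (by linarith)]
    have h4 : (max (δ + ⟪b, z⟫) 0) ^ s = δ ^ s * (max (1 + ⟪a, z⟫) 0) ^ s := by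
      rw [← Real.mul_rpow hδ0.le (le_max_right _ _), mul_max_of_nonneg _ _ hδ0.le, mul_zero, hai]
      congr 2; field_simp
    have h5 : {z | δ + ⟪b, z⟫ ≤ 0}.indicator (ker n s) z =
        (if δ + ⟪b, z⟫ ≤ 0 then 1 else 0) * ker n s z := by
      simp [indicator]
    rw [hf, ← hδ, h3, h5]
    rw [← hai] at h2
    rw [h4] at h1
    have hk := ker_nonneg s z
    have hB : (if ‖z‖ < 1 then A * ‖z‖ ^ (2 * s + κ) else 5 * ‖z‖ ^ (3 * s / 2)) =
      barrierErr s κ A ‖z‖ := rfl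
    rw [hB] at h1
    have h6 : (if δ + ⟪b, z⟫ ≤ 0 then δ ^ (3 * s / 2) / 2 else 0) =
        δ ^ (3 * s / 2) / 2 * (if δ + ⟪b, z⟫ ≤ 0 then 1 else 0) := by simp
    rw [h6] at h2
    have := mul_le_mul_of_nonneg_right (add_le_add h1 h2) hk
    nlinarith [this]
  filter_upwards [Ioc_mem_nhdsGT (show 0 < δ / (2 * ρ) by positivity),
    hlim.eventually (lt_mem_nhds (show (-1 : ℝ) < 0 by norm_num))] with ε hε hε1
  have I1 := (integrableOn_halfSpace hs0 hs1 hε.1 a).const_mul (δ ^ s - 3 / 2 * δ ^ (3 * s / 2))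
  have I2 : IntegrableOn (fun z => δ ^ (3 * s / 2) / 2 *
      {z | δ + ⟪b, z⟫ ≤ 0}.indicator (ker n s) z) {z | ε ≤ ‖z‖} :=
    ((far_ker hs0 hε.1).1.indicator (measurableSet_halfSpace δ b)).const_mul _
  have I3 := barrierErr_integrable (n := n) (A := A) hs0 hκ0
  have hψ : Continuous fun y : Euc n => profile s t₀ (‖y - c‖ ^ 2 - ρ ^ 2) :=
    (continuous_profile hs0).comp (by fun_prop)
  have I4 : IntegrableOn (fun z => (profile s t₀ (‖x - c‖ ^ 2 - ρ ^ 2) -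
      profile s t₀ (‖x + z - c‖ ^ 2 - ρ ^ 2)) * ker n s z) {z | ε ≤ ‖z‖} := by
    refine integrableOn_bounded_mul_ker (K := 1) hs0 hε.1
      (continuous_const.sub (hψ.comp (by fun_prop))).aestronglyMeasurable fun z => ?_
    have p1 := profile_nonneg (t₀ := t₀) hs0 ht₀ (by linarith)
    have p2 := profile_le_one (t₀ := t₀) hs0 ht₀ (by linarith)
    rw [abs_le]; constructor <;>
    linarith [p1 (‖x - c‖ ^ 2 - ρ ^ 2), p1 (‖x + z - c‖ ^ 2 - ρ ^ 2),
      p2 (‖x - c‖ ^ 2 - ρ ^ 2), p2 (‖x + z - c‖ ^ 2 - ρ ^ 2)]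
  have hmono := integral_mono ((I1.add I2).sub I3.1.integrableOn) I4 hpt
  have hE : ∫ z in {z : Euc n | ε ≤ ‖z‖}, barrierErr s κ A ‖z‖ * ker n s z ≤
      sphereArea n * (A / κ + 5 / (s / 2)) := by
    rw [← I3.2]
    refine setIntegral_le_integral I3.1 (.of_forall fun z => mul_nonneg ?_ (ker_nonneg s z))
    unfold barrierErr; split_ifs <;> positivity
  have hG := gain_le (s := s) hs0 hρ hδ0 hε.1 hε.2 hb1
  have hG' : gainConst n s ρ / 2 * δ ^ (-(s / 2)) =
      δ ^ (3 * s / 2) / 2 * (gainConst n s ρ * δ ^ (-(2 * s))) := by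
    have : δ ^ (-(s / 2)) = δ ^ (3 * s / 2) * δ ^ (-(2 * s)) := by
      rw [← Real.rpow_add hδ0]; ring_nf
    rw [this]; ring
  rw [integral_sub' (I1.add I2) I3.1.integrableOn, integral_add' I1 I2, integral_const_mul, integral_const_mul] at hmono
  have hG2 := mul_le_mul_of_nonneg_left hG (show 0 ≤ δ ^ (3 * s / 2) / 2 by positivity)
  rw [← hG'] at hG2
  rw [trunc]
  linarith

/-- Existence of a barrier for the exterior of a ball of radius `ρ`, uniformly in the centre. -/
theorem exists_barrier (n : ℕ) [NeZero n] {s ρ : ℝ} (hs0 : 0 < s) (hs1 : s < 1) (hρ : 0 < ρ)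
    (hρ1 : ρ ≤ 1 / 8) :
    ∃ H : ℝ → ℝ, Continuous H ∧ (∀ t, 0 ≤ H t) ∧ (∀ t, H t ≤ 1) ∧ (∀ t, H t ≤ (max t 0) ^ s) ∧
      ∃ δ₁ > 0, δ₁ ≤ 1 / 8 ∧ (∃ m > 0, ∀ t ≥ δ₁, m ≤ H t) ∧
        ∀ c x : Euc n, 0 < ‖x - c‖ ^ 2 - ρ ^ 2 → ‖x - c‖ ^ 2 - ρ ^ 2 < δ₁ →
          ∀ᶠ ε in 𝓝[>] (0 : ℝ), 1 ≤ trunc s (fun y => H (‖y - c‖ ^ 2 - ρ ^ 2)) x ε := by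
  set κ := min (s / 4) (1 - s) with hκ
  have hκ0 : 0 < κ := lt_min (by linarith) (by linarith)
  set t₀ : ℝ := min (1 / 8) ((1 / 2) ^ (2 / s)) with ht
  have ht₀ : 0 < t₀ := lt_min (by norm_num) (by positivity)
  have ht₁ : t₀ ≤ 1 / 8 := min_le_left _ _
  have hh : t₀ ^ (s / 2) ≤ 1 / 2 := by
    calc t₀ ^ (s / 2) ≤ ((1 / 2 : ℝ) ^ (2 / s)) ^ (s / 2) := by gcongr; exact min_le_right _ _
      _ = 1 / 2 := by
        rw [← Real.rpow_mul (by norm_num), show 2 / s * (s / 2) = 1 by field_simp, Real.rpow_one]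
  have hg := gainConst_pos (n := n) (s := s) hρ
  have hS := sphereArea_pos (n := n)
  set B := sphereArea n * (5 * (4 / t₀) ^ 2 / κ + 5 / (s / 2)) + 2 with hB
  have hlim : Tendsto (fun δ : ℝ => gainConst n s ρ / 2 * δ ^ (-(s / 4))) (𝓝[>] 0) atTop :=
    (tendsto_rpow_neg_nhdsGT_zero (by linarith)).const_mul_atTop (by positivity)
  obtain ⟨δ', hδ'0, hδ'⟩ := (mem_nhdsGT_iff_exists_Ioo_subset).1
    (hlim.eventually (eventually_ge_atTop B))
  have hδ'0 : 0 < δ' := hδ'0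
  set δ₁ := min δ' (t₀ / 2) with hδ₁
  have hδ₁0 : 0 < δ₁ := lt_min hδ'0 (by linarith)
  have hδ₁t : δ₁ ≤ t₀ / 2 := min_le_right _ _
  refine ⟨profile s t₀, continuous_profile hs0, profile_nonneg hs0 ht₀ (by linarith),
    profile_le_one hs0 ht₀ (by linarith), profile_le_rpow hs0 ht₀, δ₁, hδ₁0, by linarith,
    ⟨δ₁ ^ s / 2, by positivity, fun t h => half_rpow_le_profile hs0 hh hδ₁0 (by linarith) h⟩,
    fun c x h0 h1 => ?_⟩
  set δ := ‖x - c‖ ^ 2 - ρ ^ 2 with hδ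
  filter_upwards [barrier_trunc_ge hs0 hs1 hκ0 (min_le_right _ _) ht₀ ht₁ hρ hρ1 c x hδ h0
    (by linarith)] with ε hε
  refine le_trans ?_ hε
  have hb : B ≤ gainConst n s ρ / 2 * δ ^ (-(s / 4)) := hδ' ⟨h0, h1.trans_le (min_le_left _ _)⟩
  have h2 : 1 ≤ δ ^ (-(s / 4)) :=
    Real.one_le_rpow_of_pos_of_le_one_of_nonpos h0 (by linarith) (by linarith)
  have h3 : δ ^ (-κ) ≤ δ ^ (-(s / 4)) :=
    Real.rpow_le_rpow_of_exponent_ge h0 (by linarith) (by linarith [min_le_left (s / 4) (1 - s)])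
  have h4 : δ ^ (-(s / 2)) = δ ^ (-(s / 4)) * δ ^ (-(s / 4)) := by
    rw [← Real.rpow_add h0]; ring_nf
  set P := δ ^ (-(s / 4))
  have h5 : sphereArea n * (5 * (4 / t₀) ^ 2 * δ ^ (-κ) / κ + 5 / (s / 2)) ≤
      sphereArea n * (5 * (4 / t₀) ^ 2 / κ + 5 / (s / 2)) * P := by
    have e1 : 5 * (4 / t₀) ^ 2 * δ ^ (-κ) / κ ≤ 5 * (4 / t₀) ^ 2 / κ * P := by
      rw [mul_div_right_comm]; gcongr
    have e2 : 5 / (s / 2) ≤ 5 / (s / 2) * P := le_mul_of_one_le_right (by positivity) h2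
    have := mul_le_mul_of_nonneg_left (add_le_add e1 e2) hS.le
    linarith
  have h6 : B * P ≤ gainConst n s ρ / 2 * P * P := by gcongr
  rw [h4]
  nlinarith

end

section

variable {n : ℕ}

/-- The increment at `e` of the squared norm, localised to the ball of radius `r`. -/
def quad (r : ℝ) (e z : Euc n) : ℝ :=
  {z : Euc n | ‖z‖ < r}.indicator (fun z => 2 * ⟪z, e⟫ + ‖z‖ ^ 2) z

theorem quad_of_lt {r : ℝ} (e : Euc n) {z : Euc n} (h : ‖z‖ < r) :
    quad r e z = 2 * ⟪z, e⟫ + ‖z‖ ^ 2 := indicator_of_mem (show z ∈ {z : Euc n | ‖z‖ < r} from h) _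

theorem quad_of_le {r : ℝ} (e : Euc n) {z : Euc n} (h : r ≤ ‖z‖) : quad r e z = 0 :=
  indicator_of_notMem (show z ∉ {z : Euc n | ‖z‖ < r} from not_lt.2 h) _

theorem norm_add_sub_sq (x y z : Euc n) :
    ‖y + z - x‖ ^ 2 = ‖y - x‖ ^ 2 + (2 * ⟪z, y - x⟫ + ‖z‖ ^ 2) := by
  rw [show y + z - x = z + (y - x) by abel, norm_add_sq_real]; ring

theorem indicator_mul_ker {s : ℝ} (S : Set (Euc n)) (f : Euc n → ℝ) (z : Euc n) :
    S.indicator f z * ker n s z = S.indicator (fun z => f z * ker n s z) z := by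
  by_cases h : z ∈ S <;> simp [h]

/-- Mass of the kernel behind a boundary point seen from distance comparable to `d`. -/
def extConst (n : ℕ) (s ρ : ℝ) : ℝ :=
  volume.real (ball (0 : Euc n) 1) * (min 1 (ρ / 2) / 4) ^ n * 3 ^ (-((n : ℝ) + 2 * s))

theorem extConst_pos {s ρ : ℝ} (hρ : 0 < ρ) : 0 < extConst n s ρ := by
  have : 0 < volume.real (ball (0 : Euc n) 1) :=
    ENNReal.toReal_pos (measure_ball_pos _ _ one_pos).ne' measure_ball_lt_top.ne
  have : 0 < min 1 (ρ / 2) := lt_min one_pos (by linarith)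
  unfold extConst; positivity

variable [NeZero n]

theorem integrableOn_indicator_mul_ker {s ε r K : ℝ} (hs0 : 0 < s) (hε : 0 < ε) {f : Euc n → ℝ}
    (hf : Continuous f) (hK : ∀ z, ‖z‖ < r → |f z| ≤ K) (hK0 : 0 ≤ K) :
    IntegrableOn (fun z => {z : Euc n | ‖z‖ < r}.indicator f z * ker n s z) {z | ε ≤ ‖z‖} := by
  refine integrableOn_bounded_mul_ker (K := K) hs0 hε
    (hf.aestronglyMeasurable.indicator (measurableSet_near r)) fun z => ?_
  by_cases h : ‖z‖ < r
  · rw [indicator_of_mem (show z ∈ {z : Euc n | ‖z‖ < r} from h)]; exact hK z h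
  · rw [indicator_of_notMem (show z ∉ {z : Euc n | ‖z‖ < r} from h), abs_zero]; exact hK0

theorem quad_integral {s ε r : ℝ} (hs0 : 0 < s) (hs1 : s < 1) (hε : 0 < ε) (hr : 0 < r)
    (e : Euc n) :
    IntegrableOn (fun z => quad r e z * ker n s z) {z | ε ≤ ‖z‖} ∧
    ∫ z in {z : Euc n | ε ≤ ‖z‖}, quad r e z * ker n s z ≤
      sphereArea n * (r ^ (2 - 2 * s) / (2 - 2 * s)) := by
  set N : Set (Euc n) := {z : Euc n | ‖z‖ < r} with hN
  have i1 : IntegrableOn (fun z => N.indicator (fun z => 2 * ⟪z, e⟫) z * ker n s z)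
      {z | ε ≤ ‖z‖} := by
    refine integrableOn_indicator_mul_ker (K := 2 * (r * ‖e‖)) hs0 hε (by fun_prop) (fun z hz => ?_)
      (by positivity)
    rw [abs_mul, abs_two]
    gcongr
    exact (abs_real_inner_le_norm z e).trans (by gcongr)
  have i2 : IntegrableOn (fun z => N.indicator (fun z => ‖z‖ ^ 2) z * ker n s z)
      {z | ε ≤ ‖z‖} := by
    refine integrableOn_indicator_mul_ker (K := r ^ 2) hs0 hε (by fun_prop) (fun z hz => ?_)
      (by positivity)
    rw [abs_of_nonneg (by positivity)]; gcongr
  have e0 : (fun z => quad r e z * ker n s z) = fun z =>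
      N.indicator (fun z => 2 * ⟪z, e⟫) z * ker n s z +
        N.indicator (fun z => ‖z‖ ^ 2) z * ker n s z := by
    ext z
    by_cases h : z ∈ N <;> simp [quad, ← hN, h] ; ring
  rw [e0]
  refine ⟨i1.add i2, ?_⟩
  rw [integral_add i1 i2, setIntegral_odd (neg_mem_far ε), zero_add]
  · have h := near_sq_ker (n := n) hs1 hr
    rw [← h.2, ← integral_indicator (measurableSet_near r)]
    simp only [indicator_mul_ker]
    refine setIntegral_le_integral ((integrable_indicator_iff (measurableSet_near r)).2 h.1)
      (.of_forall fun z => indicator_nonneg (fun z _ => mul_nonneg (by positivity)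
        (ker_nonneg s z)) z)
  · intro z
    have : -z ∈ N ↔ z ∈ N := by simp [hN]
    by_cases h : z ∈ N <;> simp [this, h, ker_neg]

/-- A point `y` within half the boundary distance sees a substantial portion of the complement. -/
theorem exists_exterior_ball {s ρ d : ℝ} (hs0 : 0 < s) (hρ : 0 < ρ) (hd : 0 < d) (hd2 : d ≤ 2)
    {Ω : Set (Euc n)} {x y z₀ : Euc n} (hz : dist x z₀ = d) (hball : ball x d ⊆ Ω)
    (hT : TwoSidedBallAt n Ω ρ z₀) (hy : dist y x ≤ d / 2) :
    ∃ D : Set (Euc n), MeasurableSet D ∧ (∀ z ∈ D, y + z ∉ Ω ∧ d / 2 ≤ ‖z‖) ∧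
      extConst n s ρ * d ^ (-(2 * s)) ≤ ∫ z in D, ker n s z := by
  obtain ⟨ν, hν, -, hext⟩ := hT
  set m := min 1 (ρ / 2) with hm
  have hm0 : 0 < m := lt_min one_pos (by linarith)
  have hm1 : m ≤ 1 := min_le_left _ _
  have hmρ : d * m ≤ ρ := by
    have : m ≤ ρ / 2 := min_le_right _ _
    nlinarith
  have hmd : d * m ≤ d := by nlinarith
  set t := d * m with ht
  have ht0 : 0 < t := by positivity
  set c : Euc n := z₀ - (t / 2) • ν - y with hc
  have hmem : ∀ z ∈ closedBall c (t / 4), y + z ∉ Ω := fun z hz' => by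
    refine hext ?_
    rw [mem_ball, dist_eq_norm]
    have h1 : ‖z - c‖ ≤ t / 4 := by simpa [dist_eq_norm] using hz'
    have h2 : y + z - (z₀ - ρ • ν) = (z - c) + (ρ - t / 2) • ν := by
      rw [hc, sub_smul]; abel
    have h3 : ‖(ρ - t / 2) • ν‖ = ρ - t / 2 := by
      rw [norm_smul, hν, mul_one, Real.norm_of_nonneg (by linarith)]
    rw [h2]
    linarith [norm_add_le (z - c) ((ρ - t / 2) • ν)]
  have hfar : ∀ z ∈ closedBall c (t / 4), d / 2 ≤ ‖z‖ := fun z hz' => by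
    have h1 : d ≤ dist (y + z) x := not_lt.1 fun h => hmem z hz' (hball h)
    have h2 := dist_triangle (y + z) y x
    rw [dist_self_add_left] at h2
    linarith
  have hle : ∀ z ∈ closedBall c (t / 4), ‖z‖ ≤ 3 * d := fun z hz' => by
    have h1 : ‖z - c‖ ≤ t / 4 := by simpa [dist_eq_norm] using hz'
    have h2 : ‖c‖ ≤ dist x z₀ + dist y x + t / 2 := by
      have e : c = (z₀ - x) + (x - y) - (t / 2) • ν := by rw [hc]; abel
      have h3 : ‖(t / 2) • ν‖ = t / 2 := by
        rw [norm_smul, hν, mul_one, Real.norm_of_nonneg (by linarith)]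
      have h4 := norm_sub_le (z₀ - x + (x - y)) ((t / 2) • ν)
      have h5 := norm_add_le (z₀ - x) (x - y)
      rw [← e, h3] at h4
      rw [dist_comm x, dist_comm y, dist_eq_norm, dist_eq_norm]
      linarith
    have h3 : ‖z‖ ≤ ‖z - c‖ + ‖c‖ := by simpa using norm_add_le (z - c) c
    linarith
  refine ⟨closedBall c (t / 4), measurableSet_closedBall, fun z hz' => ⟨hmem z hz', hfar z hz'⟩, ?_⟩
  refine le_trans (le_of_eq ?_) (mul_le_setIntegral_ker (s := s) hs0 (by positivity)
    fun z hz' => ⟨by linarith [hfar z hz'], hle z hz'⟩)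
  have e3 : d ^ (-(2 * s)) = d ^ n * d ^ (-((n : ℝ) + 2 * s)) := by
    rw [← Real.rpow_natCast, ← Real.rpow_add hd]; ring_nf
  rw [Real.mul_rpow (by norm_num) hd.le, e3, extConst, ← hm, ht, show d * m / 4 = d * (m / 4) by ring,
    mul_pow]
  ring

theorem exists_nearest_frontier {E : Type*} [NormedAddCommGroup E] [NormedSpace ℝ E]
    [ProperSpace E] {Ω : Set E} (hΩ : IsOpen Ω) {x x₀ : E} (hx : x ∈ Ω) (hx₀ : x₀ ∉ Ω) :
    ∃ z₀ ∈ frontier Ω, 0 < dist x z₀ ∧ dist x z₀ ≤ dist x x₀ ∧ ball x (dist x z₀) ⊆ Ω := by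
  obtain ⟨z₀, hz₀, hd⟩ := hΩ.isClosed_compl.exists_infDist_eq_dist ⟨x₀, hx₀⟩ x
  have hball : ball x (dist x z₀) ⊆ Ω := by
    rw [← hd]; exact ball_infDist_compl_subset
  have hpos : 0 < dist x z₀ := dist_pos.2 fun h => hz₀ (h ▸ hx)
  refine ⟨z₀, ?_, hpos, hd ▸ infDist_le_dist_of_mem (show x₀ ∈ Ωᶜ from hx₀), hball⟩
  rw [frontier, hΩ.interior_eq]
  refine ⟨closure_mono hball ?_, hz₀⟩
  rw [closure_ball x hpos.ne', mem_closedBall, dist_comm]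

set_option maxHeartbeats 800000 in
/-- Maximum principle: a bounded function, positive only in a bounded part `U` of `Ω` where its
truncated fractional Laplacian is eventually nonpositive, is nonpositive everywhere. -/
theorem nonpos_of_trunc_nonpos {s ρ K : ℝ} (hs0 : 0 < s) (hs1 : s < 1) (hρ : 0 < ρ)
    {Ω U : Set (Euc n)} (hΩ : IsOpen Ω) {x₀ : Euc n} (hx₀ : x₀ ∉ Ω)
    (hT : ∀ z ∈ frontier Ω ∩ closedBall x₀ 4, TwoSidedBallAt n Ω ρ z)
    (hU : U ⊆ Ω ∩ ball x₀ 2) {v : Euc n → ℝ} (hv : ContinuousOn v (Ω ∩ ball x₀ 3))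
    (hvm : AEStronglyMeasurable v) (hK : ∀ y, |v y| ≤ K) (hvU : ∀ y ∉ U, v y ≤ 0)
    (hL : ∀ y ∈ U, ∀ᶠ ε in 𝓝[>] (0 : ℝ), trunc s v y ε ≤ 0) (y : Euc n) : v y ≤ 0 := by
  by_contra! hy
  have hbdd : BddAbove (range v) := ⟨K, by rintro _ ⟨z, rfl⟩; exact (abs_le.1 (hK z)).2⟩
  set S := ⨆ z, v z with hS
  have hle : ∀ z, v z ≤ S := le_ciSup hbdd
  have hS0 : 0 < S := hy.trans_le (hle y)
  have hc := extConst_pos (n := n) (s := s) hρ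
  set c₁ := extConst n s ρ with hc₁
  have hA := sphereArea_pos (n := n)
  have h22 : 0 < 2 - 2 * s := by linarith
  set C₂ := sphereArea n * (4 * (1 / 2 : ℝ) ^ (2 - 2 * s) / (2 - 2 * s) +
    (1 / 2 : ℝ) ^ (-(2 * s)) / (2 * s)) with hC₂
  have hC₂0 : 0 < C₂ := by positivity
  set θ := min S (S * c₁ / (4 * C₂)) with hθ
  have hθ0 : 0 < θ := lt_min hS0 (by positivity)
  have hθS : θ ≤ S := min_le_left _ _
  have hθC : θ * C₂ ≤ S * c₁ / 4 := by
    calc θ * C₂ ≤ S * c₁ / (4 * C₂) * C₂ := by gcongr; exact min_le_right _ _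
      _ = _ := by field_simp
  obtain ⟨x, hx⟩ : ∃ x, S - θ / 2 < v x := exists_lt_of_lt_ciSup (by linarith)
  have hxU : x ∈ U := by_contra fun h => by linarith [hvU x h]
  obtain ⟨z₀, hz₀, hd0, hdx, hball⟩ := exists_nearest_frontier hΩ (hU hxU).1 hx₀
  set d := dist x z₀ with hd
  have hxx : dist x x₀ < 2 := (hU hxU).2
  have hTz := hT z₀ ⟨hz₀, by
    rw [mem_closedBall]; linarith [dist_triangle z₀ x x₀, dist_comm z₀ x]⟩
  have hsub : closedBall x (d / 2) ⊆ Ω ∩ ball x₀ 3 := fun z hz => by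
    rw [mem_closedBall] at hz
    exact ⟨hball (by rw [mem_ball]; linarith),
      by rw [mem_ball]; linarith [dist_triangle z x x₀]⟩
  obtain ⟨p, hp, hmax⟩ := (isCompact_closedBall x (d / 2)).exists_isMaxOn
    (nonempty_closedBall.2 (by positivity))
    (f := fun z => v z + θ * (1 - 4 * ‖z - x‖ ^ 2 / d ^ 2))
    ((hv.mono hsub).add (by fun_prop))
  have hmax' : ∀ z ∈ closedBall x (d / 2), v z + θ * (1 - 4 * ‖z - x‖ ^ 2 / d ^ 2) ≤
    v p + θ * (1 - 4 * ‖p - x‖ ^ 2 / d ^ 2) := hmax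
  have hpx := hmax' x (mem_closedBall_self (by positivity))
  rw [sub_self, norm_zero, zero_pow two_ne_zero, mul_zero, zero_div, sub_zero, mul_one] at hpx
  have hq0 : 0 ≤ 4 * ‖p - x‖ ^ 2 / d ^ 2 := by positivity
  have hvp : S - θ / 2 ≤ v p := by linarith [mul_nonneg hθ0.le hq0]
  have hpU : p ∈ U := by_contra fun h => by linarith [hvU p h]
  have hpd : dist p x ≤ d / 2 := hp
  obtain ⟨D, hDm, hD, hDI⟩ := exists_exterior_ball hs0 hρ hd0 (by linarith) rfl hball hTz hpd
  obtain ⟨ε, hεL, hε0, hεd⟩ := ((hL p hpU).and (Ioc_mem_nhdsGT (half_pos hd0))).exists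
  have hpt : ∀ z : Euc n, -(4 * θ / d ^ 2) * (quad (d / 2) (p - x) z * ker n s z) -
      θ * {z : Euc n | d / 2 ≤ ‖z‖}.indicator (ker n s) z +
      S / 2 * D.indicator (ker n s) z ≤ (v p - v (p + z)) * ker n s z := fun z => by
    have hk := ker_nonneg s z
    rcases lt_or_ge ‖z‖ (d / 2) with h | h
    · have hzD : z ∉ D := fun h' => absurd (hD z h').2 (not_le.2 h)
      rw [indicator_of_notMem hzD,
        indicator_of_notMem (show z ∉ {z : Euc n | d / 2 ≤ ‖z‖} from not_le.2 h), quad_of_lt _ h]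
      have key : -(4 * θ / d ^ 2) * (2 * ⟪z, p - x⟫ + ‖z‖ ^ 2) ≤ v p - v (p + z) := by
        have e1 : θ * (1 - 4 * ‖p + z - x‖ ^ 2 / d ^ 2) - θ * (1 - 4 * ‖p - x‖ ^ 2 / d ^ 2) =
            -(4 * θ / d ^ 2) * (2 * ⟪z, p - x⟫ + ‖z‖ ^ 2) := by
          rw [norm_add_sub_sq]; ring
        rcases le_or_gt (dist (p + z) x) (d / 2) with h1 | h1
        · linarith [hmax' (p + z) h1]
        · have h2 : d ^ 2 ≤ 4 * ‖p + z - x‖ ^ 2 := by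
            rw [dist_eq_norm] at h1; nlinarith
          have h3 : 1 ≤ 4 * ‖p + z - x‖ ^ 2 / d ^ 2 := by rwa [one_le_div (by positivity)]
          have h4 := mul_nonneg hθ0.le (sub_nonneg.2 h3)
          rw [← e1]
          linarith [hle (p + z)]
      have := mul_le_mul_of_nonneg_right key hk
      linarith
    · rw [quad_of_le _ h, indicator_of_mem (show z ∈ {z : Euc n | d / 2 ≤ ‖z‖} from h)]
      by_cases hzD : z ∈ D
      · rw [indicator_of_mem hzD]
        have h1 := hvU (p + z) fun h' => (hD z hzD).1 (hU h').1
        have h2 : -θ + S / 2 ≤ v p - v (p + z) := by linarith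
        have := mul_le_mul_of_nonneg_right h2 hk
        linarith
      · rw [indicator_of_notMem hzD]
        have h2 : -θ ≤ v p - v (p + z) := by linarith [hle (p + z)]
        have := mul_le_mul_of_nonneg_right h2 hk
        linarith
  have Q := quad_integral (n := n) hs0 hs1 hε0 (half_pos hd0) (p - x)
  have F := far_ker (n := n) hs0 (half_pos hd0)
  have hk := (far_ker (n := n) hs0 hε0).1
  have I1 := Q.1.const_mul (-(4 * θ / d ^ 2))
  have I2 : IntegrableOn (fun z => θ * {z : Euc n | d / 2 ≤ ‖z‖}.indicator (ker n s) z)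
      {z | ε ≤ ‖z‖} := (hk.indicator (measurableSet_far _)).const_mul θ
  have I3 : IntegrableOn (fun z => S / 2 * D.indicator (ker n s) z) {z | ε ≤ ‖z‖} :=
    (hk.indicator hDm).const_mul (S / 2)
  have I4 : IntegrableOn (fun z => (v p - v (p + z)) * ker n s z) {z | ε ≤ ‖z‖} := by
    refine integrableOn_bounded_mul_ker (K := K + K) hs0 hε0 ?_ fun z => ?_
    · exact aestronglyMeasurable_const.sub
        (hvm.comp_measurePreserving (measurePreserving_add_left volume p))
    · exact (abs_sub _ _).trans (add_le_add (hK _) (hK _))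
  have hs₁ : {z : Euc n | d / 2 ≤ ‖z‖} ⊆ {z | ε ≤ ‖z‖} := fun z hz => hεd.trans hz
  have hs₂ : D ⊆ {z | ε ≤ ‖z‖} := fun z hz => hεd.trans (hD z hz).2
  have hmono := integral_mono ((I1.sub I2).add I3) I4 hpt
  rw [integral_add' (I1.sub I2) I3, integral_sub' I1 I2, integral_const_mul, integral_const_mul,
    integral_const_mul, setIntegral_indicator (measurableSet_far _), setIntegral_indicator hDm,
    inter_eq_right.2 hs₁, inter_eq_right.2 hs₂, F.2] at hmono
  have hQ := mul_le_mul_of_nonneg_left Q.2 (show 0 ≤ 4 * θ / d ^ 2 by positivity)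
  have hP : 0 < d ^ (-(2 * s)) := by positivity
  have e1 : 4 * θ / d ^ 2 * (sphereArea n * ((d / 2) ^ (2 - 2 * s) / (2 - 2 * s))) +
      θ * (sphereArea n * ((d / 2) ^ (-(2 * s)) / (2 * s))) = θ * C₂ * d ^ (-(2 * s)) := by
    have a1 : (d / 2) ^ (2 - 2 * s) = d ^ 2 * d ^ (-(2 * s)) * (1 / 2 : ℝ) ^ (2 - 2 * s) := by
      rw [← Real.rpow_two, ← Real.rpow_add hd0, ← sub_eq_add_neg,
        ← Real.mul_rpow hd0.le (by norm_num)]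
      ring_nf
    have a2 : (d / 2) ^ (-(2 * s)) = d ^ (-(2 * s)) * (1 / 2 : ℝ) ^ (-(2 * s)) := by
      rw [← Real.mul_rpow hd0.le (by norm_num)]; ring_nf
    rw [a1, a2, hC₂]; field_simp
  have hD2 := mul_le_mul_of_nonneg_left hDI (show 0 ≤ S / 2 by positivity)
  have hC3 := mul_le_mul_of_nonneg_right hθC hP.le
  rw [trunc] at hεL
  linarith [mul_pos (mul_pos hS0 hc) hP]

end

section

variable {n : ℕ}

/-- The localized problem: `0 ≤ w ≤ K` vanishes outside `Ω`, is continuous in `Ω ∩ B₃(x₀)`, and its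
unnormalized fractional Laplacian there is bounded by `K`. -/
structure IsLocalized (s ρ K : ℝ) (Ω : Set (Euc n)) (x₀ : Euc n) (w : Euc n → ℝ) : Prop where
  isOpen : IsOpen Ω
  frontier_mem : x₀ ∈ frontier Ω
  balls : ∀ z ∈ frontier Ω ∩ closedBall x₀ 4, TwoSidedBallAt n Ω ρ z
  pos : 0 < K
  nonneg : ∀ y, 0 ≤ w y
  le : ∀ y, w y ≤ K
  eq_zero : ∀ y ∉ Ω, w y = 0
  continuousOn : ContinuousOn w (Ω ∩ ball x₀ 3)
  meas : AEStronglyMeasurable w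
  eqn : ∀ y ∈ Ω ∩ ball x₀ 3, ∃ v, |v| ≤ K ∧ Tendsto (trunc s w y) (𝓝[>] 0) (𝓝 v)

namespace IsLocalized

variable {s ρ K : ℝ} {Ω : Set (Euc n)} {x₀ : Euc n} {w : Euc n → ℝ}

theorem notMem (h : IsLocalized s ρ K Ω x₀ w) : x₀ ∉ Ω := fun hx => by
  have := h.frontier_mem.2
  rw [h.isOpen.interior_eq] at this
  exact this hx

theorem abs_le (h : IsLocalized s ρ K Ω x₀ w) (y : Euc n) : |w y| ≤ K := by
  rw [abs_of_nonneg (h.nonneg y)]; exact h.le y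

end IsLocalized

variable [NeZero n]

theorem integrableOn_trunc {s K ε : ℝ} (hs0 : 0 < s) (hε : 0 < ε) {w : Euc n → ℝ}
    (hw : AEStronglyMeasurable w) (hK : ∀ y, |w y| ≤ K) (x : Euc n) :
    IntegrableOn (fun z => (w x - w (x + z)) * ker n s z) {z | ε ≤ ‖z‖} :=
  integrableOn_bounded_mul_ker (K := K + K) hs0 hε
    (aestronglyMeasurable_const.sub
      (hw.comp_measurePreserving (measurePreserving_add_left volume x)))
    fun _ => (abs_sub _ _).trans (add_le_add (hK _) (hK _))

theorem trunc_sub_const_mul {s K K' ε : ℝ} (hs0 : 0 < s) (hε : 0 < ε) {w ψ : Euc n → ℝ}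
    (hw : AEStronglyMeasurable w) (hK : ∀ y, |w y| ≤ K) (hψ : AEStronglyMeasurable ψ)
    (hK' : ∀ y, |ψ y| ≤ K') (a : ℝ) (x : Euc n) :
    trunc s (fun y => w y - a * ψ y) x ε = trunc s w x ε - a * trunc s ψ x ε := by
  rw [trunc, trunc, trunc, ← integral_const_mul, ← integral_sub
    (integrableOn_trunc hs0 hε hw hK x) ((integrableOn_trunc hs0 hε hψ hK' x).const_mul a)]
  congr 1; ext z; ring

/-- Boundary growth: a localized solution is bounded by the distance to a boundary point to the
power `s`. -/
theorem exists_growth (n : ℕ) [NeZero n] {s ρ : ℝ} (hs0 : 0 < s) (hs1 : s < 1) (hρ : 0 < ρ)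
    (hρ1 : ρ ≤ 1 / 8) : ∃ C : ℝ, 1 ≤ C ∧ ∀ (K : ℝ) (Ω : Set (Euc n)) (x₀ : Euc n) (w : Euc n → ℝ),
      IsLocalized s ρ K Ω x₀ w → ∀ z₀ ∈ frontier Ω, dist z₀ x₀ ≤ 3 / 2 →
        ∀ y, w y ≤ C * K * dist y z₀ ^ s := by
  obtain ⟨H, hHc, hH0, hH1, hHs, δ, hδ0, hδ1, ⟨m, hm0, hm⟩, hL⟩ := exists_barrier n hs0 hs1 hρ hρ1
  set A := max 2 m⁻¹ with hA
  have hA2 : 2 ≤ A := le_max_left _ _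
  have hAm : 1 ≤ A * m := by
    calc 1 = m⁻¹ * m := by field_simp
      _ ≤ _ := by gcongr; exact le_max_right _ _
  refine ⟨2 * A, by linarith, fun K Ω x₀ w h z₀ hz₀ hzx y => ?_⟩
  have hK0 := h.pos
  obtain ⟨ν, hν, -, hext⟩ := h.balls z₀ ⟨hz₀, by rw [mem_closedBall]; linarith⟩
  set c := z₀ - ρ • ν with hc
  have hcz : ‖z₀ - c‖ = ρ := by
    rw [hc, sub_sub_cancel, norm_smul, hν, mul_one, Real.norm_of_nonneg hρ.le]
  set f : Euc n → ℝ := fun y => ‖y - c‖ ^ 2 - ρ ^ 2 with hf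
  have hfΩ : ∀ y ∈ Ω, 0 < f y := fun y hy => by
    have h1 : y ∉ closedBall c ρ := fun h' => by
      rw [← closure_ball c hρ.ne'] at h'
      have := closure_mono hext h'
      rw [h.isOpen.isClosed_compl.closure_eq] at this
      exact this hy
    rw [mem_closedBall, not_le, dist_eq_norm] at h1
    simp only [hf]; nlinarith
  have key : ∀ y, w y - A * K * H (f y) ≤ 0 := by
    have hHm : AEStronglyMeasurable (fun y => H (f y)) (volume : Measure (Euc n)) :=
      (hHc.comp (by fun_prop)).aestronglyMeasurable
    have hHb : ∀ y, |H (f y)| ≤ 1 := fun y => by rw [abs_of_nonneg (hH0 _)]; exact hH1 _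
    refine nonpos_of_trunc_nonpos (U := Ω ∩ {y | f y < δ}) (K := K + A * K) hs0 hs1 hρ h.isOpen
      h.notMem h.balls ?_ ?_ ?_ ?_ ?_ ?_
    · rintro y ⟨hy, hyf⟩
      refine ⟨hy, ?_⟩
      have h1 : ‖y - c‖ < 3 / 8 := by
        have : ‖y - c‖ ^ 2 - ρ ^ 2 < δ := hyf
        by_contra! h2
        nlinarith
      rw [mem_ball]
      have h2 := dist_triangle y c x₀
      have h3 := dist_triangle c z₀ x₀
      rw [dist_eq_norm y c] at h2
      rw [dist_comm c z₀, dist_eq_norm z₀ c, hcz] at h3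
      linarith
    · exact h.continuousOn.sub (by fun_prop)
    · exact h.meas.sub (hHm.const_mul _)
    · intro y
      refine (abs_sub _ _).trans (add_le_add (h.abs_le y) ?_)
      rw [abs_mul, abs_of_nonneg (by positivity : 0 ≤ A * K)]
      exact mul_le_of_le_one_right (by positivity) (hHb y)
    · intro y hy
      have h0 := hH0 (f y)
      by_cases hyΩ : y ∈ Ω
      · have h1 : δ ≤ f y := not_lt.1 fun h' => hy ⟨hyΩ, h'⟩
        have h2 : A * K * m ≤ A * K * H (f y) := by gcongr; exact hm _ h1
        nlinarith [h.le y]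
      · rw [h.eq_zero y hyΩ]
        have : 0 ≤ A * K * H (f y) := by positivity
        linarith
    · rintro y ⟨hy, hyf⟩
      have hyx : y ∈ Ω ∩ ball x₀ 3 := by
        refine ⟨hy, ?_⟩
        have h1 : ‖y - c‖ < 3 / 8 := by
          have : ‖y - c‖ ^ 2 - ρ ^ 2 < δ := hyf
          by_contra! h2
          nlinarith
        rw [mem_ball]
        have h2 := dist_triangle y c x₀
        have h3 := dist_triangle c z₀ x₀
        rw [dist_eq_norm y c] at h2
        rw [dist_comm c z₀, dist_eq_norm z₀ c, hcz] at h3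
        linarith
      obtain ⟨v, hv, hT⟩ := h.eqn y hyx
      filter_upwards [hL c y (hfΩ y hy) hyf, self_mem_nhdsWithin,
        hT.eventually_lt_const (show v < 2 * K by linarith [(_root_.abs_le.1 hv).2])]
        with ε h1 hε h2
      rw [trunc_sub_const_mul hs0 hε h.meas h.abs_le hHm hHb]
      nlinarith [mul_pos (show 0 < A by linarith) hK0]
  set d := dist y z₀ with hd
  have hd0 : 0 ≤ d := dist_nonneg
  rcases le_or_gt d 1 with h1 | h1
  · have h2 : ‖y - c‖ ≤ d + ρ := by
      have := norm_add_le (y - z₀) (z₀ - c)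
      rwa [sub_add_sub_cancel, hcz, ← dist_eq_norm y z₀] at this
    have h3 : max (f y) 0 ≤ 2 * d := by
      refine max_le ?_ (by linarith)
      have : ‖y - c‖ ^ 2 ≤ (d + ρ) ^ 2 := by gcongr
      simp only [hf]; nlinarith
    have h4 : H (f y) ≤ 2 * d ^ s := calc
      H (f y) ≤ max (f y) 0 ^ s := hHs _
      _ ≤ (2 * d) ^ s := by gcongr
      _ = 2 ^ s * d ^ s := Real.mul_rpow (by norm_num) hd0
      _ ≤ 2 ^ (1 : ℝ) * d ^ s := by gcongr; norm_num
      _ = _ := by rw [Real.rpow_one]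
    have h5 : A * K * H (f y) ≤ A * K * (2 * d ^ s) := by gcongr
    linarith [key y]
  · have h2 : 1 ≤ d ^ s := Real.one_le_rpow h1.le hs0.le
    have h3 : 1 * 1 ≤ 2 * A * d ^ s := by gcongr; linarith
    nlinarith [h.le y]

end

section

theorem secDiff_pos {s t : ℝ} (hs0 : 0 < s) (hs1 : s < 1) (ht : |t| ≤ 1) (ht0 : t ≠ 0) :
    0 < secDiff s t := by
  obtain ⟨h1, h2⟩ := abs_le.1 ht
  have h := (Real.strictConcaveOn_rpow hs0 hs1).2 (show (1 + t) ∈ Ici (0 : ℝ) by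
    rw [mem_Ici]; linarith) (show (1 - t) ∈ Ici (0 : ℝ) by rw [mem_Ici]; linarith)
    (fun h => ht0 (by linarith)) (show (0 : ℝ) < 1 / 2 by norm_num)
    (show (0 : ℝ) < 1 / 2 by norm_num) (by norm_num)
  simp only [smul_eq_mul] at h
  rw [show 1 / 2 * (1 + t) + 1 / 2 * (1 - t) = 1 by ring, Real.one_rpow] at h
  rw [secDiff, max_eq_left (by linarith), max_eq_left (by linarith)]
  linarith

theorem secDiff_nonneg {s t : ℝ} (hs0 : 0 < s) (hs1 : s < 1) (ht : |t| ≤ 1) :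
    0 ≤ secDiff s t := by
  rcases eq_or_ne t 0 with rfl | h
  · rw [secDiff_zero]
  · exact (secDiff_pos hs0 hs1 ht h).le

variable {n : ℕ}

theorem norm_sub_reflection (a z : Euc n) :
    ‖a + z - (ℝ ∙ a)ᗮ.reflection z‖ = ‖a‖ * |1 + 2 * ⟪z, a⟫ / ‖a‖ ^ 2| := by
  have : a + z - (ℝ ∙ a)ᗮ.reflection z = (1 + 2 * ⟪z, a⟫ / ‖a‖ ^ 2) • a := by
    rw [Submodule.reflection_orthogonal_apply, Submodule.reflection_singleton_apply,
      real_inner_comm, add_smul, one_smul, ← Nat.cast_smul_eq_nsmul ℝ, smul_smul]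
    simp only [RCLike.ofReal_real_eq_id, id_eq, Nat.cast_ofNat]
    rw [mul_div_assoc]
    abel
  rw [this, norm_smul, mul_comm, Real.norm_eq_abs]

theorem setIntegral_near_isometry (R : Euc n ≃ₗᵢ[ℝ] Euc n) {F : Euc n → ℝ} {ε δ : ℝ}
    (hF : IntegrableOn F {z | ε ≤ ‖z‖}) :
    IntegrableOn (fun z => F (if ‖z‖ < δ then R z else z)) {z | ε ≤ ‖z‖} ∧
      ∫ z in {z | ε ≤ ‖z‖}, F (if ‖z‖ < δ then R z else z) = ∫ z in {z | ε ≤ ‖z‖}, F z := by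
  set N : Set (Euc n) := {z | ‖z‖ < δ} with hN
  have hNm : MeasurableSet N := measurableSet_near δ
  have hS : R ⁻¹' {z | ε ≤ ‖z‖} = {z | ε ≤ ‖z‖} := by ext z; simp
  have hR : MeasurableEmbedding R := R.toHomeomorph.measurableEmbedding
  have e1 : (fun z => F (if ‖z‖ < δ then R z else z)) =
      fun z => (N.indicator F ∘ R) z + Nᶜ.indicator F z := by
    ext z
    by_cases h : ‖z‖ < δ <;> simp [hN, h, indicator]
  have e2 : ∀ z, F z = N.indicator F z + Nᶜ.indicator F z := fun z =>
    (indicator_self_add_compl_apply N F z).symm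
  have i1 : IntegrableOn (N.indicator F ∘ R) {z | ε ≤ ‖z‖} := by
    have := (R.measurePreserving.integrableOn_comp_preimage hR).2 (hF.indicator hNm)
    rwa [hS] at this
  have i2 := hF.indicator hNm.compl
  rw [e1]
  refine ⟨i1.add i2, ?_⟩
  rw [integral_add i1 i2, integral_congr_ae (.of_forall e2), integral_add (hF.indicator hNm) i2]
  have := R.measurePreserving.setIntegral_preimage_emb hR (N.indicator F) {z | ε ≤ ‖z‖}
  rw [hS] at this
  rw [← this]; rfl

/-- The increment at `‖a‖` of the `s`-th power, along the difference of a translation by `z` and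
its reflection in the hyperplane orthogonal to `a`. -/
def reflIncr (s : ℝ) (a z : Euc n) : ℝ :=
  {z : Euc n | ‖z‖ < ‖a‖ / 2}.indicator
    (fun z => ‖a‖ ^ s * (1 - (max (1 + 2 * ⟪z, a⟫ / ‖a‖ ^ 2) 0) ^ s)) z

theorem abs_inner_div_le {a z : Euc n} (ha : a ≠ 0) (hz : ‖z‖ < ‖a‖ / 2) :
    |2 * ⟪z, a⟫ / ‖a‖ ^ 2| ≤ 1 := by
  have ha' := norm_pos_iff.2 ha
  rw [abs_div, abs_of_pos (by positivity : 0 < ‖a‖ ^ 2), div_le_one (by positivity), abs_mul,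
    abs_two]
  nlinarith [abs_real_inner_le_norm z a]

variable [NeZero n]

theorem exists_reflIncr_lower (n : ℕ) [NeZero n] {s : ℝ} (hs0 : 0 < s) (hs1 : s < 1) :
    ∃ c > 0, ∀ a : Euc n, a ≠ 0 → ∀ ε, 0 < ε → ε ≤ ‖a‖ / 8 →
      IntegrableOn (fun z => reflIncr s a z * ker n s z) {z | ε ≤ ‖z‖} ∧
      c * ‖a‖ ^ (-s) ≤ ∫ z in {z | ε ≤ ‖z‖}, reflIncr s a z * ker n s z := by
  obtain ⟨t₀, ht₀, hmin⟩ := (isCompact_Icc (a := (1 / 4 : ℝ)) (b := 3 / 4)).exists_isMinOn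
    (nonempty_Icc.2 (by norm_num)) (continuous_secDiff hs0).continuousOn
  set κ := secDiff s t₀ with hκ
  have hκ0 : 0 < κ := secDiff_pos hs0 hs1
    (by rw [abs_of_nonneg (by linarith [ht₀.1])]; linarith [ht₀.2]) (by linarith [ht₀.1])
  set V := volume.real (ball (0 : Euc n) 1) with hV
  have hV0 : 0 < V :=
    ENNReal.toReal_pos (measure_ball_pos _ _ one_pos).ne' measure_ball_lt_top.ne
  set c₁ := V * (1 / 8) ^ n * (3 / 8 : ℝ) ^ (-((n : ℝ) + 2 * s)) with hc₁
  have hc₁0 : 0 < c₁ := by positivity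
  refine ⟨κ * c₁ / 2, by positivity, fun a ha ε hε hεa => ?_⟩
  have ha' := norm_pos_iff.2 ha
  set b := ‖a‖ with hb
  set N : Set (Euc n) := {z : Euc n | ‖z‖ < b / 2} with hN
  set τ : Euc n → ℝ := fun z => 2 * ⟪z, a⟫ / b ^ 2 with hτ
  have hI : IntegrableOn (fun z => reflIncr s a z * ker n s z) {z | ε ≤ ‖z‖} := by
    have hc : Continuous fun z : Euc n => b ^ s * (1 - (max (1 + 2 * ⟪z, a⟫ / b ^ 2) 0) ^ s) := by
      refine continuous_const.mul (continuous_const.sub (Continuous.rpow_const ?_ fun _ => Or.inr hs0.le))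
      exact Continuous.max (by fun_prop) continuous_const
    refine integrableOn_indicator_mul_ker (K := b ^ s * 2) hs0 hε hc (fun z hz => ?_)
      (by positivity)
    have h1 := abs_inner_div_le ha hz
    rw [abs_mul, abs_of_pos (by positivity : 0 < b ^ s)]
    refine mul_le_mul_of_nonneg_left ?_ (by positivity)
    have h2 := max_rpow_le hs0 hs1 (2 * ⟪z, a⟫ / b ^ 2)
    have h3 : |2 * ⟪z, a⟫ / b ^ 2| ^ s ≤ 1 := Real.rpow_le_one (abs_nonneg _) h1 hs0.le
    have h4 : 0 ≤ (max (1 + 2 * ⟪z, a⟫ / b ^ 2) 0) ^ s :=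
      Real.rpow_nonneg (le_max_right _ _) _
    rw [abs_le]; constructor <;> linarith
  refine ⟨hI, ?_⟩
  have hneg : ∫ z in {z : Euc n | ε ≤ ‖z‖}, reflIncr s a (-z) * ker n s (-z) =
      ∫ z in {z | ε ≤ ‖z‖}, reflIncr s a z * ker n s z :=
    setIntegral_comp_neg (neg_mem_far ε) fun z => reflIncr s a z * ker n s z
  have hInneg : IntegrableOn (fun z => reflIncr s a (-z) * ker n s (-z)) {z | ε ≤ ‖z‖} := by
    have := ((Measure.measurePreserving_neg (volume : Measure (Euc n))).integrableOn_comp_preimage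
      (MeasurableEquiv.neg (Euc n)).measurableEmbedding).2 hI
    rwa [show Neg.neg ⁻¹' {z : Euc n | ε ≤ ‖z‖} = {z | ε ≤ ‖z‖} from
      Set.ext (neg_mem_far ε)] at this
  have hsum : ∀ z, reflIncr s a z * ker n s z + reflIncr s a (-z) * ker n s (-z) =
      N.indicator (fun z => b ^ s * secDiff s (τ z)) z * ker n s z := fun z => by
    rw [ker_neg, ← add_mul]
    congr 1
    by_cases h : ‖z‖ < b / 2
    · simp only [reflIncr, indicator, mem_ofPred_eq, norm_neg, ← hb, hN, h, if_true, secDiff, hτ,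
        inner_neg_left]
      ring_nf
    · simp only [reflIncr, indicator, mem_ofPred_eq, norm_neg, ← hb, hN, h, if_false, add_zero]
  set B := closedBall ((1 / 4 : ℝ) • a) (b / 8) with hB
  have hBz : ∀ z ∈ B, b / 8 ≤ ‖z‖ ∧ ‖z‖ ≤ 3 / 8 * b := fun z hz => by
    rw [hB, mem_closedBall, dist_eq_norm] at hz
    have h1 : ‖(1 / 4 : ℝ) • a‖ = b / 4 := by
      rw [norm_smul, Real.norm_of_nonneg (by norm_num)]; ring
    have h2 := norm_sub_norm_le ((1 / 4 : ℝ) • a) z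
    have h3 := norm_sub_norm_le z ((1 / 4 : ℝ) • a)
    rw [norm_sub_rev] at h2
    constructor <;> linarith
  have hker := mul_le_setIntegral_ker (s := s) hs0 (by positivity : 0 < b / 8) hBz
  have hkf := (far_ker (n := n) hs0 hε).1
  have hlow : ∀ z, κ * b ^ s * B.indicator (ker n s) z ≤
      reflIncr s a z * ker n s z + reflIncr s a (-z) * ker n s (-z) := fun z => by
    rw [hsum]
    have hk := ker_nonneg s z
    by_cases hz : z ∈ B
    · have hzN : z ∈ N := by
        show ‖z‖ < b / 2
        linarith [(hBz z hz).2]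
      rw [indicator_of_mem hz, indicator_of_mem hzN]
      refine mul_le_mul_of_nonneg_right ?_ hk
      rw [mul_comm]
      refine mul_le_mul_of_nonneg_left ?_ (by positivity)
      refine hmin ?_
      have e1 : ⟪z, a⟫ = b ^ 2 / 4 + ⟪z - (1 / 4 : ℝ) • a, a⟫ := by
        rw [inner_sub_left, real_inner_smul_left, real_inner_self_eq_norm_sq]; ring
      have h2 : |⟪z - (1 / 4 : ℝ) • a, a⟫| ≤ b / 8 * b := by
        refine (abs_real_inner_le_norm _ _).trans ?_
        rw [hB, mem_closedBall, dist_eq_norm] at hz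
        gcongr
      obtain ⟨h3, h4⟩ := abs_le.1 h2
      simp only [hτ, mem_Icc]
      rw [le_div_iff₀ (by positivity), div_le_iff₀ (by positivity), e1]
      constructor <;> nlinarith
    · rw [indicator_of_notMem hz, mul_zero]
      refine mul_nonneg (indicator_nonneg (fun z hz => ?_) z) hk
      exact mul_nonneg (by positivity) (secDiff_nonneg hs0 hs1 (abs_inner_div_le ha hz))
  have hBm : MeasurableSet B := measurableSet_closedBall
  have hBI : IntegrableOn (fun z => κ * b ^ s * B.indicator (ker n s) z) {z | ε ≤ ‖z‖} :=
    (hkf.indicator hBm).const_mul _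
  have hsub : B ⊆ {z : Euc n | ε ≤ ‖z‖} := fun z hz => hεa.trans (hBz z hz).1
  have hmono := integral_mono hBI (hI.add hInneg) hlow
  rw [integral_add' hI hInneg, hneg, integral_const_mul, setIntegral_indicator hBm,
    inter_eq_right.2 hsub] at hmono
  have e2 : b ^ (-s) * c₁ = b ^ s * (V * (b / 8) ^ n * (3 / 8 * b) ^ (-((n : ℝ) + 2 * s))) := by
    rw [hc₁, Real.mul_rpow (by norm_num) ha'.le, div_eq_mul_one_div b, mul_pow]
    have : b ^ (-s) = b ^ s * (b ^ n * b ^ (-((n : ℝ) + 2 * s))) := by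
      rw [← Real.rpow_natCast, ← Real.rpow_add ha', ← Real.rpow_add ha']; ring_nf
    rw [this]; ring
  have h5 : κ * (b ^ (-s) * c₁) ≤ κ * b ^ s * ∫ z in B, ker n s z := by
    rw [e2, ← mul_assoc]
    exact mul_le_mul_of_nonneg_left hker (by positivity)
  linarith

end

section

variable {n : ℕ}

/-- Pointwise coupling inequality at a maximum point of the doubled function
`w x - w y - L |x - y| ^ s - N |x - p| ^ 2`: increments are compared along reflected directions
when short and along equal directions otherwise. -/
theorem coupling_pointwise {s r M L N : ℝ} (hs0 : 0 < s) (hs1 : s < 1) (hr : 0 < r) (hM : 0 < M)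
    {w : Euc n → ℝ} {p x y : Euc n} (hw0 : ∀ y, 0 ≤ w y)
    (hgrow : ∀ y, w y ≤ M * (r + dist y p) ^ s)
    (hmax : ∀ x' ∈ closedBall p r, ∀ y' ∈ closedBall p r,
      w x' - w y' - L * ‖x' - y'‖ ^ s - N * ‖x' - p‖ ^ 2 ≤
        w x - w y - L * ‖x - y‖ ^ s - N * ‖x - p‖ ^ 2)
    (hx : ‖x - p‖ ≤ r / 4) (hxy : x - y ≠ 0) (hxyr : ‖x - y‖ ≤ r / 4) (hpos : 0 ≤ w x - w y)
    (z : Euc n) :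
    L * reflIncr s (x - y) z - N * quad (r / 2) (x - p) z -
        4 * M * {z : Euc n | r / 2 ≤ ‖z‖}.indicator (fun z => ‖z‖ ^ s) z ≤
      (w x - w (x + z)) -
        (w y - w (y + if ‖z‖ < ‖x - y‖ / 2 then (ℝ ∙ (x - y))ᗮ.reflection z else z)) := by
  have ha := norm_pos_iff.2 hxy
  have hy : ‖y - p‖ ≤ r / 2 := by
    have := norm_sub_le (x - p) (x - y)
    rw [show x - p - (x - y) = y - p by abel] at this
    linarith
  have hxz : ‖x + z - p‖ ≤ ‖x - p‖ + ‖z‖ := by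
    rw [show x + z - p = (x - p) + z by abel]; exact norm_add_le _ _
  have hyz : ∀ z', ‖y + z' - p‖ ≤ ‖y - p‖ + ‖z'‖ := fun z' => by
    rw [show y + z' - p = (y - p) + z' by abel]; exact norm_add_le _ _
  rcases lt_or_ge ‖z‖ (‖x - y‖ / 2) with h | h
  · have h2 : ‖z‖ < r / 2 := by linarith
    rw [if_pos h, quad_of_lt _ h2,
      indicator_of_notMem (show z ∉ {z : Euc n | r / 2 ≤ ‖z‖} from not_le.2 h2), reflIncr,
      indicator_of_mem (show z ∈ {z : Euc n | ‖z‖ < ‖x - y‖ / 2} from h)]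
    set R := (ℝ ∙ (x - y))ᗮ.reflection
    have hRz : ‖R z‖ = ‖z‖ := R.norm_map z
    have key := hmax (x + z) (by rw [mem_closedBall, dist_eq_norm]; linarith)
      (y + R z) (by rw [mem_closedBall, dist_eq_norm]; linarith [hyz (R z)])
    have h3 := abs_le.1 (abs_inner_div_le hxy h)
    have e1 : ‖x + z - (y + R z)‖ ^ s =
        ‖x - y‖ ^ s * (max (1 + 2 * ⟪z, x - y⟫ / ‖x - y‖ ^ 2) 0) ^ s := by
      rw [show x + z - (y + R z) = (x - y) + z - R z by abel, norm_sub_reflection,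
        Real.mul_rpow ha.le (abs_nonneg _), max_eq_left (by linarith [h3.1]),
        abs_of_nonneg (by linarith [h3.1])]
    rw [e1, norm_add_sub_sq] at key
    linarith
  rw [if_neg (not_lt.2 h), reflIncr,
    indicator_of_notMem (show z ∉ {z : Euc n | ‖z‖ < ‖x - y‖ / 2} from not_lt.2 h)]
  rcases lt_or_ge ‖z‖ (r / 2) with h2 | h2
  · rw [quad_of_lt _ h2,
      indicator_of_notMem (show z ∉ {z : Euc n | r / 2 ≤ ‖z‖} from not_le.2 h2)]
    have key := hmax (x + z) (by rw [mem_closedBall, dist_eq_norm]; linarith)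
      (y + z) (by rw [mem_closedBall, dist_eq_norm]; linarith [hyz z])
    rw [add_sub_add_right_eq_sub, norm_add_sub_sq] at key
    linarith
  · rw [quad_of_le _ h2, indicator_of_mem (show z ∈ {z : Euc n | r / 2 ≤ ‖z‖} from h2)]
    have h3 : (r + dist (x + z) p) ^ s ≤ 4 * ‖z‖ ^ s := calc
      (r + dist (x + z) p) ^ s ≤ (4 * ‖z‖) ^ s := by
        refine Real.rpow_le_rpow (by positivity) ?_ hs0.le
        rw [dist_eq_norm]; linarith
      _ = 4 ^ s * ‖z‖ ^ s := Real.mul_rpow (by norm_num) (norm_nonneg z)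
      _ ≤ 4 ^ (1 : ℝ) * ‖z‖ ^ s := by gcongr; norm_num
      _ = _ := by rw [Real.rpow_one]
    have h4 := mul_le_mul_of_nonneg_left h3 hM.le
    linarith [hgrow (x + z), hw0 (y + z)]

variable [NeZero n]

/-- Interior Hölder estimate, by the doubling of variables method. -/
theorem exists_interior_holder (n : ℕ) [NeZero n] {s : ℝ} (hs0 : 0 < s) (hs1 : s < 1) :
    ∃ C > 0, ∀ (w : Euc n → ℝ) (p : Euc n) (r M K : ℝ), 0 < r → 0 < M →
      AEStronglyMeasurable w → (∀ y, |w y| ≤ K) → (∀ y, 0 ≤ w y) →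
      ContinuousOn w (closedBall p r) → (∀ y, w y ≤ M * (r + dist y p) ^ s) →
      (∀ y ∈ closedBall p r, ∃ v, |v| ≤ M * r ^ (-s) ∧ Tendsto (trunc s w y) (𝓝[>] 0) (𝓝 v)) →
      ∀ q ∈ closedBall p r, w p - w q ≤ C * M * dist p q ^ s := by
  obtain ⟨c, hc0, hc⟩ := exists_reflIncr_lower n hs0 hs1
  have hA := sphereArea_pos (n := n)
  have h22 : 0 < 2 - 2 * s := by linarith
  set B := 4 + 32 * sphereArea n / (2 - 2 * s) + 8 * sphereArea n / s with hB
  have hB0 : 0 < B := by positivity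
  refine ⟨8 + B / c, by positivity, fun w p r M K hr hM hwm hK hw0 hcont hgrow heq q hq => ?_⟩
  set L := (8 + B / c) * M with hL
  have hL8 : 8 * M ≤ L := by rw [hL]; gcongr; linarith [div_pos hB0 hc0]
  have hL0 : 0 < L := by positivity
  have hLc : B * M < L * c := by
    have : L * c = B * M + 8 * M * c := by rw [hL]; field_simp; ring
    rw [this]; linarith [mul_pos hM hc0]
  set O := 2 * M * r ^ s with hO
  have hrs : 0 < r ^ s := by positivity
  have hO0 : 0 < O := by positivity
  have hwO : ∀ y ∈ closedBall p r, w y ≤ O := fun y hy => by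
    refine (hgrow y).trans ?_
    rw [hO, mul_comm 2 M, mul_assoc]
    refine mul_le_mul_of_nonneg_left ?_ hM.le
    calc (r + dist y p) ^ s ≤ (2 * r) ^ s := by
          refine Real.rpow_le_rpow (by positivity) ?_ hs0.le
          rw [mem_closedBall] at hy; linarith
      _ = 2 ^ s * r ^ s := Real.mul_rpow (by norm_num) hr.le
      _ ≤ 2 ^ (1 : ℝ) * r ^ s := by gcongr; norm_num
      _ = _ := by rw [Real.rpow_one]
  set N := 16 * O / r ^ 2 with hN
  have hN0 : 0 < N := by positivity
  by_contra! hcon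
  have hpq : p ∈ closedBall p r := mem_closedBall_self hr.le
  obtain ⟨⟨x, y⟩, ⟨hxB, hyB⟩, hmax⟩ :=
    ((isCompact_closedBall p r).prod (isCompact_closedBall p r)).exists_isMaxOn
      ⟨(p, p), hpq, hpq⟩
      (f := fun e : Euc n × Euc n =>
        w e.1 - w e.2 - L * ‖e.1 - e.2‖ ^ s - N * ‖e.1 - p‖ ^ 2) (by
      refine ContinuousOn.sub (ContinuousOn.sub (ContinuousOn.sub ?_ ?_) ?_) ?_
      · exact hcont.comp continuousOn_fst fun e he => he.1
      · exact hcont.comp continuousOn_snd fun e he => he.2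
      · refine Continuous.continuousOn (continuous_const.mul
          (Continuous.rpow_const (by fun_prop) fun _ => Or.inr hs0.le))
      · fun_prop)
  have hxB' : x ∈ closedBall p r := hxB
  have hyB' : y ∈ closedBall p r := hyB
  have hmax' : ∀ x' ∈ closedBall p r, ∀ y' ∈ closedBall p r,
      w x' - w y' - L * ‖x' - y'‖ ^ s - N * ‖x' - p‖ ^ 2 ≤
        w x - w y - L * ‖x - y‖ ^ s - N * ‖x - p‖ ^ 2 :=
    fun x' hx' y' hy' => hmax (show (x', y') ∈ closedBall p r ×ˢ closedBall p r from ⟨hx', hy'⟩)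
  have hpos : 0 < w x - w y - L * ‖x - y‖ ^ s - N * ‖x - p‖ ^ 2 := by
    refine lt_of_lt_of_le ?_ (hmax' p hpq q hq)
    rw [sub_self, norm_zero, ← dist_eq_norm]
    linarith
  have hLa : 0 ≤ L * ‖x - y‖ ^ s := by positivity
  have hNx : 0 ≤ N * ‖x - p‖ ^ 2 := by positivity
  have hosc : w x - w y ≤ O := by linarith [hwO x hxB', hw0 y]
  have hxp : ‖x - p‖ ≤ r / 4 := by
    have h1 : N * ‖x - p‖ ^ 2 ≤ O := by linarith
    have h2 : N * (r / 4) ^ 2 = O := by rw [hN]; field_simp; ring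
    rw [← h2] at h1
    exact le_of_sq_le_sq (le_of_mul_le_mul_left h1 hN0) (by positivity)
  have hxy : x - y ≠ 0 := fun h => by
    rw [sub_eq_zero] at h
    rw [h, sub_self] at hpos
    rw [h] at hNx hLa
    linarith
  have ha := norm_pos_iff.2 hxy
  have hxyr : ‖x - y‖ ≤ r / 4 := by
    by_contra! h
    have h1 : (r / 4) ^ s ≤ ‖x - y‖ ^ s := by gcongr
    have h2 : r ^ s / 4 ≤ (r / 4) ^ s := by
      rw [Real.div_rpow hr.le (by norm_num)]
      gcongr
      calc (4 : ℝ) ^ s ≤ 4 ^ (1 : ℝ) := by gcongr; norm_num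
        _ = 4 := Real.rpow_one _
    have h3 : 8 * M * (r ^ s / 4) ≤ L * ‖x - y‖ ^ s := by gcongr; linarith
    linarith
  obtain ⟨v₁, hv₁, hT₁⟩ := heq x hxB'
  obtain ⟨v₂, hv₂, hT₂⟩ := heq y hyB'
  have hrs' : 0 < r ^ (-s) := by positivity
  have hMr : 0 < M * r ^ (-s) := by positivity
  obtain ⟨ε, ⟨h1, h2⟩, hε0, hεa⟩ :=
    (((hT₁.eventually_lt_const (show v₁ < 2 * (M * r ^ (-s)) by linarith [(abs_le.1 hv₁).2])).and
      (hT₂.eventually_const_lt (show -(2 * (M * r ^ (-s))) < v₂ by linarith [(abs_le.1 hv₂).1]))).and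
      (Ioc_mem_nhdsGT (show 0 < ‖x - y‖ / 8 by positivity))).exists
  have hεr : ε ≤ r / 2 := by linarith
  set R := (ℝ ∙ (x - y))ᗮ.reflection with hR
  have I1 := integrableOn_trunc hs0 hε0 hwm hK x
  have I2 := setIntegral_near_isometry R (δ := ‖x - y‖ / 2)
    (integrableOn_trunc hs0 hε0 hwm hK y)
  have J1 := hc (x - y) hxy ε hε0 hεa
  have J2 := quad_integral (n := n) hs0 hs1 hε0 (half_pos hr) (x - p)
  have J3 := far_rpow_ker (n := n) (s := s) (p := s) (by linarith) (half_pos hr)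
  have hsub : {z : Euc n | r / 2 ≤ ‖z‖} ⊆ {z | ε ≤ ‖z‖} := fun z hz => hεr.trans hz
  have J3' : IntegrableOn ({z : Euc n | r / 2 ≤ ‖z‖}.indicator fun z => ‖z‖ ^ s * ker n s z)
      {z | ε ≤ ‖z‖} :=
    (J3.1.integrable_indicator (measurableSet_far _)).integrableOn
  have hmono := integral_mono (((J1.1.const_mul L).sub (J2.1.const_mul N)).sub
    (J3'.const_mul (4 * M))) (I1.sub I2.1) fun z => by
      have hk := ker_nonneg s z
      have key := mul_le_mul_of_nonneg_right
        (coupling_pointwise hs0 hs1 hr hM hw0 hgrow hmax' hxp hxy hxyr (by linarith) z) hk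
      have hkR : ker n s (if ‖z‖ < ‖x - y‖ / 2 then R z else z) = ker n s z := by
        split_ifs
        · rw [ker, R.norm_map, ker]
        · rfl
      simp only [Pi.sub_apply, hkR]
      rw [← indicator_mul_ker]
      linarith
  rw [integral_sub' ((J1.1.const_mul L).sub (J2.1.const_mul N)) (J3'.const_mul (4 * M)),
    integral_sub' (J1.1.const_mul L) (J2.1.const_mul N), integral_sub' I1 I2.1, I2.2,
    integral_const_mul, integral_const_mul, integral_const_mul,
    setIntegral_indicator (measurableSet_far _), inter_eq_right.2 hsub, J3.2] at hmono
  rw [trunc] at h1 h2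
  have k1 := mul_le_mul_of_nonneg_left J1.2 hL0.le
  have k2 := mul_le_mul_of_nonneg_left J2.2 hN0.le
  have k3 : r ^ (-s) ≤ ‖x - y‖ ^ (-s) :=
    Real.rpow_le_rpow_of_nonpos ha (by linarith) (by linarith)
  have k4 : N * (sphereArea n * ((r / 2) ^ (2 - 2 * s) / (2 - 2 * s))) ≤
      32 * sphereArea n / (2 - 2 * s) * (M * r ^ (-s)) := by
    have e1 : (r / 2) ^ (2 - 2 * s) ≤ r ^ (2 - 2 * s) := by gcongr; linarith
    have e2 : r ^ (2 - 2 * s) = r ^ 2 * r ^ (-s) / r ^ s := by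
      rw [← Real.rpow_two, ← Real.rpow_add hr, ← Real.rpow_sub hr]; ring_nf
    calc N * (sphereArea n * ((r / 2) ^ (2 - 2 * s) / (2 - 2 * s)))
        ≤ N * (sphereArea n * (r ^ (2 - 2 * s) / (2 - 2 * s))) := by gcongr
      _ = _ := by rw [e2, hN, hO]; field_simp; ring
  have k5 : 4 * M * (sphereArea n * ((r / 2) ^ (s - 2 * s) / (2 * s - s))) ≤
      8 * sphereArea n / s * (M * r ^ (-s)) := by
    have e1 : (r / 2) ^ (s - 2 * s) ≤ 2 * r ^ (-s) := by
      rw [show s - 2 * s = -s by ring, Real.div_rpow hr.le (by norm_num),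
        Real.rpow_neg (by norm_num : (0 : ℝ) ≤ 2), div_inv_eq_mul, mul_comm]
      gcongr
      calc (2 : ℝ) ^ s ≤ 2 ^ (1 : ℝ) := by gcongr; norm_num
        _ = 2 := Real.rpow_one _
    rw [show 2 * s - s = s by ring]
    calc 4 * M * (sphereArea n * ((r / 2) ^ (s - 2 * s) / s))
        ≤ 4 * M * (sphereArea n * (2 * r ^ (-s) / s)) := by gcongr
      _ = _ := by field_simp; ring
  have k6 : L * (c * r ^ (-s)) ≤ L * (c * ‖x - y‖ ^ (-s)) := by gcongr
  have k7 := mul_lt_mul_of_pos_right hLc hrs'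
  have k8 : B * M * r ^ (-s) = 4 * (M * r ^ (-s)) +
    32 * sphereArea n / (2 - 2 * s) * (M * r ^ (-s)) + 8 * sphereArea n / s * (M * r ^ (-s)) := by
    rw [hB]; ring
  linarith

end

/-- `C^s` regularity up to the boundary for the localized problem. -/
theorem exists_holder_localized (n : ℕ) [NeZero n] {s ρ : ℝ} (hs0 : 0 < s) (hs1 : s < 1)
    (hρ : 0 < ρ) (hρ1 : ρ ≤ 1 / 8) :
    ∃ C > 0, ∀ (K : ℝ) (Ω : Set (Euc n)) (x₀ : Euc n) (w : Euc n → ℝ),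
      IsLocalized s ρ K Ω x₀ w → ∀ p ∈ Ω ∩ ball x₀ (1 / 2), ∀ q,
        w p - w q ≤ C * K * dist p q ^ s := by
  obtain ⟨C₀, hC₀, hgrowth⟩ := exists_growth n hs0 hs1 hρ hρ1
  obtain ⟨C₁, hC₁, h_int⟩ := exists_interior_holder n hs0 hs1
  refine ⟨2 * C₀ * (C₁ + 1), by positivity, fun K Ω x₀ w h p hp q => ?_⟩
  have hK := h.pos
  have hpx : dist p x₀ < 1 / 2 := hp.2
  obtain ⟨z₀, hz₀, hd0, hdx, hball⟩ := exists_nearest_frontier h.isOpen hp.1 h.notMem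
  set d := dist p z₀ with hd
  have hz₀x : dist z₀ x₀ ≤ 3 / 2 := by linarith [dist_triangle z₀ p x₀, dist_comm z₀ p]
  have hg := hgrowth K Ω x₀ w h z₀ hz₀ hz₀x
  have hpow : ∀ t : ℝ, 0 ≤ t → (2 * t) ^ s ≤ 2 * t ^ s := fun t ht => by
    rw [Real.mul_rpow (by norm_num) ht]
    gcongr
    calc (2 : ℝ) ^ s ≤ 2 ^ (1 : ℝ) := by gcongr; norm_num
      _ = 2 := Real.rpow_one _
  have hCK : 0 < C₀ * K := by positivity
  have hq0 : 0 ≤ dist p q ^ s := by positivity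
  rcases le_or_gt (dist p q) (d / 2) with hpq | hpq
  · have hsub : closedBall p (d / 2) ⊆ Ω ∩ ball x₀ 3 := fun y hy => by
      rw [mem_closedBall] at hy
      exact ⟨hball (by rw [mem_ball]; linarith),
        by rw [mem_ball]; linarith [dist_triangle y p x₀]⟩
    have key := h_int w p (d / 2) (2 * (C₀ * K)) K (half_pos hd0) (by positivity) h.meas h.abs_le
      h.nonneg (h.continuousOn.mono hsub) (fun y => ?_) (fun y hy => ?_) q
      (by rwa [mem_closedBall, dist_comm])
    · have : C₁ * (2 * (C₀ * K)) * dist p q ^ s ≤ 2 * C₀ * (C₁ + 1) * K * dist p q ^ s := by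
        have : 0 ≤ 2 * C₀ * K * dist p q ^ s := by positivity
        linarith
      linarith
    · refine (hg y).trans ?_
      have h1 : dist y z₀ ^ s ≤ 2 * (d / 2 + dist y p) ^ s := by
        refine le_trans ?_ (hpow _ (by positivity))
        refine Real.rpow_le_rpow dist_nonneg ?_ hs0.le
        linarith [dist_triangle y p z₀, dist_nonneg (x := y) (y := p)]
      have := mul_le_mul_of_nonneg_left h1 hCK.le
      linarith
    · obtain ⟨v, hv, hT⟩ := h.eqn y (hsub hy)
      refine ⟨v, hv.trans ?_, hT⟩
      have h1 : 1 ≤ (d / 2) ^ (-s) :=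
        Real.one_le_rpow_of_pos_of_le_one_of_nonpos (half_pos hd0) (by linarith) (by linarith)
      have h2 : 1 * K ≤ 2 * (C₀ * K) := by rw [← mul_assoc]; gcongr; linarith
      calc K = 1 * K * 1 := by ring
        _ ≤ _ := by gcongr
  · have h1 : d ^ s ≤ 2 * dist p q ^ s :=
      (Real.rpow_le_rpow hd0.le (by linarith) hs0.le).trans (hpow _ dist_nonneg)
    have h2 := mul_le_mul_of_nonneg_left h1 hCK.le
    have h3 : C₀ * K * (2 * dist p q ^ s) ≤ 2 * C₀ * (C₁ + 1) * K * dist p q ^ s := by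
      have : 0 ≤ 2 * C₀ * C₁ * K * dist p q ^ s := by positivity
      linarith
    linarith [hg p, h.nonneg q]

section

theorem _root_.TwoSidedBallAt.mono {n : ℕ} {Ω : Set (Euc n)} {ρ ρ' : ℝ} {z : Euc n}
    (h : TwoSidedBallAt n Ω ρ z) (hρ : ρ' ≤ ρ) : TwoSidedBallAt n Ω ρ' z := by
  obtain ⟨ν, hν, h1, h2⟩ := h
  have e : ‖(ρ' - ρ) • ν‖ = ρ - ρ' := by
    rw [norm_smul, hν, mul_one, Real.norm_of_nonpos (by linarith)]; ring
  refine ⟨ν, hν, (ball_subset_ball' ?_).trans h1, (ball_subset_ball' ?_).trans h2⟩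
  · rw [dist_eq_norm, add_sub_add_left_eq_sub, ← sub_smul, e]; linarith
  · rw [dist_eq_norm, sub_sub_sub_cancel_left, norm_sub_rev, ← sub_smul, e]; linarith

theorem _root_.C11LocOn.continuousOn {n : ℕ} {u : Euc n → ℝ} {U : Set (Euc n)}
    (h : C11LocOn n u U) : ContinuousOn u U := fun x hx => by
  obtain ⟨ε, hε, -, hc, -⟩ := h x hx
  exact (hc.continuousOn.continuousAt (ball_mem_nhds x hε)).continuousWithinAt

variable {n : ℕ}

theorem _root_.MemL2s.integrableOn_mul_ker {s : ℝ} (hs0 : 0 < s) {u : Euc n → ℝ}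
    (h : MemL2s n s u) (x : Euc n) {ε : ℝ} (hε : 0 < ε) :
    IntegrableOn (fun z => u (x + z) * ker n s z) {z | ε ≤ ‖z‖} := by
  have hN : 0 < (n : ℝ) + 2 * s := by positivity
  set N : ℝ := (n : ℝ) + 2 * s with hNdef
  set C := (ε ^ N)⁻¹ + (1 + ‖x‖ / ε) ^ N with hC
  have hI : Integrable fun z => C * (|u (x + z)| / (1 + ‖x + z‖ ^ N)) :=
    ((measurePreserving_add_left volume x).integrable_comp_of_integrable h.2).const_mul C
  have hm : AEStronglyMeasurable (fun z => u (x + z) * ker n s z) :=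
    (h.1.aestronglyMeasurable.comp_measurePreserving (measurePreserving_add_left volume x)).mul
      (measurable_ker s).aestronglyMeasurable
  refine hI.integrableOn.mono' hm.restrict
    ((ae_restrict_iff' (measurableSet_far ε)).2 (.of_forall fun z (hz : ε ≤ ‖z‖) => ?_))
  have hz0 : 0 < ‖z‖ := hε.trans_le hz
  have h1 : 1 + ‖x + z‖ ^ N ≤ C * ‖z‖ ^ N := by
    have h2 : ‖x + z‖ ≤ (1 + ‖x‖ / ε) * ‖z‖ := by
      have : ‖x‖ / ε * ε ≤ ‖x‖ / ε * ‖z‖ := by gcongr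
      rw [div_mul_cancel₀ _ hε.ne'] at this
      linarith [norm_add_le x z]
    have h3 : ‖x + z‖ ^ N ≤ (1 + ‖x‖ / ε) ^ N * ‖z‖ ^ N := by
      rw [← Real.mul_rpow (by positivity) hz0.le]; gcongr
    have h4 : 1 ≤ (ε ^ N)⁻¹ * ‖z‖ ^ N := by
      rw [← div_eq_inv_mul, one_le_div (by positivity)]; gcongr
    rw [hC, add_mul]; linarith
  rw [Real.norm_eq_abs, abs_mul, abs_of_nonneg (ker_nonneg s z), ker, Real.rpow_neg hz0.le,
    ← mul_div_assoc, ← div_eq_mul_inv, div_le_div_iff₀ (by positivity) (by positivity)]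
  have := mul_le_mul_of_nonneg_left h1 (abs_nonneg (u (x + z)))
  linarith

variable [NeZero n]

/-- A nonnegative solution bounded by `Ku` near a ball touching the boundary has a tail controlled
by the data: evaluate the equation where a paraboloid touches from below. -/
theorem exists_tail_bound {s r g₀ Ku : ℝ} (hs0 : 0 < s) (hs1 : s < 1) (hr : 0 < r)
    {u : Euc n → ℝ} {p : Euc n} (hu0 : ∀ y, 0 ≤ u y) (hu : MemL2s n s u)
    (hcont : ContinuousOn u (closedBall p r)) (hKu : ∀ y ∈ closedBall p r, u y ≤ Ku)
    (heq : ∀ y ∈ closedBall p r, ∃ v, -g₀ ≤ v ∧ Tendsto (trunc s u y) (𝓝[>] 0) (𝓝 v)) :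
    ∃ x ∈ closedBall p r, ∫ z in {z : Euc n | 1 ≤ ‖z‖}, u (x + z) * ker n s z ≤
      g₀ + Ku * (sphereArea n / (r ^ 2 * (2 - 2 * s)) + sphereArea n / (2 * s)) := by
  have hpp : p ∈ closedBall p r := mem_closedBall_self hr.le
  have hKu0 : 0 ≤ Ku := (hu0 p).trans (hKu p hpp)
  have hA := sphereArea_pos (n := n)
  have h22 : 0 < 2 - 2 * s := by linarith
  obtain ⟨x, hx, hmin⟩ := (isCompact_closedBall p r).exists_isMinOn ⟨p, hpp⟩
    (f := fun y => u y - Ku * (1 - ‖y - p‖ ^ 2 / r ^ 2)) (hcont.sub (by fun_prop))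
  have hminB : ∀ y ∈ closedBall p r, u x - Ku * (1 - ‖x - p‖ ^ 2 / r ^ 2) ≤
    u y - Ku * (1 - ‖y - p‖ ^ 2 / r ^ 2) := hmin
  have hmin' : ∀ y, u x - Ku * (1 - ‖x - p‖ ^ 2 / r ^ 2) ≤
      u y - Ku * (1 - ‖y - p‖ ^ 2 / r ^ 2) := fun y => by
    by_cases hy : y ∈ closedBall p r
    · exact hminB y hy
    · have h1 := hminB p hpp
      rw [sub_self, norm_zero, zero_pow two_ne_zero, zero_div, sub_zero, mul_one] at h1
      rw [mem_closedBall, not_le, dist_eq_norm] at hy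
      have h2 : 1 ≤ ‖y - p‖ ^ 2 / r ^ 2 := by
        rw [one_le_div (by positivity)]; gcongr
      have h3 := mul_nonneg hKu0 (sub_nonneg.2 h2)
      linarith [hu0 y, hKu p hpp]
  refine ⟨x, hx, ?_⟩
  obtain ⟨v, hv, hT⟩ := heq x hx
  set J := ∫ z in {z : Euc n | 1 ≤ ‖z‖}, u (x + z) * ker n s z with hJ
  suffices hle : v ≤ Ku * (sphereArea n / (r ^ 2 * (2 - 2 * s)) + sphereArea n / (2 * s)) - J by
    linarith
  refine le_of_tendsto hT ?_
  filter_upwards [Ioc_mem_nhdsGT one_pos] with ε hε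
  obtain ⟨hε0, hε1⟩ := hε
  have Iu := hu.integrableOn_mul_ker hs0 x hε0
  have Ik := (far_ker (n := n) hs0 hε0).1
  have I4 : IntegrableOn (fun z => (u x - u (x + z)) * ker n s z) {z | ε ≤ ‖z‖} := by
    simp only [sub_mul]; exact (Ik.const_mul _).sub Iu
  have Q := quad_integral (n := n) hs0 hs1 hε0 one_pos (x - p)
  set F : Set (Euc n) := {z | 1 ≤ ‖z‖} with hF
  have hFm : MeasurableSet F := measurableSet_far 1
  have I3 : IntegrableOn (fun z => F.indicator
      (fun z => Ku * ker n s z - u (x + z) * ker n s z) z) {z | ε ≤ ‖z‖} :=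
    ((Ik.const_mul Ku).sub Iu).indicator hFm
  have hmono := integral_mono I4 ((Q.1.const_mul (Ku / r ^ 2)).add I3) fun z => by
    have hk := ker_nonneg s z
    simp only [Pi.add_apply]
    rcases lt_or_ge ‖z‖ 1 with h | h
    · rw [quad_of_lt _ h, indicator_of_notMem (show z ∉ F from not_le.2 h)]
      have h1 := hmin' (x + z)
      rw [norm_add_sub_sq] at h1
      have h2 : u x - u (x + z) ≤ Ku / r ^ 2 * (2 * ⟪z, x - p⟫ + ‖z‖ ^ 2) := by
        have e1 : Ku * (1 - ‖x - p‖ ^ 2 / r ^ 2) -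
            Ku * (1 - (‖x - p‖ ^ 2 + (2 * ⟪z, x - p⟫ + ‖z‖ ^ 2)) / r ^ 2) =
            Ku / r ^ 2 * (2 * ⟪z, x - p⟫ + ‖z‖ ^ 2) := by ring
        linarith
      have := mul_le_mul_of_nonneg_right h2 hk
      linarith
    · rw [quad_of_le _ h, indicator_of_mem (show z ∈ F from h)]
      have := mul_le_mul_of_nonneg_right (hKu x hx) hk
      linarith
  have hsub : F ⊆ {z : Euc n | ε ≤ ‖z‖} := fun z hz => hε1.trans hz
  have K1 := far_ker (n := n) hs0 one_pos
  rw [integral_add' (Q.1.const_mul _) I3, integral_const_mul, setIntegral_indicator hFm,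
    inter_eq_right.2 hsub, integral_sub (K1.1.const_mul Ku) (Iu.mono_set hsub),
    integral_const_mul, K1.2, Real.one_rpow, ← hJ] at hmono
  have hQ := Q.2
  rw [Real.one_rpow] at hQ
  have hQ' := mul_le_mul_of_nonneg_left hQ (show 0 ≤ Ku / r ^ 2 by positivity)
  have e2 : Ku * (sphereArea n / (r ^ 2 * (2 - 2 * s)) + sphereArea n / (2 * s)) =
      Ku / r ^ 2 * (sphereArea n * (1 / (2 - 2 * s))) + Ku * (sphereArea n * (1 / (2 * s))) := by
    field_simp
  rw [trunc, e2]
  linarith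

end

/-- Truncating a solution away from `x₀` produces a localized solution. -/
theorem exists_isLocalized (n : ℕ) [NeZero n] {s ρ : ℝ} (hs0 : 0 < s) (hs1 : s < 1)
    (hρ : 0 < ρ) (hρ1 : ρ ≤ 1 / 8) :
    ∃ C > 0, ∀ (Ω : Set (Euc n)) (x₀ : Euc n) (u g : Euc n → ℝ) (Kg Ku : ℝ), IsOpen Ω →
      x₀ ∈ frontier Ω → (∀ z ∈ frontier Ω ∩ closedBall x₀ 4, TwoSidedBallAt n Ω ρ z) →
      (∀ x, 0 ≤ u x) → C11LocOn n u (Ω ∩ ball x₀ 4) → MemL2s n s u →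
      (∀ x ∈ Ω ∩ ball x₀ 4, HasFracLapAt n s u x (g x)) → (∀ x ∈ ball x₀ 4 \ Ω, u x = 0) →
      (∀ x ∈ Ω ∩ ball x₀ 4, |g x| ≤ Kg) → (∀ x ∈ Ω ∩ ball x₀ 4, u x ≤ Ku) →
      0 ≤ Kg → 0 ≤ Ku → 0 < Kg + Ku →
      IsLocalized s ρ (C * (Kg + Ku)) Ω x₀ ((ball x₀ (7 / 2)).indicator u) := by
  have hA := sphereArea_pos (n := n)
  have h22 : 0 < 2 - 2 * s := by linarith
  have hc := fracC_pos n hs0 hs1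
  have hN : 0 < (n : ℝ) + 2 * s := by positivity
  set N : ℝ := (n : ℝ) + 2 * s with hNdef
  set B := sphereArea n / ((ρ / 2) ^ 2 * (2 - 2 * s)) + sphereArea n / (2 * s) with hB
  have hB0 : 0 < B := by positivity
  have h8 : (0 : ℝ) < 8 ^ N := by positivity
  refine ⟨1 + (1 + 8 ^ N) / fracC n s + 8 ^ N * B, by positivity,
    fun Ω x₀ u g Kg Ku hΩ hx₀ hT hu0 hC11 hL heq hzero hg hKu hKg0 hKu0 hK => ?_⟩
  have hcont := hC11.continuousOn
  have hKK : Kg / fracC n s + 8 ^ N * (Kg / fracC n s + Ku * B) + Ku ≤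
      (1 + (1 + 8 ^ N) / fracC n s + 8 ^ N * B) * (Kg + Ku) := by
    have : 0 ≤ Kg + (1 + 8 ^ N) / fracC n s * Ku + 8 ^ N * B * Kg := by positivity
    have e : (1 + (1 + 8 ^ N) / fracC n s + 8 ^ N * B) * (Kg + Ku) =
      Kg / fracC n s + 8 ^ N * (Kg / fracC n s + Ku * B) + Ku +
        (Kg + (1 + 8 ^ N) / fracC n s * Ku + 8 ^ N * B * Kg) := by ring
    linarith
  have hlap : ∀ x ∈ Ω ∩ ball x₀ 4, |g x / fracC n s| ≤ Kg / fracC n s ∧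
      Tendsto (trunc s u x) (𝓝[>] 0) (𝓝 (g x / fracC n s)) := fun x hx =>
    ⟨by rw [abs_div, abs_of_pos hc]; gcongr; exact hg x hx, tendsto_trunc hs0 hs1 (heq x hx)⟩
  have hb : ball x₀ (7 / 2) ⊆ ball x₀ 4 := ball_subset_ball (by norm_num)
  set E : Set (Euc n) := (ball x₀ (7 / 2))ᶜ with hE
  have hEm : MeasurableSet E := measurableSet_ball.compl
  have hEd : ∀ y ∈ E, 7 / 2 ≤ dist y x₀ := fun y hy => not_lt.1 hy
  -- the tail of `u`
  obtain ⟨x₁, hx₁, htail⟩ : ∃ x₁ ∈ ball x₀ (1 / 2), ∫ y in E, u y * ker n s (y - x₁) ≤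
      Kg / fracC n s + Ku * B := by
    obtain ⟨ν, hν, h_int, -⟩ := hT x₀ ⟨hx₀, mem_closedBall_self (by norm_num)⟩
    have hsub : closedBall (x₀ + ρ • ν) (ρ / 2) ⊆ Ω ∩ ball x₀ (1 / 2) := fun y hy => by
      rw [mem_closedBall] at hy
      refine ⟨h_int (by rw [mem_ball]; linarith), ?_⟩
      have h1 := dist_triangle y (x₀ + ρ • ν) x₀
      rw [dist_self_add_left, norm_smul, hν, mul_one, Real.norm_of_nonneg hρ.le] at h1
      rw [mem_ball]; linarith
    have hsub4 : closedBall (x₀ + ρ • ν) (ρ / 2) ⊆ Ω ∩ ball x₀ 4 :=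
      hsub.trans (inter_subset_inter_right _ (ball_subset_ball (by norm_num)))
    obtain ⟨x, hx, hJ⟩ := exists_tail_bound (g₀ := Kg / fracC n s) hs0 hs1 (half_pos hρ) hu0 hL
      (hcont.mono hsub4) (fun y hy => hKu y (hsub4 hy)) fun y hy =>
        ⟨_, (abs_le.1 (hlap y (hsub4 hy)).1).1, (hlap y (hsub4 hy)).2⟩
    refine ⟨x, (hsub hx).2, le_trans ?_ hJ⟩
    have hxx : dist x x₀ < 1 / 2 := (hsub hx).2
    rw [← setIntegral_translate x fun y => u y * ker n s (y - x)]
    simp only [add_sub_cancel_left]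
    refine setIntegral_mono_set (hL.integrableOn_mul_ker hs0 x one_pos)
      (.of_forall fun z => mul_nonneg (hu0 _) (ker_nonneg s z)) (LE.le.eventuallyLE ?_)
    intro z hz
    have h1 := hEd _ hz
    have h2 := dist_triangle (x + z) x x₀
    rw [dist_self_add_left] at h2
    show 1 ≤ ‖z‖
    linarith
  have hx₁x : dist x₁ x₀ < 1 / 2 := hx₁
  refine ⟨hΩ, hx₀, hT, by positivity, indicator_nonneg fun y _ => hu0 y, fun y => ?_,
    fun y hy => ?_, ?_, hL.1.aestronglyMeasurable.indicator measurableSet_ball, fun x hx => ?_⟩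
  · have hKu' : Ku ≤ (1 + (1 + 8 ^ N) / fracC n s + 8 ^ N * B) * (Kg + Ku) := by
      have : 0 ≤ Kg / fracC n s + 8 ^ N * (Kg / fracC n s + Ku * B) := by positivity
      linarith
    refine le_trans ?_ hKu'
    by_cases hy : y ∈ ball x₀ (7 / 2)
    · rw [indicator_of_mem hy]
      by_cases hyΩ : y ∈ Ω
      · exact hKu y ⟨hyΩ, hb hy⟩
      · rw [hzero y ⟨hb hy, hyΩ⟩]; exact hKu0
    · rw [indicator_of_notMem hy]; exact hKu0
  · by_cases h : y ∈ ball x₀ (7 / 2)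
    · rw [indicator_of_mem h, hzero y ⟨hb h, hy⟩]
    · rw [indicator_of_notMem h]
  · refine (hcont.mono ?_).congr fun y hy => indicator_of_mem ?_ u
    · exact inter_subset_inter_right _ (ball_subset_ball (by norm_num))
    · exact ball_subset_ball (by norm_num) hy.2
  · have hx4 : x ∈ Ω ∩ ball x₀ 4 := ⟨hx.1, ball_subset_ball (by norm_num) hx.2⟩
    have hxx : dist x x₀ < 3 := hx.2
    obtain ⟨hgx, hTx⟩ := hlap x hx4
    set τ := ∫ y in E, u y * ker n s (y - x) with hτ
    have hfar : (fun z => x + z) ⁻¹' E ⊆ {z : Euc n | 1 / 2 ≤ ‖z‖} := fun z hz => by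
      have h1 := hEd _ hz
      have h2 := dist_triangle (x + z) x x₀
      rw [dist_self_add_left] at h2
      show 1 / 2 ≤ ‖z‖
      linarith
    have hfar' : (fun z => x₁ + z) ⁻¹' E ⊆ {z : Euc n | 1 / 2 ≤ ‖z‖} := fun z hz => by
      have h1 := hEd _ hz
      have h2 := dist_triangle (x₁ + z) x₁ x₀
      rw [dist_self_add_left] at h2
      show 1 / 2 ≤ ‖z‖
      linarith
    have h_int : ∀ x' : Euc n, (fun z => x' + z) ⁻¹' E ⊆ {z : Euc n | 1 / 2 ≤ ‖z‖} →
        IntegrableOn (fun y => u y * ker n s (y - x')) E := fun x' h => by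
      rw [← integrableOn_translate x']
      simp only [add_sub_cancel_left]
      exact (hL.integrableOn_mul_ker hs0 x' (by norm_num)).mono_set h
    have hτ0 : 0 ≤ τ := setIntegral_nonneg hEm fun y _ => mul_nonneg (hu0 y) (ker_nonneg s _)
    have hτ1 : τ ≤ 8 ^ N * (Kg / fracC n s + Ku * B) := by
      refine le_trans ?_ (mul_le_mul_of_nonneg_left htail h8.le)
      rw [← integral_const_mul]
      refine setIntegral_mono_on (h_int x hfar) ((h_int x₁ hfar').const_mul _) hEm fun y hy => ?_
      have h1 := hEd y hy
      have h2 := dist_triangle y x x₀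
      have h3 := dist_triangle y x₀ x₁
      have h4 := dist_triangle y x₁ x₀
      rw [dist_comm x₀ x₁] at h3
      rw [dist_eq_norm y x] at h2
      rw [dist_eq_norm y x₁] at h3 h4
      have h5 : ker n s (y - x) ≤ 8 ^ N * ker n s (y - x₁) := by
        have h6 : 8⁻¹ * ‖y - x₁‖ ≤ ‖y - x‖ := by linarith
        have h7 : 0 < ‖y - x₁‖ := by linarith
        have h8 := Real.rpow_le_rpow_of_nonpos (z := -N) (by positivity) h6 (by linarith)
        rwa [Real.mul_rpow (by norm_num) h7.le, Real.inv_rpow (by norm_num),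
          Real.rpow_neg (x := 8) (by norm_num), inv_inv] at h8
      have := mul_le_mul_of_nonneg_left h5 (hu0 y)
      linarith
    refine ⟨g x / fracC n s + τ, ?_, ?_⟩
    · refine le_trans ?_ hKK
      refine (abs_add_le _ _).trans ?_
      rw [abs_of_nonneg hτ0]
      linarith
    · refine (hTx.add_const τ).congr' ?_
      filter_upwards [Ioc_mem_nhdsGT (show (0 : ℝ) < 1 / 2 by norm_num)] with ε hε
      have hε0 : 0 < ε := hε.1
      have hsub : (fun z => x + z) ⁻¹' E ⊆ {z : Euc n | ε ≤ ‖z‖} := fun z hz =>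
        hε.2.trans (hfar hz)
      have hPm : MeasurableSet ((fun z => x + z) ⁻¹' E) := hEm.preimage (by fun_prop)
      have Iu := hL.integrableOn_mul_ker hs0 x hε0
      have Ik := (far_ker (n := n) hs0 hε0).1
      have I4 : IntegrableOn (fun z => (u x - u (x + z)) * ker n s z) {z | ε ≤ ‖z‖} := by
        simp only [sub_mul]; exact (Ik.const_mul _).sub Iu
      have e1 : τ = ∫ z in {z : Euc n | ε ≤ ‖z‖},
          ((fun z => x + z) ⁻¹' E).indicator (fun z => u (x + z) * ker n s z) z := by
        rw [setIntegral_indicator hPm, inter_eq_right.2 hsub, hτ,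
          ← setIntegral_translate x fun y => u y * ker n s (y - x)]
        simp only [add_sub_cancel_left]
      rw [e1, trunc, trunc, ← integral_add I4 (Iu.indicator hPm)]
      congr 1
      ext z
      rw [indicator_of_mem (show x ∈ ball x₀ (7 / 2) from
        ball_subset_ball (by norm_num) hx.2)]
      by_cases hz : x + z ∈ ball x₀ (7 / 2)
      · rw [indicator_of_mem hz, indicator_of_notMem (show z ∉ (fun z => x + z) ⁻¹' E from
          fun h => h hz), add_zero]
      · rw [indicator_of_notMem hz, indicator_of_mem (show z ∈ (fun z => x + z) ⁻¹' E from hz)]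
        ring

end FracLap

/-- local boundary `C^s` regularity for nonnegative solutions:
if `Ω` is a domain with locally `C^{1,1}` boundary, `x₀ ∈ ∂Ω`, `g ∈ L^∞(Ω ∩ B₄(x₀))`, and
`u ∈ C^{1,1}_{loc}(Ω ∩ B₄) ∩ L_{2s}` is a nonnegative classical solution of `(-Δ)^s u = g` in
`Ω ∩ B₄` with `u = 0` in `B₄ \ Ω`, then
`‖u‖_{C^s(Ω ∩ B_{1/2})} ≤ C (‖g‖_{L^∞(Ω∩B₄)} + ‖u‖_{L^∞(Ω∩B₄)})`, where `C` depends only on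
`n`, `s` and the local `C^{1,1}` norm of `∂Ω` (encoded by the two-sided ball radius `ρ`). -/
theorem boundary_Cs_regularity
    (n : ℕ) (hn : 1 ≤ n) (s : ℝ) (hs0 : 0 < s) (hs1 : s < 1) (ρ : ℝ) (hρ : 0 < ρ) :
    ∃ C : ℝ, 0 < C ∧
      ∀ (Ω : Set (Euc n)), IsOpen Ω → IsConnected Ω →
        ∀ x₀ ∈ frontier Ω,
          (∀ z ∈ frontier Ω ∩ closedBall x₀ 4, TwoSidedBallAt n Ω ρ z) →
          ∀ (u g : Euc n → ℝ) (Kg Ku : ℝ),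
            (∀ x, 0 ≤ u x) →
            C11LocOn n u (Ω ∩ ball x₀ 4) →
            MemL2s n s u →
            (∀ x ∈ Ω ∩ ball x₀ 4, HasFracLapAt n s u x (g x)) →
            (∀ x ∈ ball x₀ 4 \ Ω, u x = 0) →
            (∀ x ∈ Ω ∩ ball x₀ 4, |g x| ≤ Kg) →
            (∀ x ∈ Ω ∩ ball x₀ 4, u x ≤ Ku) →
            HolderBoundOn n s u (Ω ∩ ball x₀ (1/2)) (C * (Kg + Ku)) := by
  have : NeZero n := ⟨by omega⟩
  obtain ⟨C₁, hC₁, hH⟩ := FracLap.exists_holder_localized n hs0 hs1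
    (lt_min hρ (by norm_num : (0 : ℝ) < 1 / 8)) (min_le_right ρ (1 / 8))
  obtain ⟨C₂, hC₂, hloc⟩ := FracLap.exists_isLocalized n hs0 hs1
    (lt_min hρ (by norm_num : (0 : ℝ) < 1 / 8)) (min_le_right ρ (1 / 8))
  refine ⟨1 + C₁ * C₂, by positivity, ?_⟩
  intro Ω hΩ _ x₀ hx₀ hT u g Kg Ku hu0 hC11 hL heq hzero hg hKu
  have hsub : Ω ∩ ball x₀ (1 / 2) ⊆ Ω ∩ ball x₀ 4 :=
    inter_subset_inter_right _ (ball_subset_ball (by norm_num))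
  have hball : ball x₀ (1 / 2) ⊆ ball x₀ (7 / 2) := ball_subset_ball (by norm_num)
  have hKg0 : ∀ x ∈ Ω ∩ ball x₀ (1 / 2), 0 ≤ Kg := fun x hx =>
    (abs_nonneg _).trans (hg x (hsub hx))
  have hKu0 : ∀ x ∈ Ω ∩ ball x₀ (1 / 2), 0 ≤ Ku := fun x hx =>
    (hu0 x).trans (hKu x (hsub hx))
  have hCC : 0 < C₁ * C₂ := by positivity
  refine ⟨fun x hx => ?_, fun x hx y hy => ?_⟩
  · have h1 := hKg0 x hx
    have h2 := hKu0 x hx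
    have h3 := hKu x (hsub hx)
    have h4 : 0 ≤ C₁ * C₂ * (Kg + Ku) := by positivity
    rw [abs_of_nonneg (hu0 x)]
    linarith
  · have h1 := hKg0 x hx
    have h2 := hKu0 x hx
    have hd : 0 ≤ dist x y ^ s := by positivity
    rcases (add_nonneg h1 h2).eq_or_lt with h0 | hK
    · have hux : u x = 0 := le_antisymm ((hKu x (hsub hx)).trans (by linarith)) (hu0 x)
      have huy : u y = 0 := le_antisymm ((hKu y (hsub hy)).trans (by linarith)) (hu0 y)
      simp [hux, huy, ← h0]
    have hw := hloc Ω x₀ u g Kg Ku hΩ hx₀ (fun z hz => (hT z hz).mono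
      (min_le_left _ _)) hu0 hC11 hL heq hzero hg hKu h1 h2 hK
    have hxy := hH _ Ω x₀ _ hw x hx y
    have hyx := hH _ Ω x₀ _ hw y hy x
    rw [indicator_of_mem (hball hx.2), indicator_of_mem (hball hy.2)] at hxy hyx
    rw [dist_comm y x] at hyx
    have hle : C₁ * (C₂ * (Kg + Ku)) * dist x y ^ s
        ≤ (1 + C₁ * C₂) * (Kg + Ku) * dist x y ^ s :=
      mul_le_mul_of_nonneg_right (by linarith) hd
    exact abs_sub_le_iff.2 ⟨hxy.trans hle, hyx.trans hle⟩
end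
end

section
/- Let n ≥ 1, s ∈ (0,1), R > 0, and let Ω ⊂ B_R(0) be a bounded domain. Let g ∈ L^∞(Ω) and let u ∈ C^{1,1}_{loc}(Ω) ∩ L_{2s} ∩ C(ℝⁿ) be a classical solution of (-Δ)^s u = g in Ω with u = 0 in Ω^c. Then ‖u‖_{L^∞(ℝⁿ)} ≤ C R^{2s} ‖g‖_{L^∞(Ω)}, where C depends only on n and s; in fact one may take C = 1/a, where a > 0 is the constant value of (-Δ)^s ψ in B_1(0) for the barrier ψ(x) = (1 − |x|²)_+^s. -/
open MeasureTheory Metric Set Filter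
open scoped Topology NNReal ENNReal RealInnerProductSpace

noncomputable section

theorem fracC_pos (n : ℕ) {s : ℝ} (hs0 : 0 < s) (hs1 : s < 1) : 0 < fracC n s := by
  have h1 : 0 < Real.Gamma ((n : ℝ) / 2 + s) := Real.Gamma_pos_of_pos (by positivity)
  have h2 : 0 < Real.Gamma (1 - s) := Real.Gamma_pos_of_pos (by linarith)
  have := Real.pi_pos
  unfold fracC
  positivity

theorem measurableSet_le_dist {n : ℕ} (x : Euc n) (ε : ℝ) :
    MeasurableSet {y : Euc n | ε ≤ dist x y} :=
  (isClosed_le continuous_const (continuous_const.dist continuous_id)).measurableSet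

/-- The truncated integrand of the fractional Laplacian of a bounded continuous function is
integrable. -/
theorem integrableOn_fracLap_kernel {n : ℕ} {p : ℝ} (hp : (n : ℝ) < p) {w : Euc n → ℝ}
    (hw : Continuous w) {M : ℝ} (hM : ∀ y, |w y| ≤ M) (x : Euc n) {ε : ℝ} (hε : 0 < ε) :
    IntegrableOn (fun y => (w x - w y) / dist x y ^ p) {y : Euc n | ε ≤ dist x y} := by
  have hp0 : 0 < p := lt_of_le_of_lt (Nat.cast_nonneg n) hp
  have hM0 : 0 ≤ M := (abs_nonneg _).trans (hM x)
  have hint : Integrable (fun y : Euc n => (1 + ‖x - y‖) ^ (-p)) := by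
    have h : Integrable (fun y : Euc n => (1 + ‖y‖) ^ (-p)) :=
      integrable_one_add_norm (by simpa using hp)
    exact h.comp_sub_left x
  refine Integrable.mono' (hint.const_mul (2 * M * (1 / ε + 1) ^ p)).integrableOn ?_ ?_
  · refine Measurable.aestronglyMeasurable ?_
    have := hw.measurable
    fun_prop
  · refine (ae_restrict_iff' (measurableSet_le_dist x ε)).2 (Eventually.of_forall fun y hy => ?_)
    have hy' : ε ≤ dist x y := hy
    have hd : 0 < dist x y := hε.trans_le hy'
    have hnum : |w x - w y| ≤ 2 * M := by
      have h1 := abs_sub (w x) (w y)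
      have h2 := hM x
      have h3 := hM y
      linarith
    have hle : 1 + dist x y ≤ (1 / ε + 1) * dist x y := by
      have : 1 ≤ 1 / ε * dist x y := by
        rw [one_div, inv_mul_eq_div, le_div_iff₀ hε]
        linarith
      linarith
    have hpow : (1 + dist x y) ^ p ≤ (1 / ε + 1) ^ p * dist x y ^ p := by
      rw [← Real.mul_rpow (by positivity) hd.le]
      exact Real.rpow_le_rpow (by positivity) hle hp0.le
    rw [Real.norm_eq_abs, abs_div, abs_of_pos (Real.rpow_pos_of_pos hd p), ← dist_eq_norm,
      Real.rpow_neg (by positivity), ← div_eq_mul_inv,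
      div_le_div_iff₀ (by positivity) (by positivity)]
    calc |w x - w y| * (1 + dist x y) ^ p
        ≤ 2 * M * ((1 / ε + 1) ^ p * dist x y ^ p) := by gcongr
      _ = _ := by ring

theorem HasFracLapAt.const_mul {n : ℕ} {s : ℝ} {u : Euc n → ℝ} {x : Euc n} {v : ℝ}
    (h : HasFracLapAt n s u x v) (c : ℝ) : HasFracLapAt n s (fun y => c * u y) x (c * v) := by
  unfold HasFracLapAt at h ⊢
  refine (Tendsto.const_mul c h).congr fun ε => ?_
  rw [mul_left_comm, ← integral_const_mul]
  congr 2
  ext y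
  ring

theorem HasFracLapAt.sub {n : ℕ} {s : ℝ} (hs0 : 0 < s) {u w : Euc n → ℝ} {x : Euc n} {a b : ℝ}
    (hu : HasFracLapAt n s u x a) (hw : HasFracLapAt n s w x b)
    (huc : Continuous u) (hwc : Continuous w) {A B : ℝ}
    (hA : ∀ y, |u y| ≤ A) (hB : ∀ y, |w y| ≤ B) :
    HasFracLapAt n s (fun y => u y - w y) x (a - b) := by
  unfold HasFracLapAt at *
  refine (hu.sub hw).congr' ?_
  filter_upwards [self_mem_nhdsWithin] with ε hε
  have hp : (n : ℝ) < n + 2 * s := by linarith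
  rw [← mul_sub, ← integral_sub (integrableOn_fracLap_kernel hp huc hA x hε)
    (integrableOn_fracLap_kernel hp hwc hB x hε)]
  congr 2
  ext y
  ring

/-- Scaling of the fractional Laplacian. -/
theorem HasFracLapAt.comp_smul {n : ℕ} {s : ℝ} {u : Euc n → ℝ} {x : Euc n} {v c : ℝ}
    (hc : 0 < c) (h : HasFracLapAt n s u (c • x) v) :
    HasFracLapAt n s (fun y => u (c • y)) x (c ^ (2 * s) * v) := by
  unfold HasFracLapAt at *
  have hlim : Tendsto (fun ε : ℝ => c * ε) (𝓝[>] 0) (𝓝[>] 0) := by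
    refine tendsto_nhdsWithin_iff.2 ⟨?_, ?_⟩
    · have : Tendsto (fun ε : ℝ => c * ε) (𝓝 0) (𝓝 (c * 0)) := tendsto_id.const_mul c
      rw [mul_zero] at this
      exact this.mono_left nhdsWithin_le_nhds
    · filter_upwards [self_mem_nhdsWithin] with ε hε
      exact mul_pos hc hε
  refine ((h.comp hlim).const_mul (c ^ (2 * s))).congr fun ε => ?_
  simp only [Function.comp]
  rw [mul_left_comm]
  congr 1
  rw [← integral_indicator (measurableSet_le_dist _ _),
    ← integral_indicator (measurableSet_le_dist _ _)]
  have key := Measure.integral_comp_smul (volume : Measure (Euc n))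
    ({y : Euc n | c * ε ≤ dist (c • x) y}.indicator
      fun y => (u (c • x) - u y) / dist (c • x) y ^ ((n : ℝ) + 2 * s)) c
  have hcn : 0 < c ^ n := pow_pos hc n
  rw [finrank_euclideanSpace_fin, abs_of_pos (inv_pos.2 hcn), smul_eq_mul,
    eq_inv_mul_iff_mul_eq₀ hcn.ne'] at key
  rw [← key, ← mul_assoc, ← integral_const_mul]
  congr 1
  ext y
  have hd : dist (c • x) (c • y) = c * dist x y := by
    rw [dist_smul₀, Real.norm_of_nonneg hc.le]
  simp only [indicator, mem_ofPred_eq, hd, mul_le_mul_iff_right₀ hc]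
  split_ifs
  · rw [Real.mul_rpow hc.le dist_nonneg, Real.rpow_add hc, Real.rpow_natCast]
    have : 0 < c ^ (2 * s) := Real.rpow_pos_of_pos hc _
    field_simp
  · simp

/-- At a positive global maximum of a bounded continuous function which is nonpositive outside a
ball, the fractional Laplacian is positive. -/
theorem HasFracLapAt.pos_of_forall_le {n : ℕ} (hn : 1 ≤ n) {s : ℝ} (hs0 : 0 < s) (hs1 : s < 1)
    {R : ℝ} (hR : 0 < R) {w : Euc n → ℝ} (hwc : Continuous w) {M : ℝ} (hM : ∀ y, |w y| ≤ M)
    (hout : ∀ y ∉ ball (0 : Euc n) R, w y ≤ 0) {x : Euc n} (hx : x ∈ ball (0 : Euc n) R)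
    (hpos : 0 < w x) (hmax : ∀ y, w y ≤ w x) {v : ℝ} (h : HasFracLapAt n s w x v) : 0 < v := by
  have hp : (n : ℝ) < n + 2 * s := by linarith
  have hC := fracC_pos n hs0 hs1
  set f : Euc n → ℝ := fun y => (w x - w y) / dist x y ^ ((n : ℝ) + 2 * s)
  have hf0 : ∀ y, 0 ≤ f y := fun y =>
    div_nonneg (sub_nonneg.2 (hmax y)) (Real.rpow_nonneg dist_nonneg _)
  have hJ : 0 < ∫ y in {y : Euc n | R ≤ dist x y}, f y := by
    rw [setIntegral_pos_iff_support_of_nonneg_ae (Eventually.of_forall hf0)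
      (integrableOn_fracLap_kernel hp hwc hM x hR)]
    let z : Euc n := EuclideanSpace.single ⟨0, hn⟩ (3 * R)
    have hz : ‖z‖ = 3 * R := by
      simp [z, abs_of_pos hR]
    refine (measure_ball_pos volume z hR).trans_le (measure_mono fun y hy => ?_)
    have h1 : ‖z‖ ≤ ‖y‖ + dist y z := by
      rw [dist_comm, dist_eq_norm]
      exact norm_le_insert' z y
    have h2 : ‖y‖ ≤ ‖x‖ + dist x y := by
      rw [dist_comm, dist_eq_norm]
      exact norm_le_insert' y x
    have hy' : dist y z < R := hy
    have hx' : ‖x‖ < R := by simpa using hx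
    have hd : R ≤ dist x y := by linarith
    have hwy : w y ≤ 0 := hout y (by simp; linarith)
    refine ⟨?_, hd⟩
    have : 0 < f y := div_pos (by linarith) (Real.rpow_pos_of_pos (hR.trans_le hd) _)
    exact this.ne'
  refine (mul_pos hC hJ).trans_le (ge_of_tendsto h ?_)
  filter_upwards [Ioo_mem_nhdsGT hR] with ε hε
  refine mul_le_mul_of_nonneg_left ?_ hC.le
  exact setIntegral_mono_set (integrableOn_fracLap_kernel hp hwc hM x hε.1)
    (Eventually.of_forall hf0)
    (Eventually.of_forall fun y (hy : R ≤ dist x y) => (hε.2.le.trans hy : ε ≤ dist x y))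

/-- Comparison of a solution with the rescaled barrier. -/
theorem le_of_fracLap_le {n : ℕ} (hn : 1 ≤ n) {s : ℝ} (hs0 : 0 < s) (hs1 : s < 1)
    {R : ℝ} (hR : 0 < R) {Ω : Set (Euc n)} (hΩR : Ω ⊆ ball 0 R) {a : ℝ} (ha : 0 < a)
    (hψ : ∀ x ∈ ball (0 : Euc n) 1,
      HasFracLapAt n s (fun y => (max (1 - ‖y‖ ^ 2) 0) ^ s) x a)
    {u g : Euc n → ℝ} {K : ℝ} (hK : 0 ≤ K) (hcont : Continuous u)
    (hsol : ∀ x ∈ Ω, HasFracLapAt n s u x (g x)) (hu0 : ∀ x ∉ Ω, u x = 0)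
    (hg : ∀ x ∈ Ω, g x ≤ K) (x : Euc n) : u x ≤ (1 / a) * R ^ (2 * s) * K := by
  set ψ : Euc n → ℝ := fun y => (max (1 - ‖y‖ ^ 2) 0) ^ s
  have hψc : Continuous ψ :=
    ((continuous_const.sub (continuous_norm.pow 2)).max continuous_const).rpow_const
      fun _ => Or.inr hs0.le
  have hψ0 : ∀ y, 0 ≤ ψ y := fun y => Real.rpow_nonneg (le_max_right _ _) _
  have hψ1 : ∀ y, ψ y ≤ 1 := fun y =>
    Real.rpow_le_one (le_max_right _ _) (max_le (by nlinarith [norm_nonneg y]) zero_le_one) hs0.le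
  set c : ℝ := (1 / a) * R ^ (2 * s) * K with hc
  have hc0 : 0 ≤ c := by positivity
  set b : Euc n → ℝ := fun y => c * ψ (R⁻¹ • y)
  have hbc : Continuous b := by fun_prop
  have hb0 : ∀ y, 0 ≤ b y := fun y => mul_nonneg hc0 (hψ0 _)
  have hb1 : ∀ y, b y ≤ c := fun y => mul_le_of_le_one_right hc0 (hψ1 _)
  have hbsol : ∀ y ∈ ball (0 : Euc n) R, HasFracLapAt n s b y K := by
    intro y hy
    have hy' : R⁻¹ • y ∈ ball (0 : Euc n) 1 := by
      rw [mem_ball_zero_iff] at hy ⊢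
      rw [norm_smul, norm_inv, Real.norm_of_nonneg hR.le, inv_mul_lt_iff₀ hR]
      linarith
    have h := ((hψ _ hy').comp_smul (inv_pos.2 hR)).const_mul c
    have hval : c * (R⁻¹ ^ (2 * s) * a) = K := by
      have : 0 < R ^ (2 * s) := Real.rpow_pos_of_pos hR _
      rw [hc, Real.inv_rpow hR.le]
      field_simp
    rwa [hval] at h
  have hout : ∀ y ∉ ball (0 : Euc n) R, u y = 0 := fun y hy => hu0 y fun h => hy (hΩR h)
  have hsupp : HasCompactSupport u :=
    HasCompactSupport.intro (isCompact_closedBall (0 : Euc n) R)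
      fun y hy => hout y fun h => hy (ball_subset_closedBall h)
  obtain ⟨A, hA⟩ := hsupp.exists_bound_of_continuous hcont
  have hBb : ∀ y, |b y| ≤ c := fun y => by rw [abs_of_nonneg (hb0 y)]; exact hb1 y
  refine le_trans ?_ (hb1 x)
  by_contra! hlt
  have hxΩ : ∀ y, b y < u y → y ∈ Ω := by
    intro y hy
    by_contra hy'
    rw [hu0 y hy'] at hy
    exact (hb0 y).not_gt hy
  obtain ⟨x₀, -, hx₀⟩ := (isCompact_closedBall (0 : Euc n) R).exists_isMaxOn
    ⟨x, ball_subset_closedBall (hΩR (hxΩ x hlt))⟩ (hcont.sub hbc).continuousOn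
  have hx₀x : u x - b x ≤ u x₀ - b x₀ := hx₀ (ball_subset_closedBall (hΩR (hxΩ x hlt)))
  have hpos : 0 < u x₀ - b x₀ := by linarith
  have hmax : ∀ y, u y - b y ≤ u x₀ - b x₀ := by
    intro y
    by_cases hy : b y < u y
    · exact hx₀ (ball_subset_closedBall (hΩR (hxΩ y hy)))
    · linarith
  have hx₀Ω : x₀ ∈ Ω := hxΩ x₀ (by linarith)
  have hlap := (hsol x₀ hx₀Ω).sub hs0 (hbsol x₀ (hΩR hx₀Ω)) hcont hbc hA hBb
  have hgpos := hlap.pos_of_forall_le hn hs0 hs1 hR (M := A + c) (hcont.sub hbc)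
    (fun y => (abs_sub _ _).trans (add_le_add (hA y) (hBb y)))
    (fun y hy => by simpa [hout y hy] using hb0 y) (hΩR hx₀Ω) hpos hmax
  linarith [hg x₀ hx₀Ω]

/-- global `L^∞` bound via the barrier `ψ(x) = (1-|x|²)₊^s`:
if `Ω ⊆ B_R(0)` is a bounded domain and `u` is a classical solution of `(-Δ)^s u = g` in
`Ω`, `u = 0` in `Ωᶜ`, then `‖u‖_{L^∞(ℝⁿ)} ≤ (1/a) R^{2s} ‖g‖_{L^∞(Ω)}`, where `a > 0` is
the constant value of `(-Δ)^s ψ` in `B_1(0)`. -/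
theorem global_sup_bound
    (n : ℕ) (hn : 1 ≤ n) (s : ℝ) (hs0 : 0 < s) (hs1 : s < 1)
    (R : ℝ) (hR : 0 < R)
    (Ω : Set (Euc n)) (hΩo : IsOpen Ω) (hΩc : IsConnected Ω) (hΩR : Ω ⊆ ball 0 R)
    (a : ℝ) (ha : 0 < a)
    (hψ : ∀ x ∈ ball (0 : Euc n) 1,
      HasFracLapAt n s (fun y => (max (1 - ‖y‖ ^ 2) 0) ^ s) x a)
    (u g : Euc n → ℝ) (Kg : ℝ)
    (hcont : Continuous u) (hreg : C11LocOn n u Ω) (hL : MemL2s n s u)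
    (hsol : ∀ x ∈ Ω, HasFracLapAt n s u x (g x))
    (hu0 : ∀ x ∉ Ω, u x = 0)
    (hKg : ∀ x ∈ Ω, |g x| ≤ Kg) :
    ∀ x : Euc n, |u x| ≤ (1 / a) * R ^ (2 * s) * Kg := by
  intro x
  obtain ⟨z, hz⟩ := hΩc.nonempty
  have hK : 0 ≤ Kg := (abs_nonneg _).trans (hKg z hz)
  refine abs_le.2 ⟨?_, le_of_fracLap_le hn hs0 hs1 hR hΩR ha hψ hK hcont hsol hu0
    (fun y hy => (abs_le.1 (hKg y hy)).2) x⟩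
  have h := le_of_fracLap_le (u := fun y => -1 * u y) (g := fun y => -1 * g y) hn hs0 hs1 hR hΩR
    ha hψ hK (continuous_const.mul hcont) (fun y hy => (hsol y hy).const_mul (-1))
    (fun y hy => by simp [hu0 y hy]) (fun y hy => by linarith [(abs_le.1 (hKg y hy)).1]) x
  linarith
end
end
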